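/- arXiv:1710.10964 — 10 statements merged into one kernel-verified Lean document; each statement's English description precedes it below -/
import Mathlib

section
/- Let C be a collage system of size c generating a string T. Then T has a string attractor of size at most c. -/
universe u

variable {α : Type*}

/-- `substr T i j` is the 1-based substring `T[i..j]` of `T`. -/
def substr (T : List α) (i j : ℕ) : List α := (T.drop (i - 1)).take (j + 1 - i)

/-- `Γ` is a string attractor of `T` (positions are 1-based): every nonempty
substring `T[i..j]` has an occurrence `T[i'..j'] = T[i..j]` crossing a position of `Γ`. -/
def IsAttractor (T : List α) (Γ : Finset ℕ) : Prop :=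
  (∀ p ∈ Γ, 1 ≤ p ∧ p ≤ T.length) ∧
  ∀ i j : ℕ, 1 ≤ i → i ≤ j → j ≤ T.length →
    ∃ i' j' p : ℕ, 1 ≤ i' ∧ i' ≤ j' ∧ j' ≤ T.length ∧
      substr T i' j' = substr T i j ∧ p ∈ Γ ∧ i' ≤ p ∧ p ≤ j'

/-- A rule of a collage system whose nonterminals are `Fin c`. -/
inductive CRule (α : Type u) (c : ℕ) where
  | term (a : α)
  | cat (A B : Fin c)
  | rep (R : Fin c) (ℓ : ℕ)
  | slice (K : Fin c) (l r : ℕ)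

/-- Validity of the rule of nonterminal `X` with respect to the expansions `exp`;
`rank` is a topological rank witnessing that the derivation relation has no cycles. -/
def CRuleOk {c : ℕ} (rule : Fin c → CRule α c) (exp : Fin c → List α)
    (rank : Fin c → ℕ) (X : Fin c) : Prop :=
  match rule X with
  | .term a => exp X = [a]
  | .cat A B => A ≠ X ∧ B ≠ X ∧ rank A < rank X ∧ rank B < rank X ∧
      exp X = exp A ++ exp B
  | .rep R ℓ => 2 ≤ ℓ ∧ R ≠ X ∧ rank R < rank X ∧
      exp X = (List.replicate ℓ (exp R)).flatten
  | .slice K l r => K ≠ X ∧ rank K < rank X ∧ 1 ≤ l ∧ l ≤ r ∧ r ≤ (exp K).length ∧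
      exp X = substr (exp K) l r

/-- `(rule, exp, rank)` is a valid collage system (one rule per nonterminal, no cycles). -/
def IsCollage {c : ℕ} (rule : Fin c → CRule α c) (exp : Fin c → List α)
    (rank : Fin c → ℕ) : Prop := ∀ X, CRuleOk rule exp rank X

/-- `T` is generated by some collage system of size `c`. -/
def GeneratedByCollage (T : List α) (c : ℕ) : Prop :=
  ∃ (rule : Fin c → CRule α c) (exp : Fin c → List α) (rank : Fin c → ℕ) (S : Fin c),
    IsCollage rule exp rank ∧ exp S = T

namespace CA
open List

variable {ι : Type*}

def Cov (T : List α) (Γ : Finset ℕ) (s : List α) : Prop :=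
  ∃ u v, T = u ++ s ++ v ∧ ∃ q ∈ Γ, u.length < q ∧ q ≤ u.length + s.length

open Classical in
noncomputable def cst (E w : List α) : ℕ :=
  if w = E then 0 else if w <+: E ∨ w <:+ E then 1 else 2

noncomputable def tot (e : ι → List α) (N : List (ι × List α)) : ℕ :=
  (N.map (fun z => cst (e z.1) z.2)).sum

def Red (T : List α) (e : ι → List α) (C : ι → Prop) (X : List α → Prop) (b : ℕ) : Prop :=
  ∃ (Γ : Finset ℕ) (N : List (ι × List α)), (∀ q ∈ Γ, 1 ≤ q ∧ q ≤ T.length) ∧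
    (∀ z ∈ N, C z.1 ∧ z.2 <:+: e z.1 ∧ z.2 <:+: T) ∧ 2 * Γ.card + tot e N ≤ b ∧
    ∀ s, X s → s ≠ [] → Cov T Γ s ∨ ∃ z ∈ N, s <:+: z.2

theorem Cov.mono {T : List α} {Γ Γ' : Finset ℕ} {s : List α} (h : Cov T Γ s) (hs : Γ ⊆ Γ') :
    Cov T Γ' s := by
  obtain ⟨u, v, h1, q, hq, h2⟩ := h
  exact ⟨u, v, h1, q, hs hq, h2⟩

variable {T : List α} {e : ι → List α} {C : ι → Prop}

theorem cst_le_two (E w : List α) : cst E w ≤ 2 := by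
  unfold cst; split_ifs <;> omega

theorem cst_le_one {E w : List α} (h : w <+: E ∨ w <:+ E) : cst E w ≤ 1 := by
  unfold cst; split_ifs <;> omega

theorem cst_self (E : List α) : cst E E = 0 := by simp [cst]

theorem tot_append (e : ι → List α) (N N' : List (ι × List α)) :
    tot e (N ++ N') = tot e N + tot e N' := by simp [tot]

theorem Red.mono {X X' : List α → Prop} {b b' : ℕ} (h : Red T e C X b)
    (hX : ∀ s, s ≠ [] → X' s → X s) (hb : b ≤ b') : Red T e C X' b' := by
  obtain ⟨Γ, N, h1, h2, h3, h4⟩ := h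
  exact ⟨Γ, N, h1, h2, h3.trans hb, fun s hs hn => h4 s (hX s hn hs) hn⟩

theorem Red.union {X X' : List α → Prop} {b b' : ℕ} (h : Red T e C X b)
    (h' : Red T e C X' b') : Red T e C (fun s => X s ∨ X' s) (b + b') := by
  classical
  obtain ⟨Γ, N, h1, h2, h3, h4⟩ := h
  obtain ⟨Γ', N', h1', h2', h3', h4'⟩ := h'
  refine ⟨Γ ∪ Γ', N ++ N', ?_, ?_, ?_, ?_⟩
  · intro q hq
    rcases Finset.mem_union.1 hq with hq | hq
    exacts [h1 q hq, h1' q hq]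
  · intro z hz
    rcases List.mem_append.1 hz with hz | hz
    exacts [h2 z hz, h2' z hz]
  · have := Finset.card_union_le Γ Γ'
    rw [tot_append]; omega
  · rintro s (hs | hs) hn
    · rcases h4 s hs hn with h | ⟨z, hz, h⟩
      · exact Or.inl (h.mono Finset.subset_union_left)
      · exact Or.inr ⟨z, List.mem_append_left _ hz, h⟩
    · rcases h4' s hs hn with h | ⟨z, hz, h⟩
      · exact Or.inl (h.mono Finset.subset_union_right)
      · exact Or.inr ⟨z, List.mem_append_right _ hz, h⟩

theorem Red.none {X : List α → Prop} (h : ∀ s, s ≠ [] → ¬ X s) (b : ℕ) : Red T e C X b :=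
  ⟨∅, [], by simp, by simp, by simp [tot], fun s hs hn => absurd hs (h s hn)⟩

theorem Red.pass' {i : ι} (hi : C i) {w : List α} (h : w <:+: e i) (hT : w <:+: T) :
    Red T e C (fun s => s <:+: w) (cst (e i) w) :=
  ⟨∅, [(i, w)], by simp, by simp [*], by simp [tot], fun s hs _ => Or.inr ⟨(i, w), by simp, hs⟩⟩

theorem Red.pass2 {i : ι} (hi : C i) {w : List α} (h : w <:+: e i) (hT : w <:+: T) :
    Red T e C (fun s => s <:+: w) 2 := (Red.pass' hi h hT).mono (fun _ _ h => h) (cst_le_two _ _)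

theorem Red.pass0 {i : ι} (hi : C i) (hT : e i <:+: T) :
    Red T e C (fun s => s <:+: e i) 0 :=
  (Red.pass' hi (List.infix_refl _) hT).mono (fun _ _ h => h) (cst_self _).le

/-- cost of an optional (possibly empty) string -/
noncomputable def ne (w : List α) : ℕ := if w.length = 0 then 0 else 1

theorem ne_le (w : List α) : ne w ≤ 1 := by unfold ne; split_ifs <;> omega

theorem ne_eq {w : List α} (h : w ≠ []) : ne w = 1 := by
  unfold ne; rw [if_neg]; simpa using h

theorem Red.pass1 {i : ι} (hi : C i) {w : List α} (h : w <+: e i ∨ w <:+ e i) (hT : w <:+: T) :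
    Red T e C (fun s => s <:+: w) (ne w) := by
  by_cases hw : w = []
  · subst hw
    exact Red.none (fun s hs h => hs (List.eq_nil_of_infix_nil h)) _
  · rw [ne_eq hw]
    exact (Red.pass' hi (h.elim (·.isInfix) (·.isInfix)) hT).mono (fun _ _ h => h) (cst_le_one h)

theorem Red.pass2' {i : ι} (hi : C i) {w : List α} (h : w <:+: e i) (hT : w <:+: T) :
    Red T e C (fun s => s <:+: w) (2 * ne w) := by
  by_cases hw : w = []
  · subst hw
    exact Red.none (fun s hs h => hs (List.eq_nil_of_infix_nil h)) _
  · rw [ne_eq hw]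
    exact Red.pass2 hi h hT

def Cr (a b s : List α) : Prop := ∃ x y, x ≠ [] ∧ s = x ++ y ∧ x <:+ a ∧ y <+: b

theorem Red.split {a b : List α} (h : a ++ b <:+: T) : Red T e C (Cr a b) 2 := by
  by_cases ha : a = []
  · subst ha
    refine Red.none ?_ _
    rintro s hs ⟨x, y, hx, rfl, hxa, _⟩
    exact hx (List.suffix_nil.1 hxa)
  obtain ⟨u, v, rfl⟩ := h
  have hl : 0 < a.length := List.length_pos_of_ne_nil ha
  refine ⟨{u.length + a.length}, [], ?_, by simp, by simp [tot], ?_⟩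
  · intro q hq
    simp only [Finset.mem_singleton] at hq
    subst hq
    simp only [List.length_append]
    omega
  · rintro s ⟨x, y, hx, rfl, ⟨a', rfl⟩, ⟨b', rfl⟩⟩ _
    have hl : 0 < x.length := List.length_pos_of_ne_nil hx
    refine Or.inl ⟨u ++ a', b' ++ v, by simp, _, Finset.mem_singleton_self _, ?_, ?_⟩ <;>
      simp only [List.length_append] <;> omega

theorem infix_app {a b s : List α} (h : s <:+: a ++ b) : s <:+: a ∨ s <:+: b ∨ Cr a b s := by
  by_cases ha : s <:+: a
  · exact Or.inl ha
  by_cases hb : s <:+: b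
  · exact Or.inr (Or.inl hb)
  right; right
  obtain ⟨u, v, h⟩ := h
  rw [List.append_assoc] at h
  rcases List.append_eq_append_iff.1 h with ⟨c, hc, hc'⟩ | ⟨c, hc, hc'⟩
  · -- a = u ++ c, s ++ v = c ++ b
    rcases List.append_eq_append_iff.1 hc' with ⟨d, hd, hd'⟩ | ⟨d, hd, hd'⟩
    · exact absurd ⟨u, d, by rw [hc, hd]; simp⟩ ha
    · refine ⟨c, d, ?_, hd, ⟨u, hc.symm⟩, ⟨v, hd'.symm⟩⟩
      rintro rfl
      exact hb ⟨[], v, by simp [hd', hd]⟩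
  · exact absurd ⟨c, v, by rw [hc']; simp⟩ hb

theorem Cr.infix {a b s : List α} (h : Cr a b s) : s <:+: a ++ b := by
  obtain ⟨x, y, hx, rfl, ⟨a', rfl⟩, ⟨b', rfl⟩⟩ := h
  exact ⟨a', b', by simp⟩

theorem Cr.mono {a b a' b' s : List α} (h : Cr a b s) (ha : a <:+ a') (hb : b <+: b') :
    Cr a' b' s := by
  obtain ⟨x, y, hx, hs, h1, h2⟩ := h
  exact ⟨x, y, hx, hs, h1.trans ha, h2.trans hb⟩

theorem max_pre {E p q : List α} (hp : p <+: E) (hq : q <+: E) (hpT : p <:+: T) (hqT : q <:+: T) :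
    ∃ r, r <+: E ∧ r <:+: T ∧ p <+: r ∧ q <+: r := by
  rcases List.prefix_or_prefix_of_prefix hp hq with h | h
  · exact ⟨q, hq, hqT, h, List.prefix_refl _⟩
  · exact ⟨p, hp, hpT, List.prefix_refl _, h⟩

theorem max_suf {E p q : List α} (hp : p <:+ E) (hq : q <:+ E) (hpT : p <:+: T) (hqT : q <:+: T) :
    ∃ r, r <:+ E ∧ r <:+: T ∧ p <:+ r ∧ q <:+ r := by
  rcases List.suffix_or_suffix_of_suffix hp hq with h | h
  · exact ⟨q, hq, hqT, h, List.suffix_refl _⟩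
  · exact ⟨p, hp, hpT, List.suffix_refl _, h⟩

theorem mids (A B : List α) (M : List (List α)) (hT : ∀ m ∈ M, m <:+: T)
    (hM : ∀ m ∈ M, (∃ i, C i ∧ m <:+: e i) ∨ Cr A B m) :
    ∃ x y, x <:+ A ∧ y <+: B ∧ x <:+: T ∧ y <:+: T ∧
      Red T e C (fun t => (∃ m ∈ M, t <:+: m) ∧ ¬ t <:+: x ∧ ¬ t <:+: y) (2 * M.length) := by
  induction M with
  | nil => exact ⟨[], [], List.nil_suffix, List.nil_prefix, List.nil_infix, List.nil_infix,
      Red.none (by simp) _⟩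
  | cons m M ih =>
    obtain ⟨x, y, hx, hy, hxT, hyT, hR⟩ := ih (fun m hm => hT m (List.mem_cons_of_mem _ hm))
      (fun m hm => hM m (List.mem_cons_of_mem _ hm))
    have hmT := hT m List.mem_cons_self
    rcases hM m List.mem_cons_self with ⟨i, hi, hmi⟩ | ⟨a, b, ha, rfl, haA, hbB⟩
    · refine ⟨x, y, hx, hy, hxT, hyT, (hR.union (Red.pass2 hi hmi hmT)).mono ?_ ?_⟩
      · rintro s - ⟨⟨m', hm', hs⟩, h1, h2⟩
        rcases List.mem_cons.1 hm' with rfl | hm'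
        · exact Or.inr hs
        · exact Or.inl ⟨⟨m', hm', hs⟩, h1, h2⟩
      · simp; omega
    · have haT : a <:+: T := (List.prefix_append a b).isInfix.trans hmT
      have hbT : b <:+: T := (List.suffix_append a b).isInfix.trans hmT
      obtain ⟨x', hx', hxT', hxx, hax⟩ := max_suf hx haA hxT haT
      obtain ⟨y', hy', hyT', hyy, hby⟩ := max_pre hy hbB hyT hbT
      refine ⟨x', y', hx', hy', hxT', hyT', (hR.union (Red.split hmT)).mono ?_ ?_⟩
      · rintro s - ⟨⟨m', hm', hs⟩, h1, h2⟩
        rcases List.mem_cons.1 hm' with rfl | hm'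
        · rcases infix_app hs with h | h | h
          · exact absurd (h.trans hax.isInfix) h1
          · exact absurd (h.trans hby.isInfix) h2
          · exact Or.inr h
        · exact Or.inl ⟨⟨m', hm', hs⟩, fun h => h1 (h.trans hxx.isInfix),
            fun h => h2 (h.trans hyy.isInfix)⟩
      · simp; omega

/-- normal form of the demands on one nonterminal -/
theorem normal (E : List α) (D : List (List α)) (hD : ∀ w ∈ D, w <:+: E ∧ w <:+: T)
    (hE : E ∉ D) :
    ∃ (p s : List α) (M : List (List α)), p <+: E ∧ s <:+ E ∧ p <:+: T ∧ s <:+: T ∧ (∀ m ∈ M, m <:+: E ∧ m <:+: T) ∧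
      (∀ w ∈ D, w <:+: p ∨ w <:+: s ∨ w ∈ M) ∧
      ne p + ne s + 2 * M.length ≤ (D.map (cst E)).sum := by
  induction D with
  | nil => exact ⟨[], [], [], by simp, by simp, by simp, by simp, by simp, by simp, by simp [ne]⟩
  | cons w D ih =>
    obtain ⟨p, s, M, hp, hs, hpT, hsT, hM, hw, hc⟩ := ih
      (fun w hw => hD w (List.mem_cons_of_mem _ hw)) (fun h => hE (List.mem_cons_of_mem _ h))
    obtain ⟨hwE, hwT⟩ := hD w List.mem_cons_self
    have hne : w ≠ E := by rintro rfl; exact hE List.mem_cons_self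
    by_cases h1 : w <+: E
    · have hcw : cst E w = 1 := by simp [cst, hne, h1]
      obtain ⟨p', hp', hpT', hpp, hwp⟩ := max_pre hp h1 hpT hwT
      refine ⟨p', s, M, hp', hs, hpT', hsT, hM, ?_, ?_⟩
      · intro v hv
        rcases List.mem_cons.1 hv with rfl | hv
        · exact Or.inl hwp.isInfix
        · exact (hw v hv).imp_left (·.trans hpp.isInfix)
      · have := ne_le p'
        simp [hcw]; omega
    by_cases h2 : w <:+ E
    · have hcw : cst E w = 1 := by simp [cst, hne, h2]
      obtain ⟨s', hs', hsT', hss, hws⟩ := max_suf hs h2 hsT hwT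
      refine ⟨p, s', M, hp, hs', hpT, hsT', hM, ?_, ?_⟩
      · intro v hv
        rcases List.mem_cons.1 hv with rfl | hv
        · exact Or.inr (Or.inl hws.isInfix)
        · exact (hw v hv).imp_right (Or.imp_left (·.trans hss.isInfix))
      · have := ne_le s'
        simp [hcw]; omega
    · have hcw : cst E w = 2 := by simp [cst, hne, h1, h2]
      refine ⟨p, s, w :: M, hp, hs, hpT, hsT, ?_, ?_, ?_⟩
      · intro m hm
        rcases List.mem_cons.1 hm with rfl | hm
        exacts [⟨hwE, hwT⟩, hM m hm]
      · intro v hv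
        rcases List.mem_cons.1 hv with rfl | hv
        · simp
        · rcases hw v hv with h | h | h <;> simp [h]
      · simp [hcw]; omega

theorem pre_app {a b p : List α} (h : p <+: a ++ b) : p <+: a ∨ ∃ p', p = a ++ p' ∧ p' <+: b := by
  rcases List.prefix_or_prefix_of_prefix h (List.prefix_append a b) with h1 | ⟨p', rfl⟩
  · exact Or.inl h1
  · exact Or.inr ⟨p', rfl, (List.prefix_append_right_inj a).1 h⟩

theorem suf_app {a b p : List α} (h : p <:+ a ++ b) : p <:+ b ∨ ∃ p', p = p' ++ b ∧ p' <:+ a := by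
  rcases List.suffix_or_suffix_of_suffix h (List.suffix_append a b) with h1 | ⟨p', rfl⟩
  · exact Or.inl h1
  · obtain ⟨u, hu⟩ := h
    refine Or.inr ⟨p', rfl, u, ?_⟩
    rw [← List.append_assoc] at hu
    exact List.append_cancel_right hu

/-- Generic reduction to the two cases. -/
theorem step_of {E : List α} (hfull : E <:+: T → Red T e C (fun t => t <:+: E) 2)
    (hpart : ∀ (p s : List α) (M : List (List α)), p <+: E → s <:+ E → p <:+: T → s <:+: T →
      (∀ m ∈ M, m <:+: E ∧ m <:+: T) →
      Red T e C (fun t => t <:+: p ∨ t <:+: s ∨ ∃ m ∈ M, t <:+: m)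
        (2 + ne p + ne s + 2 * M.length))
    (D : List (List α)) (hD : ∀ w ∈ D, w <:+: E ∧ w <:+: T) :
    Red T e C (fun t => ∃ w ∈ D, t <:+: w) (2 + (D.map (cst E)).sum) := by
  by_cases hE : E ∈ D
  · refine (hfull (hD E hE).2).mono ?_ (by omega)
    rintro t - ⟨w, hw, ht⟩
    exact ht.trans (hD w hw).1
  · obtain ⟨p, s, M, hp, hs, hpT, hsT, hM, hw, hc⟩ := normal E D hD hE
    refine (hpart p s M hp hs hpT hsT hM).mono ?_ (by omega)
    rintro t - ⟨w, hwD, ht⟩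
    rcases hw w hwD with h | h | h
    · exact Or.inl (ht.trans h)
    · exact Or.inr (Or.inl (ht.trans h))
    · exact Or.inr (Or.inr ⟨w, h, ht⟩)

theorem passM {K : ι} (hK : C K) (M : List (List α)) (h : ∀ m ∈ M, m <:+: e K ∧ m <:+: T) :
    Red T e C (fun t => ∃ m ∈ M, t <:+: m) (2 * M.length) := by
  induction M with
  | nil => exact Red.none (by simp) _
  | cons m M ih =>
    have hm := h m List.mem_cons_self
    refine ((Red.pass2 hK hm.1 hm.2).union (ih (fun m hm => h m (List.mem_cons_of_mem _ hm)))).mono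
      ?_ (by simp; omega)
    rintro s - ⟨m', hm', hs⟩
    rcases List.mem_cons.1 hm' with rfl | hm'
    exacts [Or.inl hs, Or.inr ⟨m', hm', hs⟩]

theorem part_slice {E : List α} {K : ι} (hK : C K) (hE : E <:+: e K) (p s : List α)
    (M : List (List α)) (hp : p <+: E) (hs : s <:+ E) (hpT : p <:+: T) (hsT : s <:+: T)
    (hM : ∀ m ∈ M, m <:+: E ∧ m <:+: T) :
    Red T e C (fun t => t <:+: p ∨ t <:+: s ∨ ∃ m ∈ M, t <:+: m)
        (2 + ne p + ne s + 2 * M.length) := by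
  have := ne_le p
  have := ne_le s
  exact ((Red.pass2' hK (hp.isInfix.trans hE) hpT).union
    ((Red.pass2' hK (hs.isInfix.trans hE) hsT).union
    (passM hK M (fun m hm => ⟨(hM m hm).1.trans hE, (hM m hm).2⟩)))).mono (fun _ _ h => h)
    (by omega)

theorem part_cat {A B : ι} (hA : C A) (hB : C B) (p s : List α)
    (M : List (List α)) (hp : p <+: e A ++ e B) (hs : s <:+ e A ++ e B)
    (hpT : p <:+: T) (hsT : s <:+: T)
    (hM : ∀ m ∈ M, m <:+: e A ++ e B ∧ m <:+: T) :
    Red T e C (fun t => t <:+: p ∨ t <:+: s ∨ ∃ m ∈ M, t <:+: m)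
        (2 + ne p + ne s + 2 * M.length) := by
  obtain ⟨x, y, hx, hy, hxT, hyT, hR⟩ := mids (T := T) (e := e) (C := C) (e A) (e B) M
    (fun m hm => (hM m hm).2) (fun m hm => by
      rcases infix_app (hM m hm).1 with h | h | h
      · exact Or.inl ⟨A, hA, h⟩
      · exact Or.inl ⟨B, hB, h⟩
      · exact Or.inr h)
  have aux : ∀ t, (∃ m ∈ M, t <:+: m) → t <:+: x ∨ t <:+: y ∨
      ((∃ m ∈ M, t <:+: m) ∧ ¬ t <:+: x ∧ ¬ t <:+: y) := fun t ht => by tauto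
  have nx := ne_le x
  have ny := ne_le y
  by_cases hp0 : p <+: e A
  · by_cases hs0 : s <:+ e B
    · refine ((Red.pass1 hA (Or.inl hp0) hpT).union ((Red.pass1 hB (Or.inr hs0) hsT).union
        ((Red.pass1 hA (Or.inr hx) hxT).union ((Red.pass1 hB (Or.inl hy) hyT).union hR)))).mono
        ?_ (by omega)
      rintro t - (h | h | h)
      · exact Or.inl h
      · exact Or.inr (Or.inl h)
      · exact Or.inr (Or.inr (aux t h))
    · obtain ⟨s', rfl, hs'⟩ := (suf_app hs).resolve_left hs0
      have hn : s' ++ e B ≠ [] := fun h => hs0 (h ▸ List.nil_suffix)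
      rw [ne_eq hn]
      have hsT' : s' <:+: T := (List.prefix_append _ _).isInfix.trans hsT
      have hBT : e B <:+: T := (List.suffix_append _ _).isInfix.trans hsT
      obtain ⟨r, hr, hrT, hxr, hsr⟩ := max_suf hx hs' hxT hsT'
      have nr := ne_le r
      refine ((Red.pass1 hA (Or.inl hp0) hpT).union ((Red.pass0 hB hBT).union
        ((Red.pass1 hA (Or.inr hr) hrT).union ((Red.split hsT).union hR)))).mono ?_ (by omega)
      rintro t - (h | h | h)
      · exact Or.inl h
      · rcases infix_app h with h | h | h
        · exact Or.inr (Or.inr (Or.inl (h.trans hsr.isInfix)))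
        · exact Or.inr (Or.inl h)
        · exact Or.inr (Or.inr (Or.inr (Or.inl h)))
      · rcases aux t h with h | h | h
        · exact Or.inr (Or.inr (Or.inl (h.trans hxr.isInfix)))
        · exact Or.inr (Or.inl (h.trans hy.isInfix))
        · exact Or.inr (Or.inr (Or.inr (Or.inr h)))
  · obtain ⟨p', rfl, hp'⟩ := (pre_app hp).resolve_left hp0
    have hn : e A ++ p' ≠ [] := fun h => hp0 (h ▸ List.nil_prefix)
    rw [ne_eq hn]
    have hAT : e A <:+: T := (List.prefix_append _ _).isInfix.trans hpT
    have hpT' : p' <:+: T := (List.suffix_append _ _).isInfix.trans hpT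
    by_cases hs0 : s <:+ e B
    · obtain ⟨r, hr, hrT, hyr, hpr⟩ := max_pre hy hp' hyT hpT'
      have nr := ne_le r
      refine ((Red.pass1 hB (Or.inr hs0) hsT).union ((Red.pass0 hA hAT).union
        ((Red.pass1 hB (Or.inl hr) hrT).union ((Red.split hpT).union hR)))).mono ?_ (by omega)
      rintro t - (h | h | h)
      · rcases infix_app h with h | h | h
        · exact Or.inr (Or.inl h)
        · exact Or.inr (Or.inr (Or.inl (h.trans hpr.isInfix)))
        · exact Or.inr (Or.inr (Or.inr (Or.inl h)))
      · exact Or.inl h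
      · rcases aux t h with h | h | h
        · exact Or.inr (Or.inl (h.trans hx.isInfix))
        · exact Or.inr (Or.inr (Or.inl (h.trans hyr.isInfix)))
        · exact Or.inr (Or.inr (Or.inr (Or.inr h)))
    · obtain ⟨s', rfl, hs'⟩ := (suf_app hs).resolve_left hs0
      have hn : s' ++ e B ≠ [] := fun h => hs0 (h ▸ List.nil_suffix)
      rw [ne_eq hn]
      have hBT : e B <:+: T := (List.suffix_append _ _).isInfix.trans hsT
      refine ((Red.pass0 hA hAT).union ((Red.pass0 hB hBT).union
        ((Red.split hpT).union ((Red.split hsT).union hR)))).mono ?_ (by omega)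
      rintro t - (h | h | h)
      · rcases infix_app h with h | h | h
        · exact Or.inl h
        · exact Or.inr (Or.inl (h.trans hp'.isInfix))
        · exact Or.inr (Or.inr (Or.inl h))
      · rcases infix_app h with h | h | h
        · exact Or.inl (h.trans hs'.isInfix)
        · exact Or.inr (Or.inl h)
        · exact Or.inr (Or.inr (Or.inr (Or.inl h)))
      · rcases aux t h with h | h | h
        · exact Or.inl (h.trans hx.isInfix)
        · exact Or.inr (Or.inl (h.trans hy.isInfix))
        · exact Or.inr (Or.inr (Or.inr (Or.inr h)))

theorem full_cat {A B : ι} (hA : C A) (hB : C B) (hT : e A ++ e B <:+: T) :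
    Red T e C (fun t => t <:+: e A ++ e B) 2 := by
  refine ((Red.pass0 hA ((List.prefix_append _ _).isInfix.trans hT)).union
    ((Red.pass0 hB ((List.suffix_append _ _).isInfix.trans hT)).union (Red.split hT))).mono
    ?_ (by omega)
  intro t _ h
  exact infix_app h

/-! ### Repetitions -/

def pw (V : List α) (l : ℕ) : List α := (List.replicate l V).flatten

theorem pw_succ (V : List α) (l : ℕ) : pw V (l + 1) = V ++ pw V l := by
  simp [pw, List.replicate_succ]

theorem pw_succ' (V : List α) (l : ℕ) : pw V (l + 1) = pw V l ++ V := by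
  simp [pw, List.replicate_succ']

theorem pw_pre (V : List α) (l : ℕ) : pw V l <+: pw V (l + 1) := by
  rw [pw_succ']; exact List.prefix_append _ _

theorem pw_suf (V : List α) (l : ℕ) : pw V l <:+ pw V (l + 1) := by
  rw [pw_succ]; exact List.suffix_append _ _

theorem norm_left (V : List α) (l : ℕ) {m : List α} (h : m <:+: pw V l) :
    m <:+: V ∨ Cr V (pw V l) m := by
  induction l with
  | zero =>
    left
    simp [pw] at h
    subst h; exact List.nil_infix
  | succ l ih =>
    have h' := h
    rw [pw_succ] at h'
    rcases infix_app h' with h | h | h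
    · exact Or.inl h
    · exact (ih h).imp_right (·.mono (List.suffix_refl _) (pw_pre V l))
    · exact Or.inr (h.mono (List.suffix_refl _) (pw_pre V l))

theorem norm_right (V : List α) (l : ℕ) {m : List α} (h : m <:+: pw V l) :
    m <:+: V ∨ Cr (pw V l) V m := by
  induction l with
  | zero =>
    left
    simp [pw] at h
    subst h; exact List.nil_infix
  | succ l ih =>
    have h' := h
    rw [pw_succ'] at h'
    rcases infix_app h' with h | h | h
    · exact (ih h).imp_right (·.mono (pw_suf V l) (List.prefix_refl _))
    · exact Or.inl h
    · exact Or.inr (h.mono (pw_suf V l) (List.prefix_refl _))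

/-- prefixes of a power: one crossing position is enough -/
theorem pre_pow {V p' : List α} {t : List α} (l : ℕ) : ∀ q : List α, q <+: pw V l →
    q <+: V ++ p' → t <:+: q → t <:+: V ∨ Cr V p' t := by
  induction l with
  | zero =>
    intro q hq _ ht
    simp [pw] at hq
    subst hq
    exact Or.inl (ht.trans List.nil_infix)
  | succ l ih =>
    intro q hq hqp ht
    have hq0 := hq
    rw [pw_succ] at hq
    rcases pre_app hq with h | ⟨q', rfl, hq'⟩
    · exact Or.inl (ht.trans h.isInfix)
    · rcases infix_app ht with h | h | h
      · exact Or.inl h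
      · exact ih q' hq' ((List.prefix_of_prefix_length_le (hq'.trans (pw_pre V l)) hq0
          (by simp)).trans hqp) h
      · exact Or.inr (h.mono (List.suffix_refl _) ((List.prefix_append_right_inj V).1 hqp))

theorem suf_pow {V p' : List α} {t : List α} (l : ℕ) : ∀ q : List α, q <:+ pw V l →
    q <:+ p' ++ V → t <:+: q → t <:+: V ∨ Cr p' V t := by
  induction l with
  | zero =>
    intro q hq _ ht
    simp [pw] at hq
    subst hq
    exact Or.inl (ht.trans List.nil_infix)
  | succ l ih =>
    intro q hq hqp ht
    have hq0 := hq
    rw [pw_succ'] at hq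
    rcases suf_app hq with h | ⟨q', rfl, hq'⟩
    · exact Or.inl (ht.trans h.isInfix)
    · rcases infix_app ht with h | h | h
      · exact ih q' hq' ((List.suffix_of_suffix_length_le (hq'.trans (pw_suf V l)) hq0
          (by simp)).trans hqp) h
      · exact Or.inl h
      · refine Or.inr (h.mono ?_ (List.prefix_refl _))
        obtain ⟨u, hu⟩ := hqp
        rw [← List.append_assoc] at hu
        exact ⟨u, List.append_cancel_right hu⟩

/-- a prefix of a power containing the base: cost 2 -/
theorem red_pre {R : ι} (hR : C R) {l : ℕ} {p : List α} (hp : p <+: pw (e R) l)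
    (hV : e R <+: p) (hT : p <:+: T) : Red T e C (fun t => t <:+: p ∨ t <:+: e R) 2 := by
  obtain ⟨p', rfl⟩ := hV
  refine ((Red.pass0 hR ((List.prefix_append _ _).isInfix.trans hT)).union
    (Red.split hT)).mono ?_ (by omega)
  rintro t - (h | h)
  · exact pre_pow l _ hp (List.prefix_refl _) h
  · exact Or.inl h

theorem red_suf {R : ι} (hR : C R) {l : ℕ} {p : List α} (hp : p <:+ pw (e R) l)
    (hV : e R <:+ p) (hT : p <:+: T) : Red T e C (fun t => t <:+: p ∨ t <:+: e R) 2 := by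
  obtain ⟨p', rfl⟩ := hV
  refine ((Red.pass0 hR ((List.suffix_append _ _).isInfix.trans hT)).union
    (Red.split hT)).mono ?_ (by omega)
  rintro t - (h | h)
  · exact suf_pow l _ hp (List.suffix_refl _) h
  · exact Or.inl h

theorem full_rep {R : ι} (hR : C R) {l : ℕ} (hl : 2 ≤ l) (hT : pw (e R) l <:+: T) :
    Red T e C (fun t => t <:+: pw (e R) l) 2 := by
  obtain ⟨k, rfl⟩ : ∃ k, l = k + 1 := ⟨l - 1, by omega⟩
  refine (red_pre hR (List.prefix_refl _) ?_ hT).mono (fun _ _ h => Or.inl h) le_rfl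
  rw [pw_succ]; exact List.prefix_append _ _

theorem pre_cmp {V p : List α} {l : ℕ} (hp : p <+: pw V l) : p <+: V ∨ V <+: p := by
  cases l with
  | zero => simp [pw] at hp; subst hp; exact Or.inl List.nil_prefix
  | succ l =>
    rw [pw_succ] at hp
    exact List.prefix_or_prefix_of_prefix hp (List.prefix_append _ _)

theorem suf_cmp {V p : List α} {l : ℕ} (hp : p <:+ pw V l) : p <:+ V ∨ V <:+ p := by
  cases l with
  | zero => simp [pw] at hp; subst hp; exact Or.inl List.nil_suffix
  | succ l =>
    rw [pw_succ'] at hp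
    exact List.suffix_or_suffix_of_suffix hp (List.suffix_append _ _)

theorem mids_left {R : ι} (hR : C R) {l : ℕ} (M : List (List α))
    (hM : ∀ m ∈ M, m <:+: pw (e R) l ∧ m <:+: T) :
    ∃ x y, x <:+ e R ∧ y <+: pw (e R) l ∧ x <:+: T ∧ y <:+: T ∧
      Red T e C (fun t => (∃ m ∈ M, t <:+: m) ∧ ¬ t <:+: x ∧ ¬ t <:+: y) (2 * M.length) :=
  mids _ _ M (fun m hm => (hM m hm).2) (fun m hm =>
    (norm_left _ _ (hM m hm).1).imp_left (fun h => ⟨R, hR, h⟩))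

theorem mids_right {R : ι} (hR : C R) {l : ℕ} (M : List (List α))
    (hM : ∀ m ∈ M, m <:+: pw (e R) l ∧ m <:+: T) :
    ∃ x y, x <:+ pw (e R) l ∧ y <+: e R ∧ x <:+: T ∧ y <:+: T ∧
      Red T e C (fun t => (∃ m ∈ M, t <:+: m) ∧ ¬ t <:+: x ∧ ¬ t <:+: y) (2 * M.length) :=
  mids _ _ M (fun m hm => (hM m hm).2) (fun m hm =>
    (norm_right _ _ (hM m hm).1).imp_left (fun h => ⟨R, hR, h⟩))

/-- long prefix together with arbitrary infixes -/
theorem rep_pre {R : ι} (hR : C R) {l : ℕ} (p : List α) (M : List (List α))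
    (hp : p <+: pw (e R) l) (hV : e R <+: p) (hpT : p <:+: T)
    (hM : ∀ m ∈ M, m <:+: pw (e R) l ∧ m <:+: T) :
    Red T e C (fun t => t <:+: p ∨ ∃ m ∈ M, t <:+: m) (2 + 2 * M.length) := by
  obtain ⟨x, y, hx, hy, hxT, hyT, hRed⟩ := mids_left hR M hM
  obtain ⟨r, hr, hrT, hpr, hyr⟩ := max_pre hp hy hpT hyT
  refine ((red_pre hR hr (hV.trans hpr) hrT).union hRed).mono ?_ le_rfl
  rintro t - (h | h)
  · exact Or.inl (Or.inl (h.trans hpr.isInfix))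
  · by_cases h1 : t <:+: x
    · exact Or.inl (Or.inr (h1.trans hx.isInfix))
    by_cases h2 : t <:+: y
    · exact Or.inl (Or.inl (h2.trans hyr.isInfix))
    exact Or.inr ⟨h, h1, h2⟩

theorem rep_suf {R : ι} (hR : C R) {l : ℕ} (p : List α) (M : List (List α))
    (hp : p <:+ pw (e R) l) (hV : e R <:+ p) (hpT : p <:+: T)
    (hM : ∀ m ∈ M, m <:+: pw (e R) l ∧ m <:+: T) :
    Red T e C (fun t => t <:+: p ∨ ∃ m ∈ M, t <:+: m) (2 + 2 * M.length) := by
  obtain ⟨x, y, hx, hy, hxT, hyT, hRed⟩ := mids_right hR M hM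
  obtain ⟨r, hr, hrT, hpr, hxr⟩ := max_suf hp hx hpT hxT
  refine ((red_suf hR hr (hV.trans hpr) hrT).union hRed).mono ?_ le_rfl
  rintro t - (h | h)
  · exact Or.inl (Or.inl (h.trans hpr.isInfix))
  · by_cases h1 : t <:+: y
    · exact Or.inl (Or.inr (h1.trans hy.isInfix))
    by_cases h2 : t <:+: x
    · exact Or.inl (Or.inl (h2.trans hxr.isInfix))
    exact Or.inr ⟨h, h2, h1⟩

theorem rep_none {R : ι} (hR : C R) {l : ℕ} (M : List (List α))
    (hM : ∀ m ∈ M, m <:+: pw (e R) l ∧ m <:+: T) :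
    Red T e C (fun t => ∃ m ∈ M, t <:+: m) (2 + 2 * M.length) := by
  obtain ⟨x, y, hx, hy, hxT, hyT, hRed⟩ := mids_left hR M hM
  have nx := ne_le x
  have ny := ne_le y
  rcases pre_cmp hy with h | h
  · refine ((Red.pass1 hR (Or.inr hx) hxT).union ((Red.pass1 hR (Or.inl h) hyT).union
      hRed)).mono ?_ (by omega)
    intro t _ ht
    tauto
  · refine ((red_pre hR hy h hyT).union hRed).mono ?_ (by omega)
    intro t _ ht
    have : t <:+: x → t <:+: e R := fun h => h.trans hx.isInfix
    tauto

theorem part_rep {R : ι} (hR : C R) {l : ℕ} (p s : List α)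
    (M : List (List α)) (hp : p <+: pw (e R) l) (hs : s <:+ pw (e R) l)
    (hpT : p <:+: T) (hsT : s <:+: T)
    (hM : ∀ m ∈ M, m <:+: pw (e R) l ∧ m <:+: T) :
    Red T e C (fun t => t <:+: p ∨ t <:+: s ∨ ∃ m ∈ M, t <:+: m)
        (2 + ne p + ne s + 2 * M.length) := by
  by_cases hp0 : p <+: e R
  · by_cases hs0 : s <:+ e R
    · exact ((Red.pass1 hR (Or.inl hp0) hpT).union ((Red.pass1 hR (Or.inr hs0) hsT).union
        (rep_none hR M hM))).mono (fun _ _ h => h) (by omega)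
    · exact ((Red.pass1 hR (Or.inl hp0) hpT).union (rep_suf hR s M hs
        ((suf_cmp hs).resolve_left hs0) hsT hM)).mono (fun _ _ h => h) (by omega)
  · have hV := (pre_cmp hp).resolve_left hp0
    have hn : p ≠ [] := fun h => hp0 (h ▸ List.nil_prefix)
    rw [ne_eq hn]
    by_cases hs0 : s = []
    · refine (rep_pre hR p M hp hV hpT hM).mono ?_ (by omega)
      rintro t ht (h | h | h)
      · exact Or.inl h
      · subst hs0; exact absurd (List.eq_nil_of_infix_nil h) ht
      · exact Or.inr h
    · rw [ne_eq hs0]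
      refine (rep_pre hR p (s :: M) hp hV hpT ?_).mono ?_ (by simp; omega)
      · intro m hm
        rcases List.mem_cons.1 hm with rfl | hm
        exacts [⟨hs.isInfix, hsT⟩, hM m hm]
      · rintro t - (h | h | ⟨m, hm, h⟩)
        · exact Or.inl h
        · exact Or.inr ⟨s, List.mem_cons_self, h⟩
        · exact Or.inr ⟨m, List.mem_cons_of_mem _ hm, h⟩

theorem step_term (a : α) (D : List (List α)) (hD : ∀ w ∈ D, w <:+: [a] ∧ w <:+: T) :
    Red T e C (fun t => ∃ w ∈ D, t <:+: w) (2 + (D.map (cst [a])).sum) := by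
  by_cases h : [a] <:+: T
  · refine (Red.split (a := [a]) (b := []) (by simpa using h)).mono ?_ (by omega)
    rintro t ht ⟨w, hw, htw⟩
    have h1 : t <:+: [a] := htw.trans (hD w hw).1
    exact ⟨t, [], ht, by simp, by
      have := h1.sublist
      rcases List.sublist_singleton.1 this with h | h
      · exact absurd h ht
      · rw [h], List.nil_prefix⟩
  · refine Red.none ?_ _
    rintro t ht ⟨w, hw, htw⟩
    have h1 : t <:+: [a] := htw.trans (hD w hw).1
    rcases List.sublist_singleton.1 h1.sublist with h' | h'
    · exact ht h'
    · exact h (h' ▸ htw.trans (hD w hw).2)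

theorem substr_infix (K : List α) (l r : ℕ) : substr K l r <:+: K :=
  (List.take_prefix _ _).isInfix.trans (List.drop_suffix _ _).isInfix

theorem step {c : ℕ} {rule : Fin c → CRule α c} {exp : Fin c → List α} {rank : Fin c → ℕ}
    (h : IsCollage rule exp rank) (X : Fin c) (D : List (List α))
    (hD : ∀ w ∈ D, w <:+: exp X ∧ w <:+: T) :
    Red T exp (fun Y => rank Y < rank X) (fun t => ∃ w ∈ D, t <:+: w)
      (2 + (D.map (cst (exp X))).sum) := by
  have hX := h X
  unfold CRuleOk at hX
  split at hX
  · rw [hX] at hD ⊢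
    exact step_term _ D hD
  · obtain ⟨-, -, hA, hB, hX⟩ := hX
    rw [hX] at hD ⊢
    exact step_of (full_cat (C := fun Y => rank Y < rank X) hA hB)
      (part_cat (C := fun Y => rank Y < rank X) hA hB) D hD
  · obtain ⟨hl, -, hR, hX⟩ := hX
    rw [hX] at hD ⊢
    exact step_of (full_rep (C := fun Y => rank Y < rank X) hR hl)
      (part_rep (C := fun Y => rank Y < rank X) hR) D hD
  · obtain ⟨-, hK, -, -, -, hX⟩ := hX
    rename_i K l r _
    have hi : exp X <:+: exp K := by rw [hX]; exact substr_infix _ _ _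
    exact step_of (fun hT => Red.pass2 (C := fun Y => rank Y < rank X) hK hi hT)
      (part_slice (C := fun Y => rank Y < rank X) hK hi) D hD

theorem main {c : ℕ} {rule : Fin c → CRule α c} {exp : Fin c → List α} {rank : Fin c → ℕ}
    (h : IsCollage rule exp rank) : ∀ (n : ℕ) (R : Finset (Fin c)), R.card = n →
    (∀ X ∈ R, ∀ Y, rank Y < rank X → Y ∈ R) → ∀ L : List (Fin c × List α),
    (∀ z ∈ L, z.1 ∈ R ∧ z.2 <:+: exp z.1 ∧ z.2 <:+: T) →
    Red T exp (fun _ => False) (fun t => ∃ z ∈ L, t <:+: z.2) (2 * n + tot exp L) := by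
  classical
  intro n
  induction n with
  | zero =>
    intro R hR _ L hL
    rw [Finset.card_eq_zero] at hR
    subst hR
    refine Red.none ?_ _
    rintro s - ⟨z, hz, -⟩
    simpa using (hL z hz).1
  | succ n ih =>
    intro R hR hcl L hL
    obtain ⟨X, hX, hmax⟩ := R.exists_max_image rank (Finset.card_pos.1 (by omega))
    set L1 := L.filter (fun z => z.1 = X) with hL1
    set L2 := L.filter (fun z => ¬ z.1 = X) with hL2
    have hsum : tot exp L1 + tot exp L2 = tot exp L := by
      simp only [tot, hL1, hL2]
      clear * -
      induction L with
      | nil => simp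
      | cons z L ih =>
        by_cases hz : z.1 = X <;> simp [hz] at ih ⊢ <;> omega
    have hs1 : ((L1.map Prod.snd).map (cst (exp X))).sum = tot exp L1 := by
      unfold tot
      rw [List.map_map]
      congr 1
      apply List.map_congr_left
      intro z hz
      have : z.1 = X := by simpa using (List.mem_filter.1 hz).2
      simp [this]
    obtain ⟨Γ, N, h1, h2, h3, h4⟩ := step (T := T) h X (L1.map Prod.snd) (by
      intro w hw
      obtain ⟨z, hz, rfl⟩ := List.mem_map.1 hw
      have hz' := List.mem_filter.1 hz
      have : z.1 = X := by simpa using hz'.2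
      exact this ▸ (hL z hz'.1).2)
    have hI := ih (R.erase X) (by rw [Finset.card_erase_of_mem hX]; omega) (by
        intro A hA Y hY
        rw [Finset.mem_erase] at hA ⊢
        refine ⟨?_, hcl A hA.2 Y hY⟩
        rintro rfl
        exact absurd (hmax A hA.2) (by omega)) (L2 ++ N) (by
      intro z hz
      rcases List.mem_append.1 hz with hz | hz
      · have hz' := List.mem_filter.1 hz
        have hne : z.1 ≠ X := by simpa using hz'.2
        have := hL z hz'.1
        exact ⟨Finset.mem_erase.2 ⟨hne, this.1⟩, this.2⟩
      · obtain ⟨a, b⟩ := h2 z hz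
        refine ⟨Finset.mem_erase.2 ⟨?_, hcl X hX _ a⟩, b⟩
        intro h
        rw [h] at a
        exact lt_irrefl _ a)
    have hG : Red T exp (fun _ : Fin c => False) (fun t => Cov T Γ t) (2 * Γ.card) :=
      ⟨Γ, [], h1, by simp, by simp [tot], fun s hs _ => Or.inl hs⟩
    rw [tot_append] at hI
    refine (hG.union hI).mono ?_ (by rw [hs1] at h3; omega)
    rintro t ht ⟨z, hz, htz⟩
    by_cases hzX : z.1 = X
    · have hz1 : z ∈ L1 := List.mem_filter.2 ⟨hz, by simpa using hzX⟩
      rcases h4 t ⟨z.2, List.mem_map_of_mem hz1, htz⟩ ht with h | ⟨y, hy, h⟩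
      · exact Or.inl h
      · exact Or.inr ⟨y, List.mem_append_right _ hy, h⟩
    · have hz2 : z ∈ L2 := List.mem_filter.2 ⟨hz, by simpa using hzX⟩
      exact Or.inr ⟨z, List.mem_append_left _ hz2, htz⟩

end CA

/-- if a collage system of size `c` generates `T`, then `T` has a
string attractor of size at most `c`. -/
theorem collage_attractor (T : List α) (c : ℕ) (h : GeneratedByCollage T c) :
    ∃ Γ : Finset ℕ, IsAttractor T Γ ∧ Γ.card ≤ c := by
  obtain ⟨rule, exp, rank, S, hC, hS⟩ := h
  obtain ⟨Γ, N, h1, h2, h3, h4⟩ := CA.main (T := T) hC c Finset.univ (by simp) (by simp) [(S, T)]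
    (by simp [hS])
  have ht : CA.tot exp [(S, T)] = 0 := by simp [CA.tot, hS, CA.cst_self]
  refine ⟨Γ, ⟨h1, ?_⟩, by omega⟩
  intro i j hi hij hj
  have hlen : (substr T i j).length = j + 1 - i := by
    simp only [substr, List.length_take, List.length_drop]; omega
  have hne : substr T i j ≠ [] := by
    intro h; rw [h] at hlen; simp at hlen; omega
  rcases h4 (substr T i j) ⟨(S, T), by simp, CA.substr_infix T i j⟩ hne with h | ⟨z, hz, -⟩
  · obtain ⟨u, v, huv, q, hq, hq1, hq2⟩ := h
    have hl := congrArg List.length huv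
    simp only [List.length_append] at hl
    refine ⟨u.length + 1, u.length + (substr T i j).length, q, by omega, by omega, by omega,
      ?_, hq, by omega, by omega⟩
    generalize substr T i j = w at *
    subst huv
    unfold substr
    have : u.length + w.length + 1 - (u.length + 1) = w.length := by omega
    rw [this]
    simp
  · exact (h2 z hz).1.elim
end

section
/- Let C be a collage system with start nonterminal S generating a string T, with rules X_i → a_i (1 ≤ i ≤ c'), Y_i → A_iB_i (1 ≤ i ≤ c''), Z_i → R_i^{ℓ_i} with ℓ_i ≥ 2 (1 ≤ i ≤ c'''), and W_i → K_i[l_i..r_i] (1 ≤ i ≤ c''''). Then for every substring T[i..j] of T at least one of the following holds: (1) i = j and T[i] = a_k for some 1 ≤ k ≤ c'; (2) there is a rule Y_k → A_kB_k such that T[i..j] equals a nonempty suffix of the expansion of A_k concatenated with a nonempty prefix of the expansion of B_k; (3) there is a rule Z_k → R_k^{ℓ_k} such that T[i..j] equals a nonempty suffix of the expansion of R_k concatenated with a nonempty prefix of the expansion of R_k^{ℓ_k−1}. -/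
universe u

variable {α : Type*}

theorem infix_append_cases {w a b : List α} (h : w <:+: a ++ b) :
    w <:+: a ∨ w <:+: b ∨ ∃ s p : List α, s ≠ [] ∧ p ≠ [] ∧ s <:+ a ∧ p <+: b ∧ w = s ++ p := by
  obtain ⟨x, y, h⟩ := h
  rw [List.append_assoc] at h
  rcases List.append_eq_append_iff.1 h with ⟨u, rfl, h2⟩ | ⟨u, rfl, h2⟩
  · rcases List.append_eq_append_iff.1 h2 with ⟨v, rfl, h3⟩ | ⟨v, rfl, h3⟩
    · exact Or.inl ⟨x, v, by simp⟩
    · by_cases hu : u = []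
      · subst hu
        exact Or.inr (Or.inl ⟨[], y, by simp [h3]⟩)
      · by_cases hv : v = []
        · subst hv
          exact Or.inl ⟨x, [], by simp⟩
        · exact Or.inr (Or.inr ⟨u, v, hu, hv, ⟨x, rfl⟩, ⟨y, h3.symm⟩, rfl⟩)
  · exact Or.inr (Or.inl ⟨u, y, by simp [h2]⟩)

theorem infix_rep_cases {w r : List α} (hw : w ≠ []) (n : ℕ)
    (h : w <:+: (List.replicate n r).flatten) :
    w <:+: r ∨ ∃ s p : List α, s ≠ [] ∧ p ≠ [] ∧ s <:+ r ∧
      p <+: (List.replicate (n - 1) r).flatten ∧ w = s ++ p := by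
  induction n with
  | zero => simp at h; exact absurd h hw
  | succ n ih =>
    rw [List.replicate_succ, List.flatten_cons] at h
    rcases infix_append_cases h with h | h | h
    · exact Or.inl h
    · rcases ih h with h | ⟨s, p, hs, hp, hsr, hpr, e⟩
      · exact Or.inl h
      · refine Or.inr ⟨s, p, hs, hp, hsr, hpr.trans ?_, e⟩
        cases n with
        | zero => simp
        | succ m =>
          simp only [Nat.add_sub_cancel]
          rw [List.replicate_succ', List.flatten_append]
          exact List.prefix_append _ _
    · exact Or.inr h

theorem substr_infix (T : List α) (i j : ℕ) : substr T i j <:+: T :=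
  (List.take_prefix _ _).isInfix.trans (List.drop_suffix _ _).isInfix

theorem collage_infix_cases {c : ℕ}
    (rule : Fin c → CRule α c) (exp : Fin c → List α) (rank : Fin c → ℕ)
    (hC : IsCollage rule exp rank) (w : List α) (hw : w ≠ []) (n : ℕ) :
    ∀ S : Fin c, rank S = n → w <:+: exp S →
    (∃ (X : Fin c) (a : α), rule X = .term a ∧ w = [a]) ∨
    (∃ (X A B : Fin c), rule X = .cat A B ∧ ∃ s p : List α, s ≠ [] ∧ p ≠ [] ∧
      s <:+ exp A ∧ p <+: exp B ∧ w = s ++ p) ∨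
    (∃ (X R : Fin c) (ℓ : ℕ), rule X = .rep R ℓ ∧ ∃ s p : List α, s ≠ [] ∧ p ≠ [] ∧
      s <:+ exp R ∧ p <+: (List.replicate (ℓ - 1) (exp R)).flatten ∧
      w = s ++ p) := by
  induction n using Nat.strong_induction_on with
  | _ n ih =>
  intro S hn hwS
  subst hn
  have hok := hC S
  unfold CRuleOk at hok
  cases hr : rule S with
  | term a =>
    simp only [hr] at hok
    rw [hok] at hwS
    refine Or.inl ⟨S, a, hr, ?_⟩
    refine hwS.sublist.eq_of_length_le ?_
    have := List.length_pos_iff.2 hw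
    simp; omega
  | cat A B =>
    simp only [hr] at hok
    obtain ⟨-, -, hA, hB, e⟩ := hok
    rw [e] at hwS
    rcases infix_append_cases hwS with h | h | h
    · exact ih _ hA A rfl h
    · exact ih _ hB B rfl h
    · exact Or.inr (Or.inl ⟨S, A, B, hr, h⟩)
  | rep R l =>
    simp only [hr] at hok
    obtain ⟨-, -, hR, e⟩ := hok
    rw [e] at hwS
    rcases infix_rep_cases hw _ hwS with h | h
    · exact ih _ hR R rfl h
    · exact Or.inr (Or.inr ⟨S, R, l, hr, h⟩)
  | slice K l r =>
    simp only [hr] at hok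
    obtain ⟨-, hK, -, -, -, e⟩ := hok
    rw [e] at hwS
    exact ih _ hK K rfl (hwS.trans (substr_infix _ _ _))

/-- for a collage system generating `T`, every substring `T[i..j]`
either (1) is a single character produced by a rule `X → a`, or (2) is a
nonempty suffix of the expansion of `A` followed by a nonempty prefix of the
expansion of `B` for some rule `Y → AB`, or (3) is a nonempty suffix of the
expansion of `R` followed by a nonempty prefix of the expansion of `R^(ℓ-1)`
for some rule `Z → R^ℓ`. -/
theorem collage_substring_cases (T : List α) (c : ℕ)
    (rule : Fin c → CRule α c) (exp : Fin c → List α) (rank : Fin c → ℕ) (S : Fin c)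
    (hC : IsCollage rule exp rank) (hS : exp S = T)
    (i j : ℕ) (h1 : 1 ≤ i) (hij : i ≤ j) (hj : j ≤ T.length) :
    (i = j ∧ ∃ (X : Fin c) (a : α), rule X = .term a ∧ substr T i j = [a]) ∨
    (∃ (X A B : Fin c), rule X = .cat A B ∧ ∃ s p : List α, s ≠ [] ∧ p ≠ [] ∧
      s <:+ exp A ∧ p <+: exp B ∧ substr T i j = s ++ p) ∨
    (∃ (X R : Fin c) (ℓ : ℕ), rule X = .rep R ℓ ∧ ∃ s p : List α, s ≠ [] ∧ p ≠ [] ∧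
      s <:+ exp R ∧ p <+: (List.replicate (ℓ - 1) (exp R)).flatten ∧
      substr T i j = s ++ p) := by
  have hlen : (substr T i j).length = j + 1 - i := by
    simp only [substr, List.length_take, List.length_drop]; omega
  have hw : substr T i j ≠ [] := by
    intro h
    rw [h] at hlen
    simp at hlen; omega
  rcases collage_infix_cases rule exp rank hC _ hw _ S rfl (hS ▸ substr_infix _ _ _) with h | h | h
  · refine Or.inl ⟨?_, h⟩
    obtain ⟨X, a, -, e⟩ := h
    rw [e] at hlen
    simp at hlen; omega
  · exact Or.inr (Or.inl h)
  · exact Or.inr (Or.inr h)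
end

section
/- Let T[1..n] be a string whose last character $ = T[n] occurs only at position n and is smaller than every other character of T, and let r be the number of maximal equal-letter runs in the Burrows–Wheeler transform of T. Then T has a string attractor of size at most r. -/
universe u

variable {α : Type*}

/-- The Burrows-Wheeler transform of `T` determined by a suffix array `sa`
(0-based): `bwtChar T sa i = T[sa i - 1]`, cyclically (so it is the last
character of `T` when `sa i = 0`). -/
def bwtChar (T : List α) (sa : Fin T.length ≃ Fin T.length) (i : Fin T.length) : α :=
  T.get ⟨((sa i : ℕ) + T.length - 1) % T.length, Nat.mod_lt _ i.pos⟩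

/-- Positions that end a maximal equal-letter run of the BWT; their number is `r`,
the number of maximal equal-letter runs. -/
def runEnds (T : List α) (sa : Fin T.length ≃ Fin T.length) : Set (Fin T.length) :=
  {i | ∀ h : (i : ℕ) + 1 < T.length, bwtChar T sa ⟨(i : ℕ) + 1, h⟩ ≠ bwtChar T sa i}

theorem lex_asymm_aux [LinearOrder α] : ∀ A B : List α,
    List.Lex (· < ·) A B → List.Lex (· < ·) B A → False := by
  intro A B h
  induction h with
  | nil => intro h; cases h
  | cons h ih =>
    intro h'
    cases h' with
    | cons h' => exact ih h'
    | rel h' => exact lt_irrefl _ h'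
  | rel h =>
    intro h'
    cases h' with
    | cons h' => exact lt_irrefl _ h
    | rel h' => exact lt_asymm h h'

theorem lex_between_aux [LinearOrder α] : ∀ x A B C : List α,
    List.Lex (· < ·) A B → List.Lex (· < ·) B C → x <+: A → x <+: C → x <+: B := by
  intro x
  induction x with
  | nil => intros; exact List.nil_prefix
  | cons a x ih =>
    intro A B C h1 h2 hA hC
    obtain ⟨A', rfl⟩ := hA
    obtain ⟨C', rfl⟩ := hC
    rw [List.cons_append] at h1 h2
    cases h1 with
    | cons h1 =>
      cases h2 with
      | cons h2 =>
        rw [List.cons_prefix_cons]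
        exact ⟨rfl, ih _ _ _ h1 h2 (List.prefix_append _ _) (List.prefix_append _ _)⟩
      | rel h2 => exact absurd h2 (lt_irrefl _)
    | rel h1 =>
      cases h2 with
      | cons h2 => exact absurd h1 (lt_irrefl _)
      | rel h2 => exact absurd h1 (lt_asymm h2)

theorem bwt_aux [LinearOrder α] (T : List α) (hpos : 0 < T.length)
    (sa : Fin T.length ≃ Fin T.length)
    (hsorted : ∀ i j : Fin T.length, i < j →
      List.Lex (· < ·) (T.drop ((sa i : ℕ))) (T.drop ((sa j : ℕ)))) :
    ∀ x : List α, x ≠ [] → T.get ⟨T.length - 1, Nat.sub_lt hpos Nat.one_pos⟩ ∉ x →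
      ∀ i : Fin T.length, x <+: T.drop (sa i) →
      (∀ j, i < j → ¬ x <+: T.drop (sa j)) →
      ∃ e ∈ runEnds T sa, (sa i : ℕ) ≤ ((sa e : ℕ) + T.length - 1) % T.length ∧
        ((sa e : ℕ) + T.length - 1) % T.length < sa i + x.length := by
  intro x
  induction x with
  | nil => intro h; exact absurd rfl h
  | cons a x ih =>
    intro _ hd i hi hmax
    have hq : (sa i : ℕ) < T.length := (sa i).2
    have hdrop : T.drop (sa i) = T[(sa i : ℕ)] :: T.drop (sa i + 1) :=
      List.drop_eq_getElem_cons hq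
    rw [hdrop, List.cons_prefix_cons] at hi
    obtain ⟨ha, hx⟩ := hi
    rw [List.mem_cons, not_or] at hd
    obtain ⟨hda, hdx⟩ := hd
    have hq1 : (sa i : ℕ) + 1 < T.length := by
      by_contra hc
      apply hda
      have : (sa i : ℕ) = T.length - 1 := by omega
      rw [ha, List.get_eq_getElem]
      simp only [this]
    obtain ⟨e, he⟩ : ∃ e, sa e = ⟨sa i + 1, hq1⟩ := ⟨sa.symm _, sa.apply_symm_apply _⟩
    have hev : (sa e : ℕ) = sa i + 1 := by rw [he]
    have hpe : ((sa e : ℕ) + T.length - 1) % T.length = sa i := by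
      rw [hev, show (sa i : ℕ) + 1 + T.length - 1 = sa i + T.length by omega,
        Nat.add_mod_right, Nat.mod_eq_of_lt hq]
    have hbe : bwtChar T sa e = a := by
      rw [bwtChar, ha, List.get_eq_getElem]
      simp only [hpe]
    have key : ∀ j, e < j → bwtChar T sa j = a → ¬ x <+: T.drop (sa j) := by
      intro j hj hb hxj
      have hj0 : (sa j : ℕ) ≠ 0 := by
        intro h0
        apply hda
        rw [← hb, bwtChar, List.get_eq_getElem, List.get_eq_getElem]
        have : ((sa j : ℕ) + T.length - 1) % T.length = T.length - 1 := by
          rw [h0, Nat.zero_add, Nat.mod_eq_of_lt (by omega)]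
        simp only [this]
      have hjl : (sa j : ℕ) < T.length := (sa j).2
      have hpj : ((sa j : ℕ) + T.length - 1) % T.length = sa j - 1 := by
        rw [show (sa j : ℕ) + T.length - 1 = (sa j - 1) + T.length by omega,
          Nat.add_mod_right, Nat.mod_eq_of_lt (by omega)]
      obtain ⟨k, hk⟩ : ∃ k, sa k = ⟨sa j - 1, by omega⟩ := ⟨sa.symm _, sa.apply_symm_apply _⟩
      have hkv : (sa k : ℕ) = sa j - 1 := by rw [hk]
      have hdk : T.drop (sa k) = a :: T.drop (sa j) := by
        rw [List.drop_eq_getElem_cons (sa k).2]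
        congr 1
        · rw [← hb, bwtChar, List.get_eq_getElem]
          simp only [hpj, hkv]
        · congr 1; omega
      have hlex : List.Lex (· < ·) (T.drop (sa i)) (T.drop (sa k)) := by
        rw [hdrop, hdk, ← ha, ← hev]
        exact List.Lex.cons (hsorted e j hj)
      have hik : i < k := by
        rcases lt_trichotomy i k with h | h | h
        · exact h
        · subst h
          exact (lex_asymm_aux _ _ hlex hlex).elim
        · exact (lex_asymm_aux _ _ hlex (hsorted k i h)).elim
      apply hmax k hik
      rw [hdk, List.cons_prefix_cons]
      exact ⟨rfl, hxj⟩
    by_cases hr : e ∈ runEnds T sa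
    · refine ⟨e, hr, hpe.ge, ?_⟩
      rw [hpe, List.length_cons]; omega
    · simp only [runEnds, Set.mem_setOf_eq, not_forall, not_not] at hr
      obtain ⟨h1, h2⟩ := hr
      have hn := key ⟨e + 1, h1⟩ (Fin.lt_def.2 (Nat.lt_succ_self _)) (h2.trans hbe)
      rw [← hev] at hx
      obtain ⟨e', he', hl, hu⟩ := ih (by rintro rfl; exact hn List.nil_prefix) hdx e hx (by
        intro j hj hxj
        rcases (Nat.succ_le_of_lt (Fin.lt_def.1 hj)).eq_or_lt with h | h
        · have : j = ⟨e + 1, h1⟩ := Fin.ext h.symm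
          exact hn (this ▸ hxj)
        · exact hn (lex_between_aux x _ _ _
            (hsorted e ⟨e + 1, h1⟩ (Fin.lt_def.2 (Nat.lt_succ_self _)))
            (hsorted ⟨e + 1, h1⟩ j (Fin.lt_def.2 h)) hx hxj))
      refine ⟨e', he', by omega, ?_⟩
      rw [List.length_cons]; omega

/-- if the last character of `T` occurs only at the last position
and is strictly smaller than every other character, and `r` is the number of
maximal equal-letter runs of the Burrows-Wheeler transform of `T` (determined by
the suffix array `sa`), then `T` has a string attractor of size at most `r`. -/
theorem bwt_runs_attractor [LinearOrder α] (T : List α) (hpos : 0 < T.length)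
    (sa : Fin T.length ≃ Fin T.length)
    (hsorted : ∀ i j : Fin T.length, i < j →
      List.Lex (· < ·) (T.drop ((sa i : ℕ))) (T.drop ((sa j : ℕ))))
    (hlast : ∀ i : Fin T.length, (i : ℕ) + 1 ≠ T.length →
      T.get ⟨T.length - 1, Nat.sub_lt hpos Nat.one_pos⟩ < T.get i) :
    ∃ Γ : Finset ℕ, IsAttractor T Γ ∧ Γ.card ≤ (runEnds T sa).ncard := by
  classical
  let f : Fin T.length → ℕ := fun e => ((sa e : ℕ) + T.length - 1) % T.length + 1
  have hfin : (runEnds T sa).Finite := Set.toFinite _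
  refine ⟨hfin.toFinset.image f, ⟨?_, ?_⟩, ?_⟩
  · intro p hp
    obtain ⟨e, _, rfl⟩ := Finset.mem_image.1 hp
    have := Nat.mod_lt ((sa e : ℕ) + T.length - 1) hpos
    simp only [f]; omega
  · intro i j hi hij hj
    by_cases hjn : j = T.length
    · refine ⟨i, j, T.length, hi, hij, hj, rfl, ?_, by omega, by omega⟩
      obtain ⟨e, he⟩ : ∃ e, sa e = ⟨0, hpos⟩ := ⟨sa.symm _, sa.apply_symm_apply _⟩
      have hev : (sa e : ℕ) = 0 := by rw [he]
      have hpe : ((sa e : ℕ) + T.length - 1) % T.length = T.length - 1 := by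
        rw [hev, Nat.zero_add, Nat.mod_eq_of_lt (by omega)]
      refine Finset.mem_image.2 ⟨e, hfin.mem_toFinset.2 ?_, ?_⟩
      · intro h hb
        set k : Fin T.length := ⟨e + 1, h⟩ with hk
        have hk0 : (sa k : ℕ) ≠ 0 := by
          intro h0
          have : k = e := sa.injective (Fin.ext (h0.trans hev.symm))
          have := congrArg Fin.val this
          simp [hk] at this
        have hkl : (sa k : ℕ) < T.length := (sa k).2
        have hpk : ((sa k : ℕ) + T.length - 1) % T.length = sa k - 1 := by
          rw [show (sa k : ℕ) + T.length - 1 = (sa k - 1) + T.length by omega,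
            Nat.add_mod_right, Nat.mod_eq_of_lt (by omega)]
        have := hlast ⟨sa k - 1, by omega⟩ (by simp only; omega)
        simp only [bwtChar, List.get_eq_getElem, hpk, hpe] at hb
        simp only [List.get_eq_getElem] at this
        exact absurd hb this.ne'
      · simp only [f, hpe]; omega
    · set x := substr T i j with hxdef
      have hxl : x.length = j + 1 - i := by
        simp only [hxdef, substr, List.length_take, List.length_drop]; omega
      have hne : x ≠ [] := by
        intro h; rw [h] at hxl; simp at hxl; omega
      have hd : T.get ⟨T.length - 1, Nat.sub_lt hpos Nat.one_pos⟩ ∉ x := by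
        intro hm
        obtain ⟨k, hk, hke⟩ := List.mem_iff_getElem.1 hm
        simp only [hxdef, substr, List.getElem_take, List.getElem_drop] at hke
        have := hlast ⟨i - 1 + k, by omega⟩ (by simp only; omega)
        simp only [List.get_eq_getElem] at this hke
        exact absurd hke this.ne'
      let S : Finset (Fin T.length) := Finset.univ.filter (fun k => x <+: T.drop (sa k))
      have hS : S.Nonempty := by
        refine ⟨sa.symm ⟨i - 1, by omega⟩, Finset.mem_filter.2 ⟨Finset.mem_univ _, ?_⟩⟩
        rw [sa.apply_symm_apply]
        exact List.take_prefix _ _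
      have hm := (Finset.mem_filter.1 (S.max'_mem hS)).2
      obtain ⟨e, he, hl, hu⟩ := bwt_aux T hpos sa hsorted x hne hd (S.max' hS) hm (by
        intro k hk hxk
        exact absurd (S.le_max' k (Finset.mem_filter.2 ⟨Finset.mem_univ _, hxk⟩)) (not_le.2 hk))
      have hle := hm.length_le
      rw [List.length_drop] at hle
      refine ⟨sa (S.max' hS) + 1, sa (S.max' hS) + x.length, f e, by omega, by omega, by omega,
        ?_, Finset.mem_image_of_mem _ (hfin.mem_toFinset.2 he), ?_, ?_⟩
      · have h2 := List.prefix_iff_eq_take.1 hm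
        rw [substr, Nat.add_sub_cancel, show (sa (S.max' hS) : ℕ) + x.length + 1
          - (sa (S.max' hS) + 1) = x.length by omega]
        exact h2.symm
      · simp only [f]; omega
      · simp only [f]; omega
  · rw [Set.ncard_eq_toFinset_card _ hfin]
    exact Finset.card_image_le
end

section
/- Let T be a string and let A be a finite acyclic directed graph with a single source s, whose edges are labeled by nonempty strings, such that (i) distinct edges leaving the same node have labels beginning with distinct characters, and (ii) the strings obtained by concatenating the edge labels along paths starting at the source and ending at a designated final set of states are exactly the suffixes of T (i.e., A is a compact automaton recognizing all and only the suffixes of T). If A has e edges, then T has a string attractor of size at most e. -/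
universe u

variable {α : Type*}

/-- `PathSpell E u v W`: there is a path from `u` to `v` using edges of `E`
whose concatenated labels spell the string `W`. -/
inductive PathSpell {V σ : Type*} (E : Set (V × List σ × V)) : V → V → List σ → Prop where
  | nil (v : V) : PathSpell E v v []
  | cons {u v w : V} {l rest : List σ} :
      (u, l, v) ∈ E → PathSpell E v w rest → PathSpell E u w (l ++ rest)

theorem PathSpell.append' {V σ : Type*} {E : Set (V × List σ × V)} {u v w : V} {X Y : List σ}
    (h : PathSpell E u v X) (h2 : PathSpell E v w Y) : PathSpell E u w (X ++ Y) := by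
  induction h with
  | nil v => simpa using h2
  | cons he _ ih =>
    rw [List.append_assoc]
    exact PathSpell.cons he (ih h2)

theorem PathSpell.split' {V σ : Type*} {E : Set (V × List σ × V)} {u f : V} {W : List σ}
    (h : PathSpell E u f W) : ∀ w Z : List σ, W = w ++ Z → w ≠ [] →
    ∃ a b X l₁ l₂ Y, (a, l₁ ++ l₂, b) ∈ E ∧ PathSpell E u a X ∧ w = X ++ l₁ ∧ l₁ ≠ [] ∧
      PathSpell E b f Y := by
  induction h with
  | nil v =>
    intro w Z h hw
    simp at h
    exact absurd h.1 hw
  | @cons u v f l rest he hp ih =>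
    intro w Z h hw
    rcases List.append_eq_append_iff.1 h with ⟨c, h1, h2⟩ | ⟨c, h1, h2⟩
    · by_cases hc : c = []
      · subst hc
        refine ⟨u, v, [], l, [], rest, by simpa using he, PathSpell.nil _, by simpa using h1, ?_, hp⟩
        rintro rfl
        exact hw (by simpa using h1)
      · obtain ⟨a, b, X, l₁, l₂, Y, hE, hX, hc', hl, hY⟩ := ih c Z h2 hc
        exact ⟨a, b, l ++ X, l₁, l₂, Y, hE, PathSpell.cons he hX, by simp [h1, hc'], hl, hY⟩
    · subst h1
      exact ⟨u, v, [], w, c, rest, he, PathSpell.nil _, rfl, hw, hp⟩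

/-- if `A` is a compact automaton (acyclic, single source `s`,
edges labeled by nonempty strings, distinct edges leaving a node having labels
starting with distinct characters) whose accepted strings are exactly the
suffixes of `T`, and `A` has `e` edges, then `T` has a string attractor of size
at most `e`. -/
theorem cdawg_attractor {V : Type*} (T : List α)
    (E : Finset (V × List α × V)) (s : V) (F : Set V) (rank : V → ℕ)
    (hnonempty : ∀ e ∈ E, (e.2.1 : List α) ≠ [])
    (hacyclic : ∀ e ∈ E, rank e.1 < rank e.2.2)
    (hdet : ∀ e₁ ∈ E, ∀ e₂ ∈ E, e₁.1 = e₂.1 → e₁ ≠ e₂ →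
      (e₁.2.1 : List α).head? ≠ (e₂.2.1 : List α).head?)
    (hlang : ∀ W : List α, (∃ f ∈ F, PathSpell (↑E : Set (V × List α × V)) s f W) ↔ W <:+ T) :
    ∃ Γ : Finset ℕ, IsAttractor T Γ ∧ Γ.card ≤ E.card := by
  classical
  have hg : ∀ e : V × List α × V, ∃ y : ℕ,
      (∃ f ∈ F, ∃ Y, PathSpell (↑E : Set (V × List α × V)) e.2.2 f Y) →
      ∃ f ∈ F, ∃ Y, PathSpell (↑E : Set (V × List α × V)) e.2.2 f Y ∧
        y = T.length - (e.2.1 ++ Y).length + 1 := by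
    intro e
    by_cases h : ∃ f ∈ F, ∃ Y, PathSpell (↑E : Set (V × List α × V)) e.2.2 f Y
    · obtain ⟨f, hf, Y, hY⟩ := h
      exact ⟨_, fun _ => ⟨f, hf, Y, hY, rfl⟩⟩
    · exact ⟨0, fun h' => absurd h' h⟩
  choose g hg using hg
  refine ⟨(E.image g).filter (fun p => 1 ≤ p ∧ p ≤ T.length), ⟨?_, ?_⟩,
    (Finset.card_filter_le _ _).trans Finset.card_image_le⟩
  · intro p hp
    exact (Finset.mem_filter.1 hp).2
  · intro i j hi hij hj
    obtain ⟨f, hf, hW⟩ := (hlang (T.drop (i - 1))).2 (List.drop_suffix _ _)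
    have hw : substr T i j ≠ [] := by
      intro h
      have := congrArg List.length h
      simp [substr] at this
      omega
    obtain ⟨a, b, X, l₁, l₂, Y, hE, hX, hc, hl, hY⟩ := hW.split' (substr T i j)
      ((T.drop (i - 1)).drop (j + 1 - i)) (List.take_append_drop _ _).symm hw
    obtain ⟨f', hf', Y', hY', hp⟩ := hg (a, l₁ ++ l₂, b) ⟨f, hf, Y, hY⟩
    obtain ⟨P, hP⟩ := (hlang (X ++ ((l₁ ++ l₂) ++ Y'))).1
      ⟨f', hf', hX.append' (PathSpell.cons hE hY')⟩
    have hlen := congrArg List.length hP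
    have hl1 : 0 < l₁.length := List.length_pos_iff.2 hl
    simp only [List.length_append] at hlen hp
    refine ⟨P.length + 1, P.length + (X ++ l₁).length, g (a, l₁ ++ l₂, b), by omega, ?_, ?_, ?_,
      ?_, ?_, ?_⟩
    · simp only [List.length_append]; omega
    · simp only [List.length_append]; omega
    · rw [hc, ← hP]
      have e1 : P.length + (X ++ l₁).length + 1 - (P.length + 1) = (X ++ l₁).length := by omega
      have e2 : P ++ (X ++ (l₁ ++ l₂ ++ Y')) = P ++ ((X ++ l₁) ++ (l₂ ++ Y')) := by simp
      rw [substr, e1, e2, Nat.add_sub_cancel, List.drop_left, List.take_left]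
    · refine Finset.mem_filter.2 ⟨Finset.mem_image_of_mem _ hE, ?_, ?_⟩ <;> omega
    · omega
    · simp only [List.length_append]; omega
end

section
/- There is an absolute constant C > 0 such that for every string T of length n and every string attractor Γ of T of size γ, there exists a bidirectional parse (and hence a macro scheme) of T of size at most C · γ · (1 + log(n/γ)). -/
universe u

variable {α : Type*}

/-- A directive of a macro scheme: either `T[i..j] ← T[i'..j']` or `T[q] ← c`. -/
inductive Directive (α : Type u) where
  | copy (i j i' j' : ℕ)
  | chr (q : ℕ) (c : α)

/-- A string `T'` is consistent with a directive. -/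
def Consistent (T' : List α) : Directive α → Prop
  | .copy i j i' j' => substr T' i j = substr T' i' j'
  | .chr q c => substr T' q q = [c]

/-- Shape and bounds conditions for a directive over a string of length `n`. -/
def DirOk (n : ℕ) : Directive α → Prop
  | .copy i j i' j' => 1 ≤ i ∧ i ≤ j ∧ j ≤ n ∧ 1 ≤ i' ∧ i' ≤ j' ∧ j' ≤ n ∧ j - i = j' - i'
  | .chr q _ => 1 ≤ q ∧ q ≤ n

/-- `M` is a macro scheme for `T`: all directives are valid and hold in `T`,
and `T` is the unique string of its length consistent with all directives. -/
def IsMacroScheme (T : List α) (M : Finset (Directive α)) : Prop :=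
  (∀ d ∈ M, DirOk T.length d) ∧ (∀ d ∈ M, Consistent T d) ∧
  ∀ T' : List α, T'.length = T.length → (∀ d ∈ M, Consistent T' d) → T' = T

/-- The left-hand side of a directive covers position `p`. -/
def Covers : Directive α → ℕ → Prop
  | .copy i j _ _, p => i ≤ p ∧ p ≤ j
  | .chr q _, p => p = q

/-- A bidirectional parse: the left-hand sides of the directives partition `{1,…,n}`. -/
def IsBidirectional (n : ℕ) (M : Finset (Directive α)) : Prop :=
  ∀ p : ℕ, 1 ≤ p → p ≤ n → ∃! d, d ∈ M ∧ Covers d p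

theorem substr_get (T : List α) (i j t : ℕ) (h : t < j + 1 - i) :
    (substr T i j)[t]? = T[i - 1 + t]? := by
  unfold substr
  rw [List.getElem?_take, List.getElem?_drop]
  simp [h]

theorem substr_len (T : List α) (i j : ℕ) (h1 : 1 ≤ i) (h3 : j ≤ T.length) :
    (substr T i j).length = j + 1 - i := by
  unfold substr
  simp
  omega

/-- block `b` of level `k` is separated from the attractor -/
def GoodBlk (Γ : Finset ℕ) (k b : ℕ) : Prop :=
  ∀ a ∈ Γ, ¬ (a / 2 ^ k ≤ b + 1 ∧ b ≤ a / 2 ^ k + 1)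

open Classical in
/-- level of a position -/
noncomputable def lev (Γ : Finset ℕ) (L q : ℕ) : ℕ :=
  Nat.findGreatest (fun k => GoodBlk Γ k (q / 2 ^ k)) L

/-- close to the attractor -/
def Near (Γ : Finset ℕ) (r p : ℕ) : Prop := ∃ a ∈ Γ, a < p + r ∧ p < a + r

theorem lev_congr (Γ : Finset ℕ) (L p q : ℕ) (h : p / 2 ^ (lev Γ L q) = q / 2 ^ (lev Γ L q)) :
    lev Γ L p = lev Γ L q := by
  classical
  have key : ∀ j, lev Γ L q ≤ j → p / 2 ^ j = q / 2 ^ j := by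
    intro j hj
    obtain ⟨d, rfl⟩ := Nat.exists_eq_add_of_le hj
    rw [pow_add, ← Nat.div_div_eq_div_mul, ← Nat.div_div_eq_div_mul, h]
  have h2 := (Nat.findGreatest_eq_iff (P := fun k => GoodBlk Γ k (q / 2 ^ k)) (k := L)
    (m := lev Γ L q)).1 (by unfold lev; rfl)
  have h3 := (Nat.findGreatest_eq_iff (P := fun k => GoodBlk Γ k (p / 2 ^ k)) (k := L)
    (m := lev Γ L q)).2 ⟨h2.1, fun h0 => by
      have := h2.2.1 h0
      simp only [key _ le_rfl]; exact this, fun j hj hjL => by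
      have := h2.2.2 hj hjL
      simp only [key _ hj.le]; exact this⟩
  unfold lev at h3 ⊢
  exact h3

theorem exists_dir {α : Type u} (T : List α) (Γ : Finset ℕ) (hA : IsAttractor T Γ) (L q : ℕ)
    (hq1 : 1 ≤ q) (hqn : q ≤ T.length) :
    ∃ d : Directive α, DirOk T.length d ∧ Consistent T d ∧
      (∀ p, 1 ≤ p → p ≤ T.length →
        (Covers d p ↔ p / 2 ^ (lev Γ L q) = q / 2 ^ (lev Γ L q))) ∧
      ∀ T' : List α, Consistent T' d → ∀ p, 1 ≤ p → p ≤ T.length → Covers d p →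
        T'[p - 1]? = T[p - 1]? ∨ ∃ p', 1 ≤ p' ∧ p' ≤ T.length ∧
          T'[p - 1]? = T'[p' - 1]? ∧ T[p - 1]? = T[p' - 1]? ∧
          ∀ r, Near Γ (r + 1) p → Near Γ r p' := by
  classical
  have h2 := (Nat.findGreatest_eq_iff (P := fun k => GoodBlk Γ k (q / 2 ^ k)) (k := L)
    (m := lev Γ L q)).1 (by unfold lev; rfl)
  generalize lev Γ L q = k at *
  have hchr : ∀ (S : List α) (c : α), substr S q q = [c] → S[q-1]? = some c := by
    intro S c h
    have := substr_get S q q 0 (by omega)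
    rw [h] at this
    simpa using this.symm
  by_cases hk : k = 0
  · subst hk
    refine ⟨.chr q (T[q-1]'(by omega)), ⟨hq1, hqn⟩, ?_, ?_, ?_⟩
    · apply List.ext_getElem?
      intro t
      rcases Nat.eq_zero_or_pos t with rfl | ht
      · rw [substr_get _ _ _ _ (by omega)]
        simp
      · rw [List.getElem?_eq_none, List.getElem?_eq_none]
        · simp; omega
        · rw [substr_len _ _ _ hq1 hqn]; omega
    · intro p _ _
      simp [Covers]
    · intro T' hT' p _ _ hc
      left
      simp only [Covers] at hc
      subst hc
      rw [hchr _ _ hT']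
      rw [List.getElem?_eq_getElem]
  · have hgood := h2.2.1 hk
    have hB : 0 < 2 ^ k := by positivity
    simp only [GoodBlk] at hgood
    generalize 2 ^ k = B at *
    have hdm := Nat.div_add_mod q B
    have hml := Nat.mod_lt q hB
    generalize hb : q / B = b at *
    have hsucc : B * (b + 1) = B * b + B := by ring
    obtain ⟨i', j', a, hi', hij', hj', hs, ha, hia, haj⟩ :=
      hA.2 (max 1 (B * b)) (min T.length (B * b + B - 1)) (by omega) (by omega) (by omega)
    have hl := congrArg List.length hs
    rw [substr_len _ _ _ hi' hj', substr_len _ _ _ (by omega) (by omega)] at hl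
    refine ⟨.copy (max 1 (B * b)) (min T.length (B * b + B - 1)) i' j', ?_, hs.symm, ?_, ?_⟩
    · refine ⟨by omega, by omega, by omega, hi', hij', hj', by omega⟩
    · intro p hp1 hpn
      simp only [Covers]
      rw [Nat.div_eq_iff hB, mul_comm b B]
      omega
    · intro T' hT' p hp1 hpn hc
      right
      simp only [Covers] at hc
      simp only [Consistent] at hT'
      generalize hlo : max 1 (B * b) = lo at *
      generalize hhi : min T.length (B * b + B - 1) = hi at *
      have e : ∀ S : List α, substr S lo hi = substr S i' j' →
          S[p-1]? = S[i' + (p - lo) - 1]? := by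
        intro S h
        have h1 := substr_get S lo hi (p - lo) (by omega)
        have h2 := substr_get S i' j' (p - lo) (by omega)
        rw [h, h2] at h1
        rw [show p - 1 = lo - 1 + (p - lo) by omega, ← h1]
        congr 1
        omega
      refine ⟨i' + (p - lo), by omega, by omega, e _ hT', e _ hs.symm, ?_⟩
      rintro r ⟨x, hx, hx1, hx2⟩
      have hg := hgood x hx
      have hBr : B ≤ r := by
        by_contra hlt
        apply hg
        constructor
        · rw [← Nat.lt_succ_iff, Nat.div_lt_iff_lt_mul hB]
          have : (b + 1).succ * B = B * b + B + B := by rw [Nat.succ_eq_add_one]; ring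
          omega
        · have h3 := Nat.div_add_mod x B
          have h4 := Nat.mod_lt x hB
          by_contra h5
          have h6 : B * (x / B + 2) ≤ B * b := Nat.mul_le_mul_left _ (by omega)
          have : B * (x / B + 2) = B * (x / B) + B + B := by ring
          omega
      exact ⟨a, ha, by omega, by omega⟩

open Classical in
theorem card_keys (Γ : Finset ℕ) (L n : ℕ) (hn : n / 2 ^ L + 1 ≤ 2 * Γ.card) :
    ((Finset.Icc 1 n).image (fun q => (lev Γ L q, q / 2 ^ (lev Γ L q)))).card
      ≤ 6 * Γ.card * L + 2 * Γ.card := by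
  have hsub : (Finset.Icc 1 n).image (fun q => (lev Γ L q, q / 2 ^ (lev Γ L q))) ⊆
      ((Finset.range L ×ˢ Γ ×ˢ Finset.range 6).image
        (fun x => (x.1, 2 * (x.2.1 / 2 ^ (x.1 + 1)) + x.2.2 - 2))) ∪
      (Finset.range (n / 2 ^ L + 1)).image (fun b => (L, b)) := by
    intro x hx
    obtain ⟨q, hq, rfl⟩ := Finset.mem_image.1 hx
    rw [Finset.mem_Icc] at hq
    have h2 := (Nat.findGreatest_eq_iff (P := fun k => GoodBlk Γ k (q / 2 ^ k)) (k := L)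
      (m := lev Γ L q)).1 (by unfold lev; rfl)
    generalize lev Γ L q = k at *
    rw [Finset.mem_union]
    rcases Nat.lt_or_ge k L with hk | hk
    · left
      have h3 := h2.2.2 (Nat.lt_succ_self k) hk
      simp only [GoodBlk] at h3
      push Not at h3
      obtain ⟨a, ha, h4, h5⟩ := h3
      rw [Nat.succ_eq_add_one] at h4 h5
      have h6 : q / 2 ^ (k + 1) = q / 2 ^ k / 2 := by
        rw [pow_succ, Nat.div_div_eq_div_mul]
      rw [h6] at h4 h5
      clear h6 h2
      generalize q / 2 ^ k = b at *
      rw [Finset.mem_image]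
      refine ⟨(k, a, b + 2 - 2 * (a / 2 ^ (k + 1))), ?_, ?_⟩
      · simp only [Finset.mem_product, Finset.mem_range]
        refine ⟨hk, ha, by omega⟩
      · simp only [Prod.mk.injEq, true_and]
        omega
    · right
      have : k = L := le_antisymm h2.1 hk
      subst this
      refine Finset.mem_image.2 ⟨q / 2 ^ k, ?_, rfl⟩
      rw [Finset.mem_range, Nat.lt_succ_iff]
      exact Nat.div_le_div_right hq.2
  refine (Finset.card_le_card hsub).trans ((Finset.card_union_le _ _).trans ?_)
  refine Nat.add_le_add (Finset.card_image_le.trans ?_) (Finset.card_image_le.trans ?_)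
  · simp only [Finset.card_product, Finset.card_range]
    apply le_of_eq; ring
  · simpa using hn

theorem exists_scheme {α : Type u} (T : List α) (Γ : Finset ℕ) (hA : IsAttractor T Γ) (L : ℕ)
    (hn : T.length / 2 ^ L + 1 ≤ 2 * Γ.card) :
    ∃ M : Finset (Directive α), IsMacroScheme T M ∧ IsBidirectional T.length M ∧
      M.card ≤ 6 * Γ.card * L + 2 * Γ.card := by
  classical
  have hD : ∀ x : ℕ × ℕ, ∃ d : Directive α,
      x ∈ (Finset.Icc 1 T.length).image (fun q => (lev Γ L q, q / 2 ^ (lev Γ L q))) →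
      DirOk T.length d ∧ Consistent T d ∧
      (∀ p, 1 ≤ p → p ≤ T.length →
        (Covers d p ↔ (lev Γ L p, p / 2 ^ (lev Γ L p)) = x)) ∧
      ∀ T' : List α, Consistent T' d → ∀ p, 1 ≤ p → p ≤ T.length → Covers d p →
        T'[p - 1]? = T[p - 1]? ∨ ∃ p', 1 ≤ p' ∧ p' ≤ T.length ∧
          T'[p - 1]? = T'[p' - 1]? ∧ T[p - 1]? = T[p' - 1]? ∧
          ∀ r, Near Γ (r + 1) p → Near Γ r p' := by
    intro x
    by_cases hx : x ∈ (Finset.Icc 1 T.length).image (fun q => (lev Γ L q, q / 2 ^ (lev Γ L q)))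
    · obtain ⟨q, hq, rfl⟩ := Finset.mem_image.1 hx
      rw [Finset.mem_Icc] at hq
      obtain ⟨d, h1, h2, h3, h4⟩ := exists_dir T Γ hA L q hq.1 hq.2
      refine ⟨d, fun _ => ⟨h1, h2, ?_, h4⟩⟩
      intro p hp1 hpn
      rw [h3 p hp1 hpn]
      constructor
      · intro h
        have := lev_congr Γ L p q h
        simp only [this, h]
      · intro h
        simp only [Prod.mk.injEq] at h
        rw [h.1] at h
        exact h.2
    · exact ⟨.copy 0 0 0 0, fun h => absurd h hx⟩
  choose D hD using hD
  have hmem : ∀ p, 1 ≤ p → p ≤ T.length → (lev Γ L p, p / 2 ^ (lev Γ L p)) ∈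
      (Finset.Icc 1 T.length).image (fun q => (lev Γ L q, q / 2 ^ (lev Γ L q))) :=
    fun p h1 h2 => Finset.mem_image.2 ⟨p, Finset.mem_Icc.2 ⟨h1, h2⟩, rfl⟩
  refine ⟨((Finset.Icc 1 T.length).image
    (fun q => (lev Γ L q, q / 2 ^ (lev Γ L q)))).image D, ⟨?_, ?_, ?_⟩, ?_,
    Finset.card_image_le.trans (card_keys Γ L _ hn)⟩
  · intro d hd
    obtain ⟨x, hx, rfl⟩ := Finset.mem_image.1 hd
    exact (hD x hx).1
  · intro d hd
    obtain ⟨x, hx, rfl⟩ := Finset.mem_image.1 hd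
    exact (hD x hx).2.1
  · intro T' hlen hT'
    have main : ∀ r p, 1 ≤ p → p ≤ T.length → Near Γ r p → T'[p-1]? = T[p-1]? := by
      intro r
      induction r with
      | zero =>
        rintro p _ _ ⟨a, _, h1, h2⟩
        omega
      | succ r ih =>
        intro p hp1 hpn hr
        have hx := hmem p hp1 hpn
        have hd := hD _ hx
        rcases hd.2.2.2 T' (hT' _ (Finset.mem_image_of_mem D hx)) p hp1 hpn
          ((hd.2.2.1 p hp1 hpn).2 rfl) with h | ⟨p', h1, h2, h3, h4, h5⟩
        · exact h
        · rw [h3, h4]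
          exact ih p' h1 h2 (h5 r hr)
    apply List.ext_getElem?
    intro t
    rcases Nat.lt_or_ge t T.length with ht | ht
    · obtain ⟨_, _, a, _, _, _, _, ha, _⟩ := hA.2 1 T.length le_rfl (by omega) le_rfl
      have := main (a + t + 2) (t + 1) (by omega) (by omega) ⟨a, ha, by omega, by omega⟩
      simpa using this
    · rw [List.getElem?_eq_none ht, List.getElem?_eq_none (by omega)]
  · intro p hp1 hpn
    have hx := hmem p hp1 hpn
    refine ⟨D _, ⟨Finset.mem_image_of_mem D hx, ((hD _ hx).2.2.1 p hp1 hpn).2 rfl⟩, ?_⟩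
    rintro d ⟨hd, hc⟩
    obtain ⟨y, hy, rfl⟩ := Finset.mem_image.1 hd
    rw [((hD y hy).2.2.1 p hp1 hpn).1 hc]

/-- there is an absolute constant `C > 0` such that every string
`T` of length `n` with a string attractor of size `γ` admits a bidirectional
parse (hence a macro scheme) of size at most `C · γ · (1 + log₂(n/γ))`. -/
theorem attractor_to_bidirectional_parse :
    ∃ C : ℝ, 0 < C ∧ ∀ (α : Type u) (T : List α) (Γ : Finset ℕ), IsAttractor T Γ →
      ∃ M : Finset (Directive α), IsMacroScheme T M ∧ IsBidirectional T.length M ∧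
        (M.card : ℝ) ≤ C * (Γ.card : ℝ) *
          (1 + Real.logb 2 ((T.length : ℝ) / (Γ.card : ℝ))) := by
  refine ⟨6, by norm_num, ?_⟩
  intro α T Γ hA
  rcases Nat.eq_zero_or_pos T.length with h0 | hpos
  · have hΓ : Γ = ∅ := by
      rw [Finset.eq_empty_iff_forall_notMem]
      intro p hp
      have := hA.1 p hp
      omega
    refine ⟨∅, ⟨by simp, by simp, ?_⟩, ?_, by simp [hΓ]⟩
    · intro T' h _
      rw [List.length_eq_zero_iff.1 h0, List.length_eq_zero_iff.1 (h.trans h0)]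
    · intro p h1 h2
      omega
  · have hγ : 0 < Γ.card := by
      obtain ⟨_, _, a, _, _, _, _, ha, _⟩ := hA.2 1 T.length le_rfl hpos le_rfl
      exact Finset.card_pos.2 ⟨a, ha⟩
    have hle : Γ.card ≤ T.length := by
      have : Γ ⊆ Finset.Icc 1 T.length := fun p hp => Finset.mem_Icc.2 (hA.1 p hp)
      simpa using Finset.card_le_card this
    have hq : T.length / Γ.card ≠ 0 := (Nat.div_pos hle hγ).ne'
    obtain ⟨M, h1, h2, h3⟩ := exists_scheme T Γ hA (Nat.log 2 (T.length / Γ.card)) (by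
      have := Nat.lt_pow_succ_log_self (b := 2) (by norm_num) (T.length / Γ.card)
      rw [Nat.div_lt_iff_lt_mul hγ] at this
      rw [Nat.succ_le_iff, Nat.div_lt_iff_lt_mul (by positivity)]
      calc _ < _ := this
        _ = _ := by rw [Nat.succ_eq_add_one, pow_succ]; ring)
    refine ⟨M, h1, h2, ?_⟩
    have hL : (Nat.log 2 (T.length / Γ.card) : ℝ) ≤
        Real.logb 2 ((T.length : ℝ) / (Γ.card : ℝ)) := by
      have hγ' : (0 : ℝ) < Γ.card := by exact_mod_cast hγ
      have hp' : (0 : ℝ) < T.length := by exact_mod_cast hpos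
      rw [Real.le_logb_iff_rpow_le (by norm_num) (by positivity), Real.rpow_natCast,
        le_div_iff₀ hγ']
      have := Nat.pow_log_le_self 2 hq
      rw [Nat.le_div_iff_mul_le hγ] at this
      exact_mod_cast this
    have h3' : (M.card : ℝ) ≤ 6 * Γ.card * (Nat.log 2 (T.length / Γ.card) : ℝ) + 2 * Γ.card := by
      exact_mod_cast h3
    have hγ0 : (0 : ℝ) ≤ Γ.card := by positivity
    nlinarith [mul_le_mul_of_nonneg_left hL hγ0]
end

section
/- There is an absolute constant C > 0 such that for every string T of length n and every string attractor Γ of T of size γ, there exists a collage system generating T of size at most C · γ · (1 + log(n/γ)). -/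
universe u

variable {α : Type*}

/-- One derivation step from the already available strings `L`. -/
inductive CStep (L : List (List α)) : List α → Prop
  | term (a : α) : CStep L [a]
  | cat (x y : List α) : x ∈ L → y ∈ L → CStep L (x ++ y)
  | slice (x : List α) (l r : ℕ) : x ∈ L → 1 ≤ l → l ≤ r → r ≤ x.length →
      CStep L (substr x l r)

inductive CGen : List (List α) → Prop
  | nil : CGen []
  | cons (L : List (List α)) (x : List α) : CGen L → CStep L x → CGen (x :: L)

theorem CGen.get {L : List (List α)} (h : CGen L) :
    ∀ (i : ℕ) (hi : i < L.length), CStep (L.drop (i+1)) L[i] := by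
  induction h with
  | nil => intro i hi; simp at hi
  | cons L x h hs ih =>
    intro i hi
    cases i with
    | zero => simpa using hs
    | succ k => simpa using ih k (by simpa using hi)

theorem exists_index {L : List (List α)} {i : ℕ} {x : List α} (h : x ∈ L.drop i) :
    ∃ Y : Fin L.length, i ≤ Y.1 ∧ L.get Y = x := by
  obtain ⟨k, hk, rfl⟩ := List.mem_iff_getElem.1 h
  have hk' : i + k < L.length := by simp at hk; omega
  exact ⟨⟨i + k, hk'⟩, by simp, by simp⟩

theorem CGen.collage {L : List (List α)} (h : CGen L) {T : List α} (hT : T ∈ L) :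
    GeneratedByCollage T L.length := by
  have key : ∀ X : Fin L.length, ∃ r : CRule α L.length,
      CRuleOk (fun _ => r) L.get (fun Y => L.length - Y.1) X := by
    intro X
    have hs := h.get X.1 X.2
    have hX : L.get X = L[X.1] := rfl
    generalize hz : L[X.1] = z at hs
    rw [hz] at hX
    have hlt := X.2
    cases hs with
    | term a => exact ⟨.term a, hX⟩
    | cat x y hx hy =>
      obtain ⟨A, hA, rfl⟩ := exists_index hx
      obtain ⟨B, hB, rfl⟩ := exists_index hy
      refine ⟨.cat A B, ?_, ?_, ?_, ?_, hX⟩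
      · rintro rfl; omega
      · rintro rfl; omega
      · show L.length - A.1 < L.length - X.1; omega
      · show L.length - B.1 < L.length - X.1; omega
    | slice x l r hx h1 h2 h3 =>
      obtain ⟨A, hA, rfl⟩ := exists_index hx
      refine ⟨.slice A l r, ?_, ?_, h1, h2, h3, hX⟩
      · rintro rfl; omega
      · show L.length - A.1 < L.length - X.1; omega
  choose rule hrule using key
  obtain ⟨S, hS⟩ := List.mem_iff_get.1 hT
  exact ⟨rule, L.get, fun Y => L.length - Y.1, S, fun X => hrule X, hS⟩

/-- Extension of a list of available strings by at most `d` new ones. -/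
def CExt (L L' : List (List α)) (d : ℕ) : Prop :=
  CGen L' ∧ L ⊆ L' ∧ L'.length ≤ L.length + d

theorem CExt.refl {L : List (List α)} (h : CGen L) (d : ℕ) : CExt L L d :=
  ⟨h, fun _ h => h, by omega⟩

theorem CExt.trans {L L' L'' : List (List α)} {d e : ℕ} (h : CExt L L' d) (h' : CExt L' L'' e) :
    CExt L L'' (d + e) :=
  ⟨h'.1, fun _ hx => h'.2.1 (h.2.1 hx), by have := h.2.2; have := h'.2.2; omega⟩

theorem CExt.step {L : List (List α)} {x : List α} (h : CGen L) (hs : CStep L x) :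
    CExt L (x :: L) 1 := ⟨.cons L x h hs, fun _ h => by simp [h], by simp⟩

theorem cext_finset {ι : Type*} (f : ι → List α) (d : ℕ) (L0 : List (List α)) (h0 : CGen L0)
    (S : Finset ι)
    (H : ∀ p ∈ S, ∀ L, CGen L → L0 ⊆ L → ∃ L', CExt L L' d ∧ f p ∈ L') :
    ∃ L', CExt L0 L' (d * S.card) ∧ ∀ p ∈ S, f p ∈ L' := by
  classical
  induction S using Finset.induction_on with
  | empty => exact ⟨L0, CExt.refl h0 _, by simp⟩
  | insert p S hp ih =>
    obtain ⟨L1, h1, h1'⟩ := ih (fun q hq => H q (by simp [hq]))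
    obtain ⟨L2, h2, h2'⟩ := H p (by simp) L1 h1.1 h1.2.1
    refine ⟨L2, ?_, ?_⟩
    · have := h1.trans h2
      rwa [Finset.card_insert_of_notMem hp, Nat.mul_succ]
    · intro q hq
      rcases Finset.mem_insert.1 hq with rfl | hq
      · exact h2'
      · exact h2.2.1 (h1' q hq)

/-- The 0-based half-open segment `T[a..b)`. -/
def seg (T : List α) (a b : ℕ) : List α := (T.drop a).take (b - a)

theorem substr_eq_seg (T : List α) {i : ℕ} (j : ℕ) (hi : 1 ≤ i) :
    substr T i j = seg T (i - 1) j := by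
  unfold substr seg
  congr 1; omega

theorem seg_length (T : List α) {a b : ℕ} (hb : b ≤ T.length) : (seg T a b).length = b - a := by
  unfold seg; simp; omega

theorem seg_append (T : List α) {a b c : ℕ} (hab : a ≤ b) (hbc : b ≤ c) :
    seg T a b ++ seg T b c = seg T a c := by
  unfold seg
  have e : c - a = (b - a) + (c - b) := by omega
  rw [e, List.take_add, List.drop_drop]
  congr 3; omega

theorem seg_slice (T : List α) {a b a' b' : ℕ} (h1 : a ≤ a') (h2 : a' ≤ b') (h3 : b' ≤ b) :
    substr (seg T a b) (a' - a + 1) (b' - a) = seg T a' b' := by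
  unfold seg substr
  rw [List.drop_take, List.drop_drop, List.take_take]
  congr 1
  · omega
  · congr 1; omega

def ctx (T : List α) (m p : ℕ) : List α := seg T (p - m) (min T.length (p + m - 1))

theorem key_step {T : List α} {Γ : Finset ℕ} (hΓ : IsAttractor T Γ) {L : List (List α)} {m : ℕ}
    (hL : ∀ p ∈ Γ, ctx T m p ∈ L) {a b : ℕ} (hab : a < b) (hb : b ≤ T.length)
    (hm : b - a ≤ m) : CStep L (seg T a b) := by
  obtain ⟨i, j, p, hi, hij, hj, he, hp, hip, hpj⟩ := hΓ.2 (a+1) b (by omega) (by omega) hb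
  rw [substr_eq_seg _ _ hi, substr_eq_seg _ _ (by omega)] at he
  simp only [Nat.add_sub_cancel] at he
  have hlen := congrArg List.length he
  rw [seg_length _ hj, seg_length _ hb] at hlen
  rw [← he, ← seg_slice T (a := p - m) (b := min T.length (p + m - 1)) (a' := i - 1) (b' := j)
    (by omega) (by omega) (by omega)]
  refine CStep.slice _ _ _ (hL p hp) (by omega) (by omega) ?_
  rw [seg_length _ (by omega)]
  omega

theorem ext_left {T : List α} {Γ : Finset ℕ} (hΓ : IsAttractor T Γ) {L : List (List α)} {m : ℕ}
    (h : CGen L) (hL : ∀ p ∈ Γ, ctx T m p ∈ L) {a b c : ℕ} (hab : a ≤ b) (hbc : b ≤ c)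
    (hb : b ≤ T.length) (hm : b - a ≤ m) (hx : seg T b c ∈ L) :
    ∃ L', CExt L L' 2 ∧ seg T a c ∈ L' := by
  rcases hab.eq_or_lt with rfl | hlt
  · exact ⟨L, CExt.refl h _, hx⟩
  · have h1 := CExt.step h (key_step hΓ hL hlt hb hm)
    have h2 := CExt.step h1.1 (CStep.cat (seg T a b) (seg T b c) (by simp) (by simp [hx]))
    rw [seg_append T hab hbc] at h2
    exact ⟨_, h1.trans h2, by simp⟩

theorem ext_right {T : List α} {Γ : Finset ℕ} (hΓ : IsAttractor T Γ) {L : List (List α)} {m : ℕ}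
    (h : CGen L) (hL : ∀ p ∈ Γ, ctx T m p ∈ L) {a b c : ℕ} (hab : a ≤ b) (hbc : b ≤ c)
    (hc : c ≤ T.length) (hm : c - b ≤ m) (hx : seg T a b ∈ L) :
    ∃ L', CExt L L' 2 ∧ seg T a c ∈ L' := by
  rcases hbc.eq_or_lt with rfl | hlt
  · exact ⟨L, CExt.refl h _, hx⟩
  · have h1 := CExt.step h (key_step hΓ hL hlt hc hm)
    have h2 := CExt.step h1.1 (CStep.cat (seg T a b) (seg T b c) (by simp [hx]) (by simp))
    rw [seg_append T hab hbc] at h2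
    exact ⟨_, h1.trans h2, by simp⟩

theorem level {T : List α} {Γ : Finset ℕ} (hΓ : IsAttractor T Γ) (k : ℕ) :
    ∃ L, CGen L ∧ L.length ≤ Γ.card + 4 * Γ.card * k ∧ ∀ p ∈ Γ, ctx T (2^k) p ∈ L := by
  induction k with
  | zero =>
    obtain ⟨L, h, h'⟩ := cext_finset (ctx T 1) 1 [] .nil Γ (by
      intro p hp L hL _
      obtain ⟨h1, h2⟩ := hΓ.1 p hp
      refine ⟨_, CExt.step hL (CStep.term (T[p-1]'(by omega))), ?_⟩
      have : ctx T 1 p = [T[p-1]'(by omega)] := by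
        unfold ctx seg
        rw [show min T.length (p + 1 - 1) - (p - 1) = 1 by omega,
          List.drop_eq_getElem_cons (by omega : p - 1 < T.length)]
        rfl
      rw [this]; simp)
    exact ⟨L, h.1, by simpa using h.2.2, by simpa using h'⟩
  | succ k ih =>
    obtain ⟨L0, h0, hlen, hc⟩ := ih
    have hm : 1 ≤ 2^k := Nat.one_le_two_pow
    rw [show 2^(k+1) = 2 * 2^k by ring]
    generalize 2^k = m at *
    obtain ⟨L, h, h'⟩ := cext_finset (ctx T (2*m)) 4 L0 h0 Γ (by
      intro p hp L hL hsub
      obtain ⟨hp1, hp2⟩ := hΓ.1 p hp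
      have hc0 : ∀ p ∈ Γ, ctx T m p ∈ L := fun q hq => hsub (hc q hq)
      obtain ⟨L1, h1, h1'⟩ := ext_left hΓ hL hc0 (a := p - 2*m) (b := p - m)
        (c := min T.length (p + m - 1)) (by omega) (by omega) (by omega) (by omega) (hc0 p hp)
      obtain ⟨L2, h2, h2'⟩ := ext_right hΓ h1.1 (fun q hq => h1.2.1 (hc0 q hq)) (a := p - 2*m)
        (b := min T.length (p + m - 1)) (c := min T.length (p + 2*m - 1))
        (by omega) (by omega) (by omega) (by omega) h1'
      exact ⟨L2, h1.trans h2, h2'⟩)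
    refine ⟨L, h.1, ?_, h'⟩
    have := h.2.2
    rw [Nat.mul_succ]; omega

theorem blocks {T : List α} {Γ : Finset ℕ} (hΓ : IsAttractor T Γ) {L : List (List α)} {m : ℕ}
    (hT : 0 < T.length) (hm : 1 ≤ m)
    (h : CGen L) (hL : ∀ p ∈ Γ, ctx T m p ∈ L) (j : ℕ) :
    ∃ L', CExt L L' (2 * (j + 1)) ∧ seg T 0 (min T.length ((j + 1) * m)) ∈ L' := by
  induction j with
  | zero =>
    have h1 := CExt.step h (key_step hΓ hL (a := 0) (b := min T.length m)
      (by omega) (by omega) (by omega))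
    exact ⟨_, h1.trans (CExt.refl h1.1 1), by simp⟩
  | succ j ih =>
    obtain ⟨L1, h1, h1'⟩ := ih
    have e : (j + 1 + 1) * m = (j + 1) * m + m := by ring
    rw [e]
    generalize (j + 1) * m = q at *
    obtain ⟨L2, h2, h2'⟩ := ext_right hΓ h1.1 (fun q hq => h1.2.1 (hL q hq)) (a := 0)
        (b := min T.length q) (c := min T.length (q + m))
        (by omega) (by omega) (by omega) (by omega) h1'
    exact ⟨L2, h1.trans h2, h2'⟩

theorem main_nat {T : List α} {Γ : Finset ℕ} (hΓ : IsAttractor T Γ) (hT : 0 < T.length)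
    (hg : 1 ≤ Γ.card) (k : ℕ) (hk : T.length ≤ Γ.card * 2^k) :
    ∃ c, GeneratedByCollage T c ∧ c ≤ Γ.card * (3 + 4 * k) := by
  obtain ⟨L, h, hlen, hc⟩ := level hΓ k
  obtain ⟨L', h1, h1'⟩ := blocks hΓ hT Nat.one_le_two_pow h hc (Γ.card - 1)
  rw [Nat.sub_add_cancel hg] at h1 h1'
  rw [min_eq_left hk] at h1'
  have : seg T 0 T.length = T := by simp [seg]
  rw [this] at h1'
  refine ⟨_, h1.1.collage h1', ?_⟩
  have := h1.2.2
  nlinarith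

/-- there is an absolute constant `C > 0` such that every nonempty
string `T` of length `n` with a string attractor of size `γ` is generated by a
collage system of size at most `C · γ · (1 + log₂(n/γ))`. -/
theorem attractor_to_collage :
    ∃ C : ℝ, 0 < C ∧ ∀ (α : Type u) (T : List α) (Γ : Finset ℕ), T ≠ [] →
      IsAttractor T Γ →
      ∃ c : ℕ, GeneratedByCollage T c ∧
        (c : ℝ) ≤ C * (Γ.card : ℝ) *
          (1 + Real.logb 2 ((T.length : ℝ) / (Γ.card : ℝ))) := by
  refine ⟨7, by norm_num, ?_⟩
  intro α T Γ hT hΓ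
  have hn : 0 < T.length := List.length_pos_of_ne_nil hT
  have hg : 1 ≤ Γ.card := by
    obtain ⟨_, _, p, _, _, _, _, hp, _⟩ := hΓ.2 1 1 le_rfl le_rfl hn
    exact Finset.card_pos.2 ⟨p, hp⟩
  have hgn : Γ.card ≤ T.length := by
    have hs : Γ ⊆ Finset.Icc 1 T.length := fun p hp => Finset.mem_Icc.2 (hΓ.1 p hp)
    simpa using Finset.card_le_card hs
  have hgR : (0 : ℝ) < Γ.card := by exact_mod_cast hg
  have hnR : (0 : ℝ) < T.length := by exact_mod_cast hn
  have hx1 : (1 : ℝ) ≤ (T.length : ℝ) / Γ.card := by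
    rw [le_div_iff₀ hgR, one_mul]; exact_mod_cast hgn
  have hx0 : (0 : ℝ) < (T.length : ℝ) / Γ.card := by linarith
  have hlog : 0 ≤ Real.logb 2 ((T.length : ℝ) / Γ.card) := Real.logb_nonneg (by norm_num) hx1
  set x := Real.logb 2 ((T.length : ℝ) / Γ.card) with hx
  have hk : T.length ≤ Γ.card * 2 ^ ⌈x⌉₊ := by
    have h1 : (T.length : ℝ) / Γ.card ≤ (2 : ℝ) ^ ((⌈x⌉₊ : ℕ) : ℝ) :=
      (Real.logb_le_iff_le_rpow (by norm_num) hx0).1 (Nat.le_ceil x)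
    rw [Real.rpow_natCast, div_le_iff₀ hgR, mul_comm] at h1
    exact_mod_cast h1
  obtain ⟨c, hc, hle⟩ := main_nat hΓ hn hg _ hk
  refine ⟨c, hc, ?_⟩
  have hle' : (c : ℝ) ≤ Γ.card * (3 + 4 * (⌈x⌉₊ : ℝ)) := by exact_mod_cast hle
  have hceil := Nat.ceil_lt_add_one hlog
  calc (c : ℝ) ≤ Γ.card * (3 + 4 * (⌈x⌉₊ : ℝ)) := hle'
    _ ≤ Γ.card * (7 * (1 + x)) := by
        apply mul_le_mul_of_nonneg_left _ hgR.le
        linarith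
    _ = 7 * (Γ.card : ℝ) * (1 + x) := by ring
end

section
/- There is an absolute constant C > 0 such that for every string T of length n and every string attractor Γ of T of size γ, there exists a straight-line program (SLP) generating T of size at most C · γ · (1 + log(n/γ))². -/
universe u

variable {α : Type*}

/-- An SLP rule: only the forms `X → a` and `X → AB` are allowed. -/
def CRule.IsSLPRule {c : ℕ} : CRule α c → Prop
  | .term _ => True
  | .cat _ _ => True
  | _ => False

/-- `T` is generated by some straight-line program of size `g`. -/
def GeneratedBySLP (T : List α) (g : ℕ) : Prop :=
  ∃ (rule : Fin g → CRule α g) (exp : Fin g → List α) (rank : Fin g → ℕ) (S : Fin g),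
    IsCollage rule exp rank ∧ (∀ X, (rule X).IsSLPRule) ∧ exp S = T

/-- Binary trees with labelled leaves; an SLP is a finite subtree-closed set of trees. -/
inductive BT (α : Type u) where
  | leaf (a : α)
  | node (l r : BT α)

namespace BT

def yield {α : Type u} : BT α → List α
  | leaf a => [a]
  | node l r => yield l ++ yield r

def height {α : Type u} : BT α → ℕ
  | leaf _ => 0
  | node l r => max (height l) (height r) + 1

def Closed {α : Type u} (S : Finset (BT α)) : Prop :=
  ∀ l r : BT α, node l r ∈ S → l ∈ S ∧ r ∈ S

theorem yield_ne {α : Type u} (t : BT α) : t.yield ≠ [] := by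
  induction t with
  | leaf a => simp [yield]
  | node l r ihl ihr => simp [yield, ihl]

def Rep {α : Type u} (S : Finset (BT α)) (u : List α) (h : ℕ) : Prop :=
  u = [] ∨ ∃ t ∈ S, t.yield = u ∧ t.height ≤ h

theorem Rep.mono {α : Type u} {S S' : Finset (BT α)} {u : List α} {h h' : ℕ}
    (H : Rep S u h) (hS : S ⊆ S') (hh : h ≤ h') : Rep S' u h' := by
  rcases H with H | ⟨t, ht, hy, hht⟩
  · exact Or.inl H
  · exact Or.inr ⟨t, hS ht, hy, hht.trans hh⟩

theorem add_node {α : Type u} (S : Finset (BT α)) (hS : Closed S) (l r : BT α)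
    (hl : l ∈ S) (hr : r ∈ S) :
    ∃ S' : Finset (BT α), S ⊆ S' ∧ Closed S' ∧ S'.card ≤ S.card + 1 ∧ node l r ∈ S' := by
  classical
  refine ⟨insert (node l r) S, Finset.subset_insert _ _, ?_, Finset.card_insert_le _ _,
    Finset.mem_insert_self _ _⟩
  intro l' r' h
  rcases Finset.mem_insert.1 h with h | h
  · injection h with h1 h2
    subst h1 h2
    exact ⟨Finset.mem_insert_of_mem hl, Finset.mem_insert_of_mem hr⟩
  · exact ⟨Finset.mem_insert_of_mem (hS _ _ h).1, Finset.mem_insert_of_mem (hS _ _ h).2⟩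

theorem add_leaf {α : Type u} (S : Finset (BT α)) (hS : Closed S) (a : α) :
    ∃ S' : Finset (BT α), S ⊆ S' ∧ Closed S' ∧ S'.card ≤ S.card + 1 ∧ leaf a ∈ S' := by
  classical
  refine ⟨insert (leaf a) S, Finset.subset_insert _ _, ?_, Finset.card_insert_le _ _,
    Finset.mem_insert_self _ _⟩
  intro l' r' h
  rcases Finset.mem_insert.1 h with h | h
  · cases h
  · exact ⟨Finset.mem_insert_of_mem (hS _ _ h).1, Finset.mem_insert_of_mem (hS _ _ h).2⟩

theorem prefix_tree {α : Type u} (S : Finset (BT α)) (hS : Closed S) (t : BT α) :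
    t ∈ S → ∀ u v : List α, t.yield = u ++ v → u ≠ [] →
    ∃ S' : Finset (BT α), S ⊆ S' ∧ Closed S' ∧ S'.card ≤ S.card + t.height ∧
      ∃ t' ∈ S', t'.yield = u ∧ t'.height ≤ t.height := by
  induction t with
  | leaf a =>
    intro ht u v huv hu
    refine ⟨S, subset_rfl, hS, by simp, leaf a, ht, ?_, le_rfl⟩
    cases u with
    | nil => exact absurd rfl hu
    | cons b u =>
      simp [yield] at huv ⊢
      grind
  | node l r ihl ihr =>
    intro ht u v huv hu
    obtain ⟨hl, hr⟩ := hS _ _ ht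
    simp only [yield] at huv
    rcases List.append_eq_append_iff.1 huv with ⟨w, h1, h2⟩ | ⟨w, h1, h2⟩
    · by_cases hw : w = []
      · subst hw
        exact ⟨S, subset_rfl, hS, by simp, l, hl, by simpa using h1.symm,
          by simp only [height]; omega⟩
      · obtain ⟨S', a1, a2, a3, r', a4, a5, a6⟩ := ihr hr w v h2 hw
        obtain ⟨S'', b1, b2, b3, b4⟩ := add_node S' a2 l r' (a1 hl) a4
        refine ⟨S'', a1.trans b1, b2, ?_, _, b4, ?_, ?_⟩
        · simp only [height]; omega
        · simp [yield, a5, h1]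
        · simp only [height]; omega
    · obtain ⟨S', a1, a2, a3, r', a4, a5, a6⟩ := ihl hl u w h1 hu
      refine ⟨S', a1, a2, ?_, r', a4, a5, ?_⟩ <;> simp only [height] <;> omega

theorem suffix_tree {α : Type u} (S : Finset (BT α)) (hS : Closed S) (t : BT α) :
    t ∈ S → ∀ u v : List α, t.yield = u ++ v → v ≠ [] →
    ∃ S' : Finset (BT α), S ⊆ S' ∧ Closed S' ∧ S'.card ≤ S.card + t.height ∧
      ∃ t' ∈ S', t'.yield = v ∧ t'.height ≤ t.height := by
  induction t with
  | leaf a =>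
    intro ht u v huv hu
    refine ⟨S, subset_rfl, hS, by simp, leaf a, ht, ?_, le_rfl⟩
    cases u with
    | nil => simpa using huv
    | cons b u =>
      simp [yield] at huv ⊢
      grind
  | node l r ihl ihr =>
    intro ht u v huv hu
    obtain ⟨hl, hr⟩ := hS _ _ ht
    simp only [yield] at huv
    rcases List.append_eq_append_iff.1 huv with ⟨w, h1, h2⟩ | ⟨w, h1, h2⟩
    · obtain ⟨S', a1, a2, a3, r', a4, a5, a6⟩ := ihr hr w v h2 hu
      refine ⟨S', a1, a2, ?_, r', a4, a5, ?_⟩ <;> simp only [height] <;> omega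
    · by_cases hw : w = []
      · subst hw
        exact ⟨S, subset_rfl, hS, by simp, r, hr, by simpa using h2.symm,
          by simp only [height]; omega⟩
      · obtain ⟨S', a1, a2, a3, l', a4, a5, a6⟩ := ihl hl u w h1 hw
        obtain ⟨S'', b1, b2, b3, b4⟩ := add_node S' a2 l' r a4 (a1 hr)
        refine ⟨S'', a1.trans b1, b2, ?_, _, b4, ?_, ?_⟩
        · simp only [height]; omega
        · simp [yield, a5, h2]
        · simp only [height]; omega

theorem rep_infix {α : Type u} (S : Finset (BT α)) (hS : Closed S) (u v : List α) (h : ℕ)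
    (hu : Rep S u h) (hv : v <:+: u) :
    ∃ S' : Finset (BT α), S ⊆ S' ∧ Closed S' ∧ S'.card ≤ S.card + 2 * h ∧ Rep S' v h := by
  by_cases hv0 : v = []
  · exact ⟨S, subset_rfl, hS, by omega, Or.inl hv0⟩
  obtain ⟨a, b, hab⟩ := hv
  rcases hu with hu | ⟨t, ht, hy, hh⟩
  · subst hu; simp [hv0] at hab
  obtain ⟨S', a1, a2, a3, t', a4, a5, a6⟩ :=
    prefix_tree S hS t ht (a ++ v) b (by rw [hy, hab]) (by simp [hv0])
  obtain ⟨S'', b1, b2, b3, t'', b4, b5, b6⟩ := suffix_tree S' a2 t' a4 a v a5 hv0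
  exact ⟨S'', a1.trans b1, b2, by omega, Or.inr ⟨t'', b4, b5, by omega⟩⟩

theorem rep_append {α : Type u} (S : Finset (BT α)) (hS : Closed S) (u v : List α) (h h' : ℕ)
    (hu : Rep S u h) (hv : Rep S v h') :
    ∃ S' : Finset (BT α), S ⊆ S' ∧ Closed S' ∧ S'.card ≤ S.card + 1 ∧
      Rep S' (u ++ v) (max h h' + 1) := by
  rcases hu with hu | ⟨t, ht, hy, hh⟩
  · subst hu
    exact ⟨S, subset_rfl, hS, by omega, by simpa using hv.mono subset_rfl (by omega)⟩
  rcases hv with hv | ⟨t', ht', hy', hh'⟩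
  · subst hv
    exact ⟨S, subset_rfl, hS, by omega, Or.inr ⟨t, ht, by simpa using hy, by omega⟩⟩
  obtain ⟨S', b1, b2, b3, b4⟩ := add_node S hS t t' ht ht'
  refine ⟨S', b1, b2, b3, Or.inr ⟨_, b4, by simp [yield, hy, hy'], ?_⟩⟩
  simp only [height]; omega

theorem bulk {α : Type u} (S : Finset (BT α)) (hS : Closed S) (f : ℕ → List α) (h c : ℕ)
    (Γ : Finset ℕ)
    (H : ∀ S' : Finset (BT α), S ⊆ S' → Closed S' → ∀ p ∈ Γ,
      ∃ S'' : Finset (BT α), S' ⊆ S'' ∧ Closed S'' ∧ S''.card ≤ S'.card + c ∧ Rep S'' (f p) h) :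
    ∃ S' : Finset (BT α), S ⊆ S' ∧ Closed S' ∧ S'.card ≤ S.card + Γ.card * c ∧
      ∀ p ∈ Γ, Rep S' (f p) h := by
  classical
  induction Γ using Finset.induction_on with
  | empty => exact ⟨S, subset_rfl, hS, by simp, by simp⟩
  | insert q G hq ih =>
    obtain ⟨S', a1, a2, a3, a4⟩ :=
      ih (fun S' h1 h2 p hp => H S' h1 h2 p (Finset.mem_insert_of_mem hp))
    obtain ⟨S'', b1, b2, b3, b4⟩ := H S' a1 a2 q (Finset.mem_insert_self _ _)
    refine ⟨S'', a1.trans b1, b2, ?_, ?_⟩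
    · rw [Finset.card_insert_of_notMem hq, add_mul]; omega
    · intro p hp
      rcases Finset.mem_insert.1 hp with rfl | hp
      · exact b4
      · exact (a4 p hp).mono b1 le_rfl

/-- zero-based half-open substring -/
def sub {α : Type u} (T : List α) (a b : ℕ) : List α := (T.drop a).take (b - a)

theorem sub_append {α : Type u} (T : List α) (a b c : ℕ) (h1 : a ≤ b) (h2 : b ≤ c) :
    sub T a b ++ sub T b c = sub T a c := by
  unfold sub
  have e : c - a = (b - a) + (c - b) := by omega
  rw [e, List.take_add, List.drop_drop]
  congr 4
  omega

theorem sub_infix {α : Type u} (T : List α) (a b a' b' : ℕ) (h1 : a' ≤ a) (h : a ≤ b)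
    (h2 : b ≤ b') : sub T a b <:+: sub T a' b' :=
  ⟨sub T a' a, sub T b b', by rw [sub_append T a' a b h1 h, sub_append T a' b b' (by omega) h2]⟩

def win {α : Type u} (T : List α) (k p : ℕ) : List α := sub T (p - 2 ^ k) (p + 2 ^ k - 1)

theorem attr_win {α : Type u} (T : List α) (Γ : Finset ℕ) (hΓ : IsAttractor T Γ) (k a b : ℕ)
    (hab : b ≤ a + 2 ^ k) (hne : sub T a b ≠ []) : ∃ p ∈ Γ, sub T a b <:+: win T k p := by
  have hlen : 0 < (sub T a b).length := List.length_pos_iff.2 hne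
  simp only [sub, List.length_take, List.length_drop] at hlen
  obtain ⟨i, j, p, h1, h2, h3, h4, h5, h6, h7⟩ :=
    hΓ.2 (a + 1) (min b T.length) (by omega) (by omega) (by omega)
  have e1 : substr T (a + 1) (min b T.length) = sub T a b := by
    unfold substr sub
    rw [Nat.add_sub_cancel, List.take_eq_take_iff]
    simp only [List.length_drop]
    omega
  have e2 : substr T i j = sub T (i - 1) j := by
    unfold substr sub
    congr 1
    omega
  have hl : (substr T i j).length = j + 1 - i := by
    simp only [substr, List.length_take, List.length_drop]; omega
  have hl2 : (sub T a b).length ≤ 2 ^ k := by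
    simp only [sub, List.length_take, List.length_drop]; omega
  rw [e1] at h4
  rw [h4] at hl
  refine ⟨p, h5, ?_⟩
  rw [← h4, e2]
  apply sub_infix <;> omega

theorem rep_block {α : Type u} (T : List α) (Γ : Finset ℕ) (hΓ : IsAttractor T Γ) (k h : ℕ)
    (S : Finset (BT α)) (hS : Closed S) (hw : ∀ p ∈ Γ, Rep S (win T k p) h)
    (a b : ℕ) (hab : b ≤ a + 2 ^ k) :
    ∃ S' : Finset (BT α), S ⊆ S' ∧ Closed S' ∧ S'.card ≤ S.card + 2 * h ∧
      Rep S' (sub T a b) h := by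
  by_cases hne : sub T a b = []
  · exact ⟨S, subset_rfl, hS, by omega, Or.inl hne⟩
  · obtain ⟨p, hp, hi⟩ := attr_win T Γ hΓ k a b hab hne
    exact rep_infix S hS _ _ h (hw p hp) hi

theorem win_succ {α : Type u} (T : List α) (k p : ℕ) (hp : 1 ≤ p) :
    win T (k + 1) p = (sub T (p - 2 ^ (k + 1)) (p - 2 ^ k) ++ win T k p) ++
      sub T (p + 2 ^ k - 1) (p + 2 ^ (k + 1) - 1) := by
  have : 2 ^ (k + 1) = 2 ^ k + 2 ^ k := by ring
  have h0 : 0 < 2 ^ k := by positivity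
  unfold win
  rw [sub_append, sub_append] <;> omega

theorem levels {α : Type u} (T : List α) (Γ : Finset ℕ) (hΓ : IsAttractor T Γ) (k : ℕ) :
    ∃ S : Finset (BT α), Closed S ∧ S.card ≤ Γ.card * (1 + 4 * k ^ 2) ∧
      ∀ p ∈ Γ, Rep S (win T k p) (2 * k) := by
  induction k with
  | zero =>
    obtain ⟨S, h1, h2, h3, h4⟩ := bulk (∅ : Finset (BT α)) (by intro l r h; simp at h)
      (fun p => win T 0 p) 0 1 Γ (by
        intro S' _ hS' p hp
        obtain ⟨hp1, hp2⟩ := hΓ.1 p hp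
        have hlt : p - 1 < T.length := by omega
        obtain ⟨S'', b1, b2, b3, b4⟩ := add_leaf S' hS' (T[p - 1])
        refine ⟨S'', b1, b2, b3, Or.inr ⟨_, b4, ?_, le_rfl⟩⟩
        have e : p - (p - 1) = 1 := by omega
        simp only [yield, win, sub, pow_zero, Nat.add_sub_cancel, e]
        rw [List.drop_eq_getElem_cons hlt, List.take_succ_cons, List.take_zero])
    exact ⟨S, h2, by simpa using h3, by simpa using h4⟩
  | succ k ih =>
    obtain ⟨S, c1, c2, c3⟩ := ih
    have e : 2 ^ (k + 1) = 2 ^ k + 2 ^ k := by ring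
    obtain ⟨S1, h1, h2, h3, h4⟩ := bulk S c1 (fun p => win T (k + 1) p) (2 * (k + 1))
      (8 * k + 2) Γ (by
        intro S1 hs1 hc1 p hp
        obtain ⟨hp1, hp2⟩ := hΓ.1 p hp
        have hw1 : ∀ p ∈ Γ, Rep S1 (win T k p) (2 * k) := fun p hp => (c3 p hp).mono hs1 le_rfl
        obtain ⟨S2, hs2, hc2, hn2, hr2⟩ := rep_block T Γ hΓ k (2 * k) S1 hc1 hw1
          (p - 2 ^ (k + 1)) (p - 2 ^ k) (by omega)
        have hw2 : ∀ p ∈ Γ, Rep S2 (win T k p) (2 * k) := fun p hp => (hw1 p hp).mono hs2 le_rfl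
        obtain ⟨S3, hs3, hc3, hn3, hr3⟩ := rep_block T Γ hΓ k (2 * k) S2 hc2 hw2
          (p + 2 ^ k - 1) (p + 2 ^ (k + 1) - 1) (by
            rw [e]; generalize 2 ^ k = x; omega)
        obtain ⟨S4, hs4, hc4, hn4, hr4⟩ := rep_append S3 hc3 _ _ _ _
          (hr2.mono hs3 le_rfl) ((hw2 p hp).mono hs3 le_rfl)
        obtain ⟨S5, hs5, hc5, hn5, hr5⟩ := rep_append S4 hc4 _ _ _ _
          hr4 (hr3.mono hs4 le_rfl)
        refine ⟨S5, hs2.trans (hs3.trans (hs4.trans hs5)), hc5, by omega, ?_⟩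
        simp only [win_succ T k p hp1]
        exact hr5.mono subset_rfl (by omega))
    refine ⟨S1, h2, ?_, h4⟩
    calc S1.card ≤ Γ.card * (1 + 4 * k ^ 2) + Γ.card * (8 * k + 2) := by omega
      _ = Γ.card * (1 + 4 * k ^ 2 + (8 * k + 2)) := by ring
      _ ≤ _ := Nat.mul_le_mul_left _ (by nlinarith)

theorem blocks {α : Type u} (T : List α) (Γ : Finset ℕ) (hΓ : IsAttractor T Γ) (k h : ℕ)
    (S : Finset (BT α)) (hS : Closed S) (hw : ∀ p ∈ Γ, Rep S (win T k p) h) (i : ℕ) :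
    ∃ S' : Finset (BT α), S ⊆ S' ∧ Closed S' ∧ S'.card ≤ S.card + i * (2 * h + 1) ∧
      ∃ h', Rep S' (sub T 0 (i * 2 ^ k)) h' := by
  induction i with
  | zero => exact ⟨S, subset_rfl, hS, by simp, 0, Or.inl (by simp [sub])⟩
  | succ i ih =>
    obtain ⟨S1, hs1, hc1, hn1, h', hr1⟩ := ih
    obtain ⟨S2, hs2, hc2, hn2, hr2⟩ := rep_block T Γ hΓ k h S1 hc1
      (fun p hp => (hw p hp).mono hs1 le_rfl) (i * 2 ^ k) ((i + 1) * 2 ^ k)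
      (by rw [add_mul, one_mul])
    obtain ⟨S3, hs3, hc3, hn3, hr3⟩ := rep_append S2 hc2 _ _ _ _ (hr1.mono hs2 le_rfl) hr2
    refine ⟨S3, hs1.trans (hs2.trans hs3), hc3, ?_, h' ⊔ h + 1, ?_⟩
    · rw [add_mul]; omega
    · rwa [sub_append] at hr3
      · omega
      · exact Nat.mul_le_mul_right _ (by omega)

theorem toSLP {α : Type u} (S : Finset (BT α)) (hS : Closed S) (t : BT α) (ht : t ∈ S) :
    GeneratedBySLP t.yield S.card := by
  classical
  let e := S.equivFin
  let R : (x : BT α) → x ∈ S → CRule α S.card := fun x => match x with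
    | leaf a => fun _ => CRule.term a
    | node l r => fun h => CRule.cat (e ⟨l, (hS l r h).1⟩) (e ⟨r, (hS l r h).2⟩)
  refine ⟨fun X => R (e.symm X).1 (e.symm X).2, fun X => (e.symm X).1.yield,
    fun X => (e.symm X).1.height, e ⟨t, ht⟩, ?_, ?_, by simp⟩
  · intro X
    obtain ⟨⟨x, hx⟩, rfl⟩ := e.surjective X
    unfold CRuleOk
    simp only [Equiv.symm_apply_apply]
    cases x with
    | leaf a => simp [R, yield]
    | node l r =>
      have hl : l.height < (node l r).height := by simp only [height]; omega
      have hr : r.height < (node l r).height := by simp only [height]; omega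
      simp only [R, Equiv.symm_apply_apply, yield]
      refine ⟨?_, ?_, hl, hr, trivial⟩
      · intro h
        have := congrArg Subtype.val (e.injective h)
        simp only at this
        rw [← this] at hl
        exact lt_irrefl _ hl
      · intro h
        have := congrArg Subtype.val (e.injective h)
        simp only at this
        rw [← this] at hr
        exact lt_irrefl _ hr
  · intro X
    obtain ⟨⟨x, hx⟩, rfl⟩ := e.surjective X
    simp only [Equiv.symm_apply_apply]
    cases x <;> simp [R, CRule.IsSLPRule]

theorem main_nat {α : Type u} (T : List α) (Γ : Finset ℕ) (hT : T ≠ [])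
    (hΓ : IsAttractor T Γ) (k : ℕ) (hk : T.length ≤ Γ.card * 2 ^ k) :
    ∃ g : ℕ, GeneratedBySLP T g ∧ g ≤ Γ.card * (4 * k ^ 2 + 4 * k + 2) := by
  obtain ⟨S, h1, h2, h3⟩ := levels T Γ hΓ k
  obtain ⟨S', _, hc, hn, h', hr⟩ := blocks T Γ hΓ k _ S h1 h3 Γ.card
  have e : sub T 0 (Γ.card * 2 ^ k) = T := by
    simp only [sub, List.drop_zero, Nat.sub_zero]
    exact List.take_of_length_le hk
  rw [e] at hr
  rcases hr with hr | ⟨t, ht, hy, -⟩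
  · exact absurd hr hT
  refine ⟨S'.card, hy ▸ toSLP S' hc t ht, ?_⟩
  calc S'.card ≤ Γ.card * (1 + 4 * k ^ 2) + Γ.card * (2 * (2 * k) + 1) := by omega
    _ = _ := by ring

end BT

/-- there is an absolute constant `C > 0` such that every nonempty
string `T` of length `n` with a string attractor of size `γ` is generated by a
straight-line program of size at most `C · γ · (1 + log₂(n/γ))²`. -/
theorem attractor_to_slp :
    ∃ C : ℝ, 0 < C ∧ ∀ (α : Type u) (T : List α) (Γ : Finset ℕ), T ≠ [] →
      IsAttractor T Γ →
      ∃ g : ℕ, GeneratedBySLP T g ∧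
        (g : ℝ) ≤ C * (Γ.card : ℝ) *
          (1 + Real.logb 2 ((T.length : ℝ) / (Γ.card : ℝ))) ^ 2 := by
  refine ⟨10, by norm_num, ?_⟩
  intro α T Γ hT hΓ
  have hn : 0 < T.length := List.length_pos_iff.2 hT
  have hg : 0 < Γ.card := by
    obtain ⟨_, _, p, _, _, _, _, hp, _⟩ := hΓ.2 1 1 le_rfl le_rfl hn
    exact Finset.card_pos.2 ⟨p, hp⟩
  have hgn : Γ.card ≤ T.length := by
    have : Γ ⊆ Finset.Icc 1 T.length := fun p hp => Finset.mem_Icc.2 (hΓ.1 p hp)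
    simpa using Finset.card_le_card this
  have hgR : (0 : ℝ) < Γ.card := by exact_mod_cast hg
  have hnR : (0 : ℝ) < T.length := by exact_mod_cast hn
  have hL : 0 ≤ Real.logb 2 ((T.length : ℝ) / (Γ.card : ℝ)) := by
    apply Real.logb_nonneg (by norm_num)
    rw [le_div_iff₀ hgR, one_mul]
    exact_mod_cast hgn
  have hex : ∃ k, T.length ≤ Γ.card * 2 ^ k :=
    ⟨T.length, by nlinarith [Nat.lt_two_pow_self (n := T.length)]⟩
  classical
  obtain ⟨k, hk, hmin⟩ : ∃ k, T.length ≤ Γ.card * 2 ^ k ∧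
      ∀ m < k, ¬ T.length ≤ Γ.card * 2 ^ m :=
    ⟨Nat.find hex, Nat.find_spec hex, fun m hm => Nat.find_min hex hm⟩
  have hkL : (k : ℝ) ≤ 1 + Real.logb 2 ((T.length : ℝ) / (Γ.card : ℝ)) := by
    cases k with
    | zero => simp only [Nat.cast_zero]; linarith
    | succ m =>
      have h := hmin m (by omega)
      have h' : (Γ.card : ℝ) * 2 ^ m ≤ T.length := by
        have : Γ.card * 2 ^ m ≤ T.length := by omega
        exact_mod_cast this
      have : (m : ℝ) ≤ Real.logb 2 ((T.length : ℝ) / (Γ.card : ℝ)) := by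
        rw [Real.le_logb_iff_rpow_le (by norm_num) (by positivity), le_div_iff₀ hgR,
          Real.rpow_natCast]
        linarith
      push_cast
      linarith
  obtain ⟨g, hgen, hle⟩ := BT.main_nat T Γ hT hΓ k hk
  refine ⟨g, hgen, ?_⟩
  generalize Real.logb 2 ((T.length : ℝ) / (Γ.card : ℝ)) = L at *
  have h1 : (g : ℝ) ≤ (Γ.card : ℝ) * (4 * (k : ℝ) ^ 2 + 4 * k + 2) := by exact_mod_cast hle
  have hk0 : (0 : ℝ) ≤ k := by positivity
  have h2 : 4 * (k : ℝ) ^ 2 + 4 * k + 2 ≤ 10 * (1 + L) ^ 2 := by nlinarith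
  calc (g : ℝ) ≤ _ := h1
    _ ≤ (Γ.card : ℝ) * (10 * (1 + L) ^ 2) := by gcongr
    _ = _ := by ring
end

section
/- There is an absolute constant C > 0 such that for every string T of length n the following hold, where γ* is the size of a smallest string attractor of T, b* the size of a smallest macro scheme of T, c* the size of a smallest collage system generating T, g* the size of a smallest SLP generating T, g_rl* the size of a smallest run-length SLP generating T, and z the number of LZ77 phrases of T: (1) b* ≤ C·γ*·(1 + log(n/γ*)) and c* ≤ C·γ*·(1 + log(n/γ*)); (2) g* ≤ C·γ*·(1 + log(n/γ*))², g_rl* ≤ C·γ*·(1 + log(n/γ*))², and z ≤ C·γ*·(1 + log(n/γ*))². -/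
universe u

variable {α : Type*}

/-- `minMacro T` is the size `b*` of a smallest macro scheme for `T`. -/
noncomputable def minMacro (T : List α) : ℕ :=
  sInf {m | ∃ M : Finset (Directive α), IsMacroScheme T M ∧ M.card = m}

/-- A run-length SLP rule: only the forms `X → a`, `X → AB` and `X → R^ℓ` are allowed. -/
def CRule.IsRLSLPRule {c : ℕ} : CRule α c → Prop
  | .slice _ _ _ => False
  | _ => True

/-- `T` is generated by some run-length straight-line program of size `g`. -/
def GeneratedByRLSLP (T : List α) (g : ℕ) : Prop :=
  ∃ (rule : Fin g → CRule α g) (exp : Fin g → List α) (rank : Fin g → ℕ) (S : Fin g),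
    IsCollage rule exp rank ∧ (∀ X, (rule X).IsRLSLPRule) ∧ exp S = T

/-- `minAttr T` is the size `γ*` of a smallest string attractor of `T`. -/
noncomputable def minAttr (T : List α) : ℕ :=
  sInf {m | ∃ Γ : Finset ℕ, IsAttractor T Γ ∧ Γ.card = m}

/-- `minCollage T` is the size `c*` of a smallest collage system generating `T`. -/
noncomputable def minCollage (T : List α) : ℕ := sInf {c | GeneratedByCollage T c}

/-- `minSLP T` is the size `g*` of a smallest SLP generating `T`. -/
noncomputable def minSLP (T : List α) : ℕ := sInf {g | GeneratedBySLP T g}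

/-- `minRLSLP T` is the size `g_rl*` of a smallest run-length SLP generating `T`. -/
noncomputable def minRLSLP (T : List α) : ℕ := sInf {g | GeneratedByRLSLP T g}

/-- Length of the greedy LZ77 phrase (non-overlapping variant) starting at the
1-based position `i`: the maximum of `1` and the largest `ℓ` such that
`T[i..i+ℓ-1]` has an occurrence `T[p..p+ℓ-1]` with `p+ℓ-1 < i`. -/
noncomputable def lzLen (T : List α) (i : ℕ) : ℕ :=
  max 1 (sSup {ℓ : ℕ | ∃ p : ℕ, 1 ≤ p ∧ p + ℓ ≤ i ∧ i + ℓ ≤ T.length + 1 ∧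
    substr T p (p + ℓ - 1) = substr T i (i + ℓ - 1)})

/-- Starting position of the `k`-th (0-based) phrase of the LZ77 parsing of `T`. -/
noncomputable def lzStart (T : List α) : ℕ → ℕ
  | 0 => 1
  | k + 1 => lzStart T k + lzLen T (lzStart T k)

/-- `z`: the number of phrases of the LZ77 parsing of `T`. -/
noncomputable def lzCount (T : List α) : ℕ := sInf {k : ℕ | lzStart T k = T.length + 1}

section Helpers

/-- 0-based half-open substring. -/
def sb (T : List α) (a b : ℕ) : List α := (T.drop a).take (b - a)

theorem sb_get (T : List α) (a b i : ℕ) : (sb T a b)[i]? = if i < b - a then T[a+i]? else none := by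
  unfold sb
  rw [List.getElem?_take]
  simp [List.getElem?_drop]

theorem sb_length (T : List α) (a b : ℕ) (hb : b ≤ T.length) : (sb T a b).length = b - a := by
  simp [sb]; omega

theorem substr_eq_sb (T : List α) (a b : ℕ) : substr T (a+1) b = sb T a b := by
  simp [substr, sb]

theorem sb_append (T : List α) (a b c : ℕ) (hab : a ≤ b) (hbc : b ≤ c) :
    sb T a b ++ sb T b c = sb T a c := by
  unfold sb
  have h1 : c - a = (b - a) + (c - b) := by omega
  rw [h1, List.take_add, List.drop_drop]
  congr 3; omega

theorem sb_sb (T : List α) (a b c d : ℕ) (hd : c + d ≤ b - a) :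
    sb (sb T a b) c (c+d) = sb T (a+c) (a+c+d) := by
  apply List.ext_getElem?
  intro i
  rw [sb_get, sb_get, sb_get]
  by_cases h : i < d
  · rw [if_pos (by omega), if_pos (by omega), if_pos (by omega)]; congr 1; omega
  · rw [if_neg (by omega), if_neg (by omega)]

theorem sb_full (T : List α) : sb T 0 T.length = T := by simp [sb]

inductive CT (α : Type u) where
  | leaf (a : α)
  | node (l r : CT α)
  | slice (t : CT α) (l r : ℕ)

namespace CT

def ex : CT α → List α
  | leaf a => [a]
  | node l r => ex l ++ ex r
  | slice t l r => substr (ex t) l r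

def ht : CT α → ℕ
  | leaf _ => 0
  | node l r => max (ht l) (ht r) + 1
  | slice t _ _ => ht t + 1

def good (f : Prop) : CT α → Prop
  | leaf _ => True
  | node l r => good f l ∧ good f r
  | slice t l r => f ∧ good f t ∧ 1 ≤ l ∧ l ≤ r ∧ r ≤ (ex t).length

open Classical in
noncomputable def subs : CT α → Finset (CT α)
  | leaf a => {leaf a}
  | node l r => {node l r} ∪ (subs l ∪ subs r)
  | slice t l r => {slice t l r} ∪ subs t

theorem self_mem (t : CT α) : t ∈ subs t := by cases t <;> simp [subs]

theorem subs_trans {s t : CT α} (h : s ∈ subs t) : subs s ⊆ subs t := by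
  induction t with
  | leaf a => simp [subs] at h; subst h; exact Finset.Subset.refl _
  | node l r ihl ihr =>
    simp only [subs, Finset.mem_union, Finset.mem_singleton] at h
    rcases h with h | h | h
    · subst h; exact Finset.Subset.refl _
    · intro x hx; simp [subs, ihl h hx]
    · intro x hx; simp [subs, ihr h hx]
  | slice t a b ih =>
    simp only [subs, Finset.mem_union, Finset.mem_singleton] at h
    rcases h with h | h
    · subst h; exact Finset.Subset.refl _
    · intro x hx; simp [subs, ih h hx]

theorem good_sub {f : Prop} {s t : CT α} (h : s ∈ subs t) (ht : good f t) : good f s := by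
  induction t with
  | leaf a => simp [subs] at h; subst h; exact ht
  | node l r ihl ihr =>
    simp only [subs, Finset.mem_union, Finset.mem_singleton] at h
    rcases h with h | h | h
    · subst h; exact ht
    · exact ihl h ht.1
    · exact ihr h ht.2
  | slice t a b ih =>
    simp only [subs, Finset.mem_union, Finset.mem_singleton] at h
    rcases h with h | h
    · subst h; exact ht
    · exact ih h ht.2.1

theorem ht_sub {s t : CT α} (h : s ∈ subs t) : ht s ≤ ht t := by
  induction t with
  | leaf a => simp [subs] at h; subst h; exact le_rfl
  | node l r ihl ihr =>
    simp only [subs, Finset.mem_union, Finset.mem_singleton] at h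
    rcases h with h | h | h
    · subst h; exact le_rfl
    · have := ihl h; simp only [ht]; omega
    · have := ihr h; simp only [ht]; omega
  | slice t a b ih =>
    simp only [subs, Finset.mem_union, Finset.mem_singleton] at h
    rcases h with h | h
    · subst h; exact le_rfl
    · have := ih h; simp only [ht]; omega

theorem to_grammar {f : Prop} (t : CT α) (hg : good f t) :
    ∃ (rule : Fin (subs t).card → CRule α (subs t).card) (exp : Fin (subs t).card → List α)
      (rank : Fin (subs t).card → ℕ) (S : Fin (subs t).card),
    IsCollage rule exp rank ∧ (¬ f → ∀ X, (rule X).IsSLPRule) ∧ exp S = ex t := by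
  classical
  let e := (subs t).equivFin
  let exp : Fin (subs t).card → List α := fun X => ex (e.symm X).1
  let rank : Fin (subs t).card → ℕ := fun X => ht (e.symm X).1
  have key : ∀ X, ∃ r : CRule α (subs t).card, CRuleOk (fun _ => r) exp rank X ∧
      (¬ f → r.IsSLPRule) := by
    intro X
    have hm := (e.symm X).2
    have hgs := good_sub hm hg
    have hsub := subs_trans hm
    have hr : rank X = ht (e.symm X).1 := rfl
    have hx : exp X = ex (e.symm X).1 := rfl
    have hne : ∀ Y, rank Y < rank X → Y ≠ X := by
      rintro Y h rfl; exact lt_irrefl _ h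
    generalize (e.symm X).1 = s at *
    have mk : ∀ u ∈ subs s, ∃ Y, exp Y = ex u ∧ rank Y = ht u := by
      intro u hu
      exact ⟨e ⟨u, hsub hu⟩, by simp [exp], by simp [rank]⟩
    cases s with
    | leaf a => exact ⟨.term a, by simpa [CRuleOk, ex] using hx, fun _ => trivial⟩
    | node l r =>
      obtain ⟨A, hA1, hA2⟩ := mk l (by simp [subs, self_mem])
      obtain ⟨B, hB1, hB2⟩ := mk r (by simp [subs, self_mem])
      have h1 : rank A < rank X := by simp only [hr, hA2, ht]; omega
      have h2 : rank B < rank X := by simp only [hr, hB2, ht]; omega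
      refine ⟨.cat A B, ⟨hne _ h1, hne _ h2, h1, h2, ?_⟩, fun _ => trivial⟩
      rw [hx, hA1, hB1]; rfl
    | slice u a b =>
      obtain ⟨A, hA1, hA2⟩ := mk u (by simp [subs, self_mem])
      have h1 : rank A < rank X := by simp only [hr, hA2, ht]; omega
      refine ⟨.slice A a b, ⟨hne _ h1, h1, hgs.2.2.1, hgs.2.2.2.1, ?_, ?_⟩, fun h => (h hgs.1).elim⟩
      · rw [hA1]; exact hgs.2.2.2.2
      · rw [hx, hA1]; rfl
  choose rule h1 h2 using key
  refine ⟨rule, exp, rank, e ⟨t, self_mem t⟩, fun X => h1 X, fun hf X => h2 X hf, ?_⟩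
  simp [exp]

theorem minCollage_le {f : Prop} (t : CT α) (hg : good f t) : minCollage (ex t) ≤ (subs t).card := by
  apply Nat.sInf_le
  obtain ⟨r, e, k, S, h1, _, h3⟩ := to_grammar t hg
  exact ⟨r, e, k, S, h1, h3⟩

theorem minSLP_le (t : CT α) (hg : good False t) : minSLP (ex t) ≤ (subs t).card := by
  apply Nat.sInf_le
  obtain ⟨r, e, k, S, h1, h2, h3⟩ := to_grammar t hg
  exact ⟨r, e, k, S, h1, h2 not_false, h3⟩

theorem minRLSLP_le (t : CT α) (hg : good False t) : minRLSLP (ex t) ≤ (subs t).card := by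
  apply Nat.sInf_le
  obtain ⟨r, e, k, S, h1, h2, h3⟩ := to_grammar t hg
  refine ⟨r, e, k, S, h1, fun X => ?_, h3⟩
  have := h2 not_false X
  revert this
  cases r X <;> simp [CRule.IsSLPRule, CRule.IsRLSLPRule]

/-- Extraction by pruning. -/
theorem suffix_ex (t : CT α) (hg : good False t) (a : ℕ) (ha : a < (ex t).length) :
    ∃ t', good False t' ∧ ex t' = (ex t).drop a ∧ ht t' ≤ ht t ∧
      ∃ N : Finset (CT α), (∀ s ∈ subs t', s ∈ subs t ∨ s ∈ N) ∧ N.card ≤ ht t := by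
  classical
  induction t generalizing a with
  | leaf x =>
    simp [ex] at ha
    subst ha
    exact ⟨leaf x, hg, by simp, le_rfl, ∅, fun s h => Or.inl h, by simp⟩
  | slice t l r _ => exact hg.1.elim
  | node l r ihl ihr =>
    by_cases h : a < (ex l).length
    · obtain ⟨l', h1, h2, h3, N, h4, h5⟩ := ihl hg.1 a h
      refine ⟨node l' r, ⟨h1, hg.2⟩, ?_, ?_, insert (node l' r) N, ?_, ?_⟩
      · simp only [ex, h2]; rw [List.drop_append_of_le_length (by omega)]
      · simp only [ht]; omega
      · intro s hs
        simp only [subs, Finset.mem_union, Finset.mem_singleton, Finset.mem_insert] at hs ⊢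
        rcases hs with hs | hs | hs
        · tauto
        · have := h4 s hs; tauto
        · tauto
      · have := Finset.card_insert_le (node l' r) N
        simp only [ht]; omega
    · simp only [ex, List.length_append] at ha
      obtain ⟨r', h1, h2, h3, N, h4, h5⟩ := ihr hg.2 (a - (ex l).length) (by omega)
      refine ⟨r', h1, ?_, ?_, N, ?_, ?_⟩
      · simp only [ex, h2]; rw [List.drop_append, List.drop_eq_nil_of_le (by omega : (ex l).length ≤ a)]; simp
      · simp only [ht]; omega
      · intro s hs
        have := h4 s hs
        simp only [subs, Finset.mem_union]; tauto
      · simp only [ht]; omega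

theorem prefix_ex (t : CT α) (hg : good False t) (b : ℕ) (hb : 0 < b) (hb' : b ≤ (ex t).length) :
    ∃ t', good False t' ∧ ex t' = (ex t).take b ∧ ht t' ≤ ht t ∧
      ∃ N : Finset (CT α), (∀ s ∈ subs t', s ∈ subs t ∨ s ∈ N) ∧ N.card ≤ ht t := by
  classical
  induction t generalizing b with
  | leaf x =>
    simp [ex] at hb'
    have : b = 1 := by omega
    subst this
    exact ⟨leaf x, hg, by simp [ex], le_rfl, ∅, fun s h => Or.inl h, by simp⟩
  | slice t l r _ => exact hg.1.elim
  | node l r ihl ihr =>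
    by_cases h : b ≤ (ex l).length
    · obtain ⟨l', h1, h2, h3, N, h4, h5⟩ := ihl hg.1 b hb h
      refine ⟨l', h1, ?_, ?_, N, ?_, ?_⟩
      · simp only [ex, h2]; rw [List.take_append_of_le_length (by omega)]
      · simp only [ht]; omega
      · intro s hs
        have := h4 s hs
        simp only [subs, Finset.mem_union]; tauto
      · simp only [ht]; omega
    · simp only [ex, List.length_append] at hb'
      obtain ⟨r', h1, h2, h3, N, h4, h5⟩ := ihr hg.2 (b - (ex l).length) (by omega) (by omega)
      refine ⟨node l r', ⟨hg.1, h1⟩, ?_, ?_, insert (node l r') N, ?_, ?_⟩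
      · simp only [ex, h2]; rw [List.take_append, List.take_of_length_le (by omega : (ex l).length ≤ b)]
      · simp only [ht]; omega
      · intro s hs
        simp only [subs, Finset.mem_union, Finset.mem_singleton, Finset.mem_insert] at hs ⊢
        rcases hs with hs | hs | hs
        · tauto
        · tauto
        · have := h4 s hs; tauto
      · have := Finset.card_insert_le (node l r') N
        simp only [ht]; omega

/-- Extraction property with cost `c`. -/
def Extr (α : Type u) (f : Prop) (c : ℕ → ℕ) : Prop :=
  ∀ t : CT α, good f t → ∀ a b, a < b → b ≤ (ex t).length →
    ∃ t', good f t' ∧ ex t' = sb (ex t) a b ∧ ht t' ≤ ht t + 1 ∧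
      ∃ N : Finset (CT α), (∀ s ∈ subs t', s ∈ subs t ∨ s ∈ N) ∧ N.card ≤ c (ht t)

theorem extr_slp : Extr α False (fun h => 2 * h) := by
  classical
  intro t hg a b hab hb
  obtain ⟨t1, g1, e1, k1, N1, s1, c1⟩ := suffix_ex t hg a (by omega)
  obtain ⟨t2, g2, e2, k2, N2, s2, c2⟩ := prefix_ex t1 g1 (b - a) (by omega) (by rw [e1, List.length_drop]; omega)
  refine ⟨t2, g2, by rw [e2, e1]; rfl, by omega, N1 ∪ N2, ?_, ?_⟩
  · intro s hs
    rw [Finset.mem_union]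
    rcases s2 s hs with h | h
    · have := s1 s h; tauto
    · tauto
  · have := Finset.card_union_le N1 N2
    simp only; omega

theorem extr_col : Extr α True (fun _ => 1) := by
  classical
  intro t hg a b hab hb
  refine ⟨slice t (a+1) b, ⟨trivial, hg, by omega, by omega, hb⟩, substr_eq_sb _ _ _, le_rfl,
    {slice t (a+1) b}, ?_, by simp⟩
  intro s hs
  simp only [subs, Finset.mem_union, Finset.mem_singleton] at hs ⊢
  tauto

end CT
open CT

def Att0 (T : List α) (Q : Finset ℕ) : Prop :=
  (∀ q ∈ Q, q < T.length) ∧ ∀ a b, a < b → b ≤ T.length → ∃ a' q, q ∈ Q ∧ a' ≤ q ∧ q < a' + (b - a) ∧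
    a' + (b - a) ≤ T.length ∧ sb T a' (a' + (b - a)) = sb T a b

def Lev (T : List α) (Q : Finset ℕ) (f : Prop) (k h : ℕ) (F : Finset (CT α)) : Prop :=
  (∀ t ∈ F, good f t ∧ subs t ⊆ F) ∧
  ∀ q ∈ Q, ∃ t ∈ F, ex t = sb T (q + 1 - 2^k) (min T.length (q + 2^k)) ∧ ht t ≤ h

theorem lev_ext {T : List α} {Q : Finset ℕ} {f : Prop} {k h : ℕ} {F : Finset (CT α)} {c : ℕ → ℕ}
    (hA : Att0 T Q) (hL : Lev T Q f k h F) (hE : Extr α f c) (hc : Monotone c)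
    (a b : ℕ) (hab : a < b) (hb : b ≤ T.length) (hk : b - a ≤ 2^k) :
    ∃ t', good f t' ∧ ex t' = sb T a b ∧ ht t' ≤ h + 1 ∧
      ∃ N : Finset (CT α), (∀ s ∈ subs t', s ∈ F ∨ s ∈ N) ∧ N.card ≤ c h := by
  obtain ⟨a', q, hq, h1, h2, h3, h4⟩ := hA.2 a b hab hb
  obtain ⟨t, ht1, ht2, ht3⟩ := hL.2 q hq
  have hqn := hA.1 q hq
  have hlen : (ex t).length = min T.length (q + 2^k) - (q + 1 - 2^k) := by
    rw [ht2, sb_length _ _ _ (by omega)]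
  obtain ⟨t', g, e, hh, N, hs, hN⟩ := hE t (hL.1 t ht1).1 (a' - (q + 1 - 2^k))
    ((a' - (q + 1 - 2^k)) + (b - a)) (by omega) (by omega)
  refine ⟨t', g, ?_, by omega, N, ?_, hN.trans (hc ht3)⟩
  · rw [e, ht2, sb_sb _ _ _ _ _ (by omega), ← h4]
    congr 1 <;> omega
  · intro s hs'
    rcases hs s hs' with h | h
    · exact Or.inl ((hL.1 t ht1).2 h)
    · exact Or.inr h

theorem cat_left {T : List α} {Q : Finset ℕ} {f : Prop} {k h : ℕ} {F : Finset (CT α)} {c : ℕ → ℕ}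
    (hA : Att0 T Q) (hL : Lev T Q f k h F) (hE : Extr α f c) (hc : Monotone c)
    (a b d : ℕ) (hab : a ≤ b) (hbd : b ≤ d) (hb : d ≤ T.length) (hk : b - a ≤ 2^k)
    (t : CT α) (hg : good f t) (he : ex t = sb T b d) (N : Finset (CT α))
    (hN : ∀ s ∈ subs t, s ∈ F ∨ s ∈ N) :
    ∃ t', good f t' ∧ ex t' = sb T a d ∧ ht t' ≤ max (ht t) (h + 1) + 1 ∧
      ∃ N' : Finset (CT α), (∀ s ∈ subs t', s ∈ F ∨ s ∈ N') ∧ N'.card ≤ N.card + c h + 1 := by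
  classical
  rcases Nat.eq_or_lt_of_le hab with rfl | hlt
  · exact ⟨t, hg, he, by omega, N, hN, by omega⟩
  · obtain ⟨u, g, e, hh, M, hs, hM⟩ := lev_ext hA hL hE hc a b hlt (by omega) hk
    refine ⟨node u t, ⟨g, hg⟩, ?_, ?_, insert (node u t) (N ∪ M), ?_, ?_⟩
    · simp only [ex, e, he]; exact sb_append _ _ _ _ hab hbd
    · simp only [ht]; omega
    · intro s h'
      simp only [subs, Finset.mem_union, Finset.mem_singleton, Finset.mem_insert] at h' ⊢
      rcases h' with h' | h' | h'
      · tauto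
      · have := hs s h'; tauto
      · have := hN s h'; tauto
    · have := Finset.card_insert_le (node u t) (N ∪ M)
      have := Finset.card_union_le N M
      omega

theorem cat_right {T : List α} {Q : Finset ℕ} {f : Prop} {k h : ℕ} {F : Finset (CT α)} {c : ℕ → ℕ}
    (hA : Att0 T Q) (hL : Lev T Q f k h F) (hE : Extr α f c) (hc : Monotone c)
    (a b d : ℕ) (hab : a ≤ b) (hbd : b ≤ d) (hb : d ≤ T.length) (hk : d - b ≤ 2^k)
    (t : CT α) (hg : good f t) (he : ex t = sb T a b) (N : Finset (CT α))
    (hN : ∀ s ∈ subs t, s ∈ F ∨ s ∈ N) :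
    ∃ t', good f t' ∧ ex t' = sb T a d ∧ ht t' ≤ max (ht t) (h + 1) + 1 ∧
      ∃ N' : Finset (CT α), (∀ s ∈ subs t', s ∈ F ∨ s ∈ N') ∧ N'.card ≤ N.card + c h + 1 := by
  classical
  rcases Nat.eq_or_lt_of_le hbd with rfl | hlt
  · exact ⟨t, hg, he, by omega, N, hN, by omega⟩
  · obtain ⟨u, g, e, hh, M, hs, hM⟩ := lev_ext hA hL hE hc b d hlt (by omega) hk
    refine ⟨node t u, ⟨hg, g⟩, ?_, ?_, insert (node t u) (N ∪ M), ?_, ?_⟩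
    · simp only [ex, e, he]; exact sb_append _ _ _ _ hab hbd
    · simp only [ht]; omega
    · intro s h'
      simp only [subs, Finset.mem_union, Finset.mem_singleton, Finset.mem_insert] at h' ⊢
      rcases h' with h' | h' | h'
      · tauto
      · have := hN s h'; tauto
      · have := hs s h'; tauto
    · have := Finset.card_insert_le (node t u) (N ∪ M)
      have := Finset.card_union_le N M
      omega

theorem lev_step {T : List α} {Q : Finset ℕ} {f : Prop} {k h : ℕ} {F : Finset (CT α)} {c : ℕ → ℕ}
    (hA : Att0 T Q) (hL : Lev T Q f k h F) (hE : Extr α f c) (hc : Monotone c) :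
    ∃ F', Lev T Q f (k+1) (h+3) F' ∧ F'.card ≤ F.card + Q.card * (2 * c h + 2) := by
  classical
  have key : ∀ q, ∃ (S : Finset (CT α)) (N : Finset (CT α)), q ∈ Q → ∃ t, S = subs t ∧ good f t ∧
      ex t = sb T (q + 1 - 2^(k+1)) (min T.length (q + 2^(k+1))) ∧ ht t ≤ h + 3 ∧
      (∀ s ∈ subs t, s ∈ F ∨ s ∈ N) ∧ N.card ≤ 2 * c h + 2 := by
    intro q
    by_cases hq : q ∈ Q
    swap
    · exact ⟨∅, ∅, fun h => (hq h).elim⟩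
    obtain ⟨t, ht1, ht2, ht3⟩ := hL.2 q hq
    have hqn := hA.1 q hq
    have hp : 2^(k+1) = 2 * 2^k := by rw [pow_succ]; ring
    have hp1 : 0 < 2^k := by positivity
    obtain ⟨t1, g1, e1, k1, N1, s1, c1⟩ := cat_left hA hL hE hc (q + 1 - 2^(k+1)) (q + 1 - 2^k)
      (min T.length (q + 2^k)) (by omega) (by omega) (by omega) (by omega) t (hL.1 t ht1).1 ht2 ∅
      (fun s hs => Or.inl ((hL.1 t ht1).2 hs))
    obtain ⟨t2, g2, e2, k2, N2, s2, c2⟩ := cat_right hA hL hE hc (q + 1 - 2^(k+1)) 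
      (min T.length (q + 2^k)) (min T.length (q + 2^(k+1))) (by omega) (by omega) (by omega) (by omega)
      t1 g1 e1 N1 s1
    rw [Finset.card_empty] at c1
    exact ⟨subs t2, N2, fun _ => ⟨t2, rfl, g2, e2, by omega, s2, by omega⟩⟩
  choose S N hh using key
  refine ⟨F ∪ Q.biUnion S, ⟨?_, ?_⟩, ?_⟩
  · intro s hs
    rw [Finset.mem_union, Finset.mem_biUnion] at hs
    rcases hs with hs | ⟨q, hq, hs⟩
    · exact ⟨(hL.1 s hs).1, (hL.1 s hs).2.trans Finset.subset_union_left⟩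
    · obtain ⟨t, hS, h'⟩ := hh q hq
      rw [hS] at hs
      refine ⟨good_sub hs h'.1, fun x hx => ?_⟩
      rw [Finset.mem_union, Finset.mem_biUnion]
      exact Or.inr ⟨q, hq, hS ▸ subs_trans hs hx⟩
  · intro q hq
    obtain ⟨t, hS, h'⟩ := hh q hq
    refine ⟨t, ?_, h'.2.1, h'.2.2.1⟩
    rw [Finset.mem_union, Finset.mem_biUnion]
    exact Or.inr ⟨q, hq, hS ▸ self_mem _⟩
  · have h1 : F ∪ Q.biUnion S ⊆ F ∪ Q.biUnion N := by
      intro s hs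
      rw [Finset.mem_union, Finset.mem_biUnion] at hs ⊢
      rcases hs with hs | ⟨q, hq, hs⟩
      · exact Or.inl hs
      · obtain ⟨t, hS, h'⟩ := hh q hq
        rcases h'.2.2.2.1 s (hS ▸ hs) with h | h
        · exact Or.inl h
        · exact Or.inr ⟨q, hq, h⟩
    have h2 := Finset.card_le_card h1
    have h3 := Finset.card_union_le F (Q.biUnion N)
    have h4 := Finset.card_biUnion_le_card_mul Q N (2 * c h + 2) (fun q hq => by
      obtain ⟨t, hS, h'⟩ := hh q hq
      exact h'.2.2.2.2)
    omega

theorem lev_zero {T : List α} {Q : Finset ℕ} (f : Prop) (hA : Att0 T Q) :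
    ∃ F, Lev T Q f 0 0 F ∧ F.card ≤ Q.card := by
  classical
  refine ⟨Q.attach.image (fun q => leaf (T[q.1]'(hA.1 q.1 q.2))), ⟨?_, ?_⟩, ?_⟩
  · intro t ht
    obtain ⟨q, hq, rfl⟩ := Finset.mem_image.1 ht
    refine ⟨trivial, ?_⟩
    simp only [subs, Finset.singleton_subset_iff]; exact ht
  · intro q hq
    have hqn := hA.1 q hq
    refine ⟨leaf T[q], Finset.mem_image.2 ⟨⟨q, hq⟩, Finset.mem_attach _ _, rfl⟩, ?_, le_rfl⟩
    have : min T.length (q + 2^0) = q + 1 := by simp; omega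
    rw [this]
    apply List.ext_getElem?
    intro i
    rw [sb_get]
    rcases i with _ | i
    · simp [ex]
    · rw [if_neg (by simp)]; simp [ex]
  · exact Finset.card_image_le.trans (by simp)

theorem lev_iter {T : List α} {Q : Finset ℕ} {f : Prop} {c : ℕ → ℕ}
    (hA : Att0 T Q) (hE : Extr α f c) (hc : Monotone c) (K : ℕ) : ∀ k ≤ K,
    ∃ F, Lev T Q f k (3 * k) F ∧ F.card ≤ Q.card + k * (Q.card * (2 * c (3 * K) + 2)) := by
  intro k
  induction k with
  | zero => intro _; obtain ⟨F, h1, h2⟩ := lev_zero f hA; exact ⟨F, h1, by omega⟩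
  | succ k ih =>
    intro hk
    obtain ⟨F, h1, h2⟩ := ih (by omega)
    obtain ⟨F', h3, h4⟩ := lev_step hA h1 hE hc
    refine ⟨F', h3, ?_⟩
    have h5 : c (3 * k) ≤ c (3 * K) := hc (by omega)
    have h6 : Q.card * (2 * c (3 * k) + 2) ≤ Q.card * (2 * c (3 * K) + 2) :=
      Nat.mul_le_mul_left _ (by omega)
    rw [Nat.succ_mul]; omega

theorem build {T : List α} {Q : Finset ℕ} {f : Prop} {c : ℕ → ℕ} (hT : T ≠ [])
    (hA : Att0 T Q) (hE : Extr α f c) (hc : Monotone c) (K : ℕ) (hK : T.length ≤ Q.card * 2^K) :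
    ∃ t, good f t ∧ ex t = T ∧ (subs t).card ≤
      Q.card + K * (Q.card * (2 * c (3 * K) + 2)) + Q.card * (c (3 * K) + 1) := by
  classical
  obtain ⟨F, h1, h2⟩ := lev_iter hA hE hc K K le_rfl
  have hn : 0 < T.length := List.length_pos_iff.2 hT
  have hp1 : 0 < 2^K := by positivity
  have key : ∀ m, ∃ t, good f t ∧ ex t = sb T 0 (min T.length ((m + 1) * 2^K)) ∧
      ∃ N : Finset (CT α), (∀ s ∈ subs t, s ∈ F ∨ s ∈ N) ∧ N.card ≤ (m + 1) * (c (3 * K) + 1) := by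
    intro m
    induction m with
    | zero =>
      obtain ⟨t, g, e, _, N, s, cc⟩ := lev_ext hA h1 hE hc 0 (min T.length ((0 + 1) * 2^K))
        (by omega) (by omega) (by omega)
      exact ⟨t, g, e, N, s, by omega⟩
    | succ m ih =>
      obtain ⟨t, g, e, N, s, cc⟩ := ih
      have hm : (m + 1 + 1) * 2^K = (m + 1) * 2^K + 2^K := by ring
      obtain ⟨t', g', e', _, N', s', cc'⟩ := cat_right hA h1 hE hc 0 (min T.length ((m + 1) * 2^K))
        (min T.length ((m + 1 + 1) * 2^K)) (by omega) (by omega) (by omega) (by omega) t g e N s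
      refine ⟨t', g', e', N', s', ?_⟩
      rw [Nat.succ_mul (m+1)]; omega
  have hQ : 0 < Q.card := by
    rcases Nat.eq_zero_or_pos Q.card with h | h
    · rw [h] at hK; omega
    · exact h
  obtain ⟨m, hm⟩ : ∃ m, Q.card = m + 1 := ⟨Q.card - 1, by omega⟩
  obtain ⟨t, g, e, N, s, cc⟩ := key m
  rw [← hm] at e cc
  refine ⟨t, g, ?_, ?_⟩
  · rw [e, min_eq_left hK, sb_full]
  · have : subs t ⊆ F ∪ N := fun x hx => Finset.mem_union.2 (s x hx)
    have h3 := Finset.card_le_card this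
    have h4 := Finset.card_union_le F N
    omega
inductive Occ : CT α → CT α → ℕ → Prop
  | refl (t : CT α) : Occ t t 0
  | left {l r x : CT α} {o : ℕ} : Occ l x o → Occ (node l r) x o
  | right {l r x : CT α} {o : ℕ} : Occ r x o → Occ (node l r) x ((ex l).length + o)

theorem Occ.mem {t x : CT α} {o : ℕ} (h : Occ t x o) : x ∈ subs t := by
  induction h with
  | refl t => exact self_mem t
  | left _ ih => simp [subs, ih]
  | right _ ih => simp [subs, ih]

theorem Occ.len {t x : CT α} {o : ℕ} (h : Occ t x o) : o + (ex x).length ≤ (ex t).length := by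
  induction h with
  | refl t => omega
  | left _ ih => simp only [ex, List.length_append]; omega
  | right _ ih => simp only [ex, List.length_append]; omega

theorem Occ.get {t x : CT α} {o : ℕ} (h : Occ t x o) : ∀ i < (ex x).length,
    (ex t)[o + i]? = (ex x)[i]? := by
  induction h with
  | refl t => intro i _; simp
  | left h ih =>
    intro i hi
    have := h.len
    simp only [ex]
    rw [List.getElem?_append_left (by omega), ih i hi]
  | right h ih =>
    intro i hi
    simp only [ex]
    rw [List.getElem?_append_right (by omega), ← ih i hi]
    congr 1; omega

theorem Occ.disj {t x : CT α} {o o' : ℕ} (h : Occ t x o) (h' : Occ t x o') :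
    o = o' ∨ o + (ex x).length ≤ o' ∨ o' + (ex x).length ≤ o := by
  have self : ∀ {l r : CT α} {o : ℕ}, Occ l (node l r) o → False := by
    intro l r o h
    have := ht_sub h.mem
    simp only [ht] at this; omega
  have self' : ∀ {l r : CT α} {o : ℕ}, Occ r (node l r) o → False := by
    intro l r o h
    have := ht_sub h.mem
    simp only [ht] at this; omega
  induction h generalizing o' with
  | refl t =>
    cases h' with
    | refl => exact Or.inl rfl
    | left h => exact (self h).elim
    | right h => exact (self' h).elim
  | left h ih =>
    cases h' with
    | refl => exact (self h).elim
    | left h' => exact ih h'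
    | right h' => have := h.len; omega
  | right h ih =>
    cases h' with
    | refl => exact (self' h).elim
    | left h' => have := h'.len; omega
    | right h' => have := ih h'; omega

theorem lca (t : CT α) (hg : good False t) (a b : ℕ) (hab : a < b) (hb : b < (ex t).length) :
    ∃ x m o, Occ t x o ∧ (∃ l r, x = node l r ∧ m = (ex l).length) ∧
      o ≤ a ∧ a < o + m ∧ o + m ≤ b ∧ b < o + (ex x).length := by
  induction t generalizing a b with
  | leaf x => simp [ex] at hb; omega
  | slice t l r _ => exact hg.1.elim
  | node l r ihl ihr =>
    simp only [ex, List.length_append] at hb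
    by_cases h1 : b < (ex l).length
    · obtain ⟨x, m, o, h, h'⟩ := ihl hg.1 a b hab h1
      exact ⟨x, m, o, h.left, h'⟩
    · by_cases h2 : a < (ex l).length
      · refine ⟨node l r, _, 0, Occ.refl _, ⟨l, r, rfl, rfl⟩, by omega, by omega, by omega, ?_⟩
        simp only [ex, List.length_append]; omega
      · obtain ⟨x, m, o, h, h3, h'⟩ := ihr hg.2 (a - (ex l).length) (b - (ex l).length) (by omega) (by omega)
        exact ⟨x, m, _, h.right, h3, by omega, by omega, by omega, by omega⟩

theorem lzLen_pos (T : List α) (i : ℕ) : 1 ≤ lzLen T i := le_max_left _ _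

theorem lzLen_bdd (T : List α) (i : ℕ) : BddAbove {ℓ : ℕ | ∃ p : ℕ, 1 ≤ p ∧ p + ℓ ≤ i ∧ i + ℓ ≤ T.length + 1 ∧
    substr T p (p + ℓ - 1) = substr T i (i + ℓ - 1)} :=
  ⟨i, by rintro l ⟨p, h⟩; omega⟩

theorem lzLen_le (T : List α) (i : ℕ) (h1 : 1 ≤ i) (hi : i ≤ T.length) : i + lzLen T i ≤ T.length + 1 := by
  have : lzLen T i ≤ T.length + 1 - i := by
    apply max_le (by omega)
    by_cases hne : {ℓ : ℕ | ∃ p : ℕ, 1 ≤ p ∧ p + ℓ ≤ i ∧ i + ℓ ≤ T.length + 1 ∧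
      substr T p (p + ℓ - 1) = substr T i (i + ℓ - 1)}.Nonempty
    · apply csSup_le hne
      rintro l ⟨p, h⟩; omega
    · rw [Set.not_nonempty_iff_eq_empty.1 hne]; simp
  omega

theorem lzLen_max (T : List α) (a p : ℕ) (h1 : p + (lzLen T (a+1) + 1) ≤ a)
    (h2 : a + (lzLen T (a+1) + 1) ≤ T.length)
    (h : sb T p (p + (lzLen T (a+1) + 1)) = sb T a (a + (lzLen T (a+1) + 1))) : False := by
  have : lzLen T (a+1) + 1 ≤ lzLen T (a+1) := by
    refine le_trans ?_ (le_max_right _ _)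
    apply le_csSup (lzLen_bdd T (a+1))
    refine ⟨p + 1, by omega, by omega, by omega, ?_⟩
    rw [substr_eq_sb, substr_eq_sb]
    convert h using 2 <;> omega
  omega

theorem lzCount_le (t : CT α) (hg : good False t) : lzCount (ex t) ≤ (subs t).card + 1 := by
  classical
  set T := ex t with hT
  have hpos : ∀ k, 1 ≤ lzStart T k := by
    intro k
    induction k with
    | zero => simp [lzStart]
    | succ k ih => simp only [lzStart]; omega
  have hmono : StrictMono (lzStart T) := by
    apply strictMono_nat_of_lt_succ
    intro k
    have := lzLen_pos T (lzStart T k)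
    simp only [lzStart]; omega
  have hlt : ∀ k, k < lzCount T → lzStart T k ≤ T.length := by
    intro k
    induction k with
    | zero =>
      intro h
      have h1 := Nat.notMem_of_lt_sInf h
      simp only [Set.mem_ofPred_eq, lzStart] at h1 ⊢
      omega
    | succ k ih =>
      intro h
      have h1 := Nat.notMem_of_lt_sInf h
      simp only [Set.mem_ofPred_eq] at h1
      have h2 := lzLen_le T (lzStart T k) (hpos k) (ih (by omega))
      have h3 : lzStart T (k+1) = lzStart T k + lzLen T (lzStart T k) := rfl
      omega
  have key : ∀ k, ∃ y : Option (CT α), k + 1 < lzCount T → ∃ x m o, y = some x ∧ Occ t x o ∧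
      (∃ l r, x = node l r ∧ m = (ex l).length) ∧
      o ≤ lzStart T k - 1 ∧ lzStart T k - 1 < o + m ∧ o + m ≤ lzStart T (k+1) - 1 ∧
      lzStart T (k+1) - 1 < o + (ex x).length := by
    intro k
    by_cases hk : k + 1 < lzCount T
    · have h1 := hlt _ hk
      have h2 : lzStart T k < lzStart T (k+1) := hmono (Nat.lt_succ_self k)
      have h3 := hpos k
      obtain ⟨x, m, o, h⟩ := lca t hg (lzStart T k - 1) (lzStart T (k+1) - 1) (by omega) (by rw [← hT]; omega)
      exact ⟨some x, fun _ => ⟨x, m, o, rfl, h⟩⟩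
    · exact ⟨none, fun h => (hk h).elim⟩
  choose φ hφ using key
  have hinj : ∀ k k', k < k' → k' + 1 < lzCount T → φ k ≠ φ k' := by
    intro k k' hkk hk' heq
    obtain ⟨x, m, o, e1, oc, ⟨l, r, hx, hm⟩, h1, h2, h3, h4⟩ := hφ k (by omega)
    obtain ⟨x', m', o', e1', oc', ⟨l', r', hx', hm'⟩, h1', h2', h3', h4'⟩ := hφ k' hk'
    have hxx : x = x' := by rw [e1, e1'] at heq; exact Option.some.inj heq
    subst hxx
    have hmm : m = m' := by
      rw [hx] at hx'
      injection hx' with q1 q2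
      rw [hm, hm', q1]
    subst hmm
    have hle : lzStart T (k+1) ≤ lzStart T k' := hmono.monotone (by omega)
    have hp := hpos k
    have hp' := hpos k'
    have hs : lzStart T (k'+1) = lzStart T k' + lzLen T (lzStart T k') := rfl
    have hl := oc.len
    have hl' := oc'.len
    rcases oc.disj oc' with h | h | h
    · omega
    · obtain ⟨a, ha⟩ : ∃ a, lzStart T k' = a + 1 := ⟨_, (Nat.sub_add_cancel hp').symm⟩
      rw [ha] at hs
      rw [← hT] at hl hl'
      refine lzLen_max T a (o + (a - o')) (by omega) (by omega) ?_
      apply List.ext_getElem?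
      intro i
      rw [sb_get, sb_get]
      by_cases hi : i < lzLen T (a+1) + 1
      · rw [if_pos (by omega), if_pos (by omega)]
        have g1 := oc.get (a - o' + i) (by omega)
        have g2 := oc'.get (a - o' + i) (by omega)
        rw [← g2, ← hT] at g1
        convert g1 using 2 <;> omega
      · rw [if_neg (by omega), if_neg (by omega)]
    · omega
  have hcard : (Finset.range (lzCount T - 1)).card ≤ ((subs t).image some).card := by
    apply Finset.card_le_card_of_injOn φ
    · intro k hk
      have hk' : k < lzCount T - 1 := by simpa using hk
      obtain ⟨x, m, o, e1, oc, _⟩ := hφ k (by omega)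
      rw [e1]
      simpa using oc.mem
    · intro k hk k' hk' heq
      have hk1 : k < lzCount T - 1 := by simpa using hk
      have hk1' : k' < lzCount T - 1 := by simpa using hk'
      rcases lt_trichotomy k k' with h | h | h
      · exact (hinj k k' h (by omega) heq).elim
      · exact h
      · exact (hinj k' k h (by omega) heq.symm).elim
  have := hcard.trans Finset.card_image_le
  rw [Finset.card_range] at this
  omega

theorem minMacro_le {T : List α} {Q : Finset ℕ}
    (hA : Att0 T Q) (K : ℕ) (hK : T.length ≤ Q.card * 2^K) :
    minMacro T ≤ Q.card * (2 * K + 2) := by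
  classical
  have hsrc : ∀ a b, ∃ a', a < b → b ≤ T.length → ∃ q, q ∈ Q ∧ a' ≤ q ∧ q < a' + (b - a) ∧
    a' + (b - a) ≤ T.length ∧ sb T a' (a' + (b - a)) = sb T a b := by
    intro a b
    by_cases h : a < b ∧ b ≤ T.length
    · obtain ⟨a', h'⟩ := hA.2 a b h.1 h.2
      exact ⟨a', fun _ _ => h'⟩
    · exact ⟨0, fun h1 h2 => (h ⟨h1, h2⟩).elim⟩
  choose src hsrc using hsrc
  let S1 : Finset (ℕ × ℕ) := (Q ×ˢ Finset.range K).image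
    (fun p => (p.1 + 1 - 2^(p.2+1), p.1 + 1 - 2^p.2))
  let S2 : Finset (ℕ × ℕ) := (Q ×ˢ Finset.range K).image
    (fun p => (p.1 + 2^p.2, min T.length (p.1 + 2^(p.2+1))))
  let S3 : Finset (ℕ × ℕ) := (Finset.range Q.card).image
    (fun i => (i * 2^K, min T.length (i * 2^K + 2^K)))
  let S : Finset (ℕ × ℕ) := (S1 ∪ (S2 ∪ S3)).filter (fun p => p.1 < p.2)
  let dir : ℕ × ℕ → Directive α := fun p =>
    .copy (p.1 + 1) p.2 (src p.1 p.2 + 1) (src p.1 p.2 + (p.2 - p.1))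
  let M1 : Finset (Directive α) := Q.attach.image
    (fun q => .chr (q.1 + 1) (T[q.1]'(hA.1 q.1 q.2)))
  let M : Finset (Directive α) := M1 ∪ S.image dir
  have hS : ∀ p ∈ S, p.1 < p.2 ∧ p.2 ≤ T.length := by
    intro p hp
    simp only [S, S1, S2, S3, Finset.mem_filter, Finset.mem_union, Finset.mem_image, Finset.mem_product] at hp
    refine ⟨hp.2, ?_⟩
    rcases hp.1 with ⟨u, hu, rfl⟩ | ⟨u, hu, rfl⟩ | ⟨u, hu, rfl⟩
    · have := hA.1 _ hu.1
      have : 0 < 2^u.2 := by positivity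
      simp only; omega
    · simp
    · simp
  have hcard : M.card ≤ Q.card * (2 * K + 2) := by
    have c1 : M1.card ≤ Q.card := Finset.card_image_le.trans (by simp)
    have c2 : S1.card ≤ Q.card * K := Finset.card_image_le.trans (by simp)
    have c3 : S2.card ≤ Q.card * K := Finset.card_image_le.trans (by simp)
    have c4 : S3.card ≤ Q.card := Finset.card_image_le.trans (by simp)
    have c5 : S.card ≤ (S1 ∪ (S2 ∪ S3)).card := Finset.card_filter_le _ _
    have c6 := Finset.card_union_le S1 (S2 ∪ S3)
    have c7 := Finset.card_union_le S2 S3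
    have c8 : (S.image dir).card ≤ S.card := Finset.card_image_le
    have c9 : M.card ≤ _ := Finset.card_union_le M1 (S.image dir)
    have : Q.card * (2 * K + 2) = Q.card * K + Q.card * K + Q.card + Q.card := by ring
    omega
  have hchr : ∀ (T' : List α) (q : ℕ) (hq : q < T.length),
      substr T' (q+1) (q+1) = [T[q]] ↔ T'[q]? = T[q]? := by
    intro T' q hq
    rw [substr_eq_sb]
    have e : (sb T' q (q+1))[0]? = T'[q]? := by rw [sb_get]; simp
    constructor
    · intro h
      rw [h] at e
      rw [← e]; simp [hq]
    · intro h
      rw [h] at e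
      apply List.ext_getElem?
      intro i
      rcases i with _ | i
      · rw [e]; simp [hq]
      · rw [sb_get, if_neg (by omega)]; simp
  have hM : IsMacroScheme T M := by
    refine ⟨?_, ?_, ?_⟩
    · intro d hd
      rcases Finset.mem_union.1 hd with hd | hd
      · obtain ⟨q, _, rfl⟩ := Finset.mem_image.1 hd
        have := hA.1 q.1 q.2
        exact ⟨by omega, by omega⟩
      · obtain ⟨p, hp, rfl⟩ := Finset.mem_image.1 hd
        obtain ⟨h1, h2⟩ := hS p hp
        obtain ⟨q, h3, h4, h5, h6, _⟩ := hsrc p.1 p.2 h1 h2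
        simp only [dir, DirOk]
        omega
    · intro d hd
      rcases Finset.mem_union.1 hd with hd | hd
      · obtain ⟨q, _, rfl⟩ := Finset.mem_image.1 hd
        exact (hchr T q.1 (hA.1 q.1 q.2)).2 rfl
      · obtain ⟨p, hp, rfl⟩ := Finset.mem_image.1 hd
        obtain ⟨h1, h2⟩ := hS p hp
        obtain ⟨q, h3, h4, h5, h6, h7⟩ := hsrc p.1 p.2 h1 h2
        simp only [dir, Consistent]
        rw [substr_eq_sb, substr_eq_sb, h7]
    · intro T' hlen hT'
      have main : ∀ d x q, q ∈ Q → x < T.length → x ≤ q + d → q ≤ x + d → T'[x]? = T[x]? := by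
        intro d
        induction d using Nat.strong_induction_on with
        | _ d ih =>
        intro x q hq hx hxq hqx
        have hqn := hA.1 q hq
        by_cases hd : (x < q + d ∧ q < x + d)
        · exact ih (d-1) (by omega) x q hq hx (by omega) (by omega)
        have step : ∀ a b, (a, b) ∈ S1 ∪ (S2 ∪ S3) → a ≤ x → x < b → b - a ≤ d →
            T'[x]? = T[x]? := by
          intro a b hab h1 h2 h3
          have hab' : (a, b) ∈ S := Finset.mem_filter.2 ⟨hab, by simp only; omega⟩
          obtain ⟨h4, h5⟩ := hS _ hab'
          simp only at h4 h5
          obtain ⟨q', h6, h7, h8, h9, h10⟩ := hsrc a b h4 h5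
          have hcons := hT' (dir (a, b)) (Finset.mem_union_right _ (Finset.mem_image_of_mem _ hab'))
          simp only [dir, Consistent] at hcons
          rw [substr_eq_sb, substr_eq_sb] at hcons
          have e1 := congrArg (fun L => L[x - a]?) hcons
          have e2 := congrArg (fun L => L[x - a]?) h10
          simp only [sb_get] at e1 e2
          rw [if_pos (by omega), if_pos (by omega), Nat.add_sub_cancel' h1] at e1 e2
          rw [e1, ← e2]
          exact ih (d-1) (by omega) _ q' h6 (by omega) (by omega) (by omega)
        rcases Nat.eq_zero_or_pos d with h0 | h0
        · have : x = q := by omega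
          subst this
          have := hT' (.chr (x+1) T[x]) (Finset.mem_union_left _
            (Finset.mem_image.2 ⟨⟨x, hq⟩, Finset.mem_attach _ _, rfl⟩))
          exact (hchr T' x hx).1 this
        · have hk1 : 2^(Nat.log 2 d) ≤ d := Nat.pow_log_le_self 2 (by omega)
          have hk2 : d < 2^(Nat.log 2 d + 1) := Nat.lt_pow_succ_log_self (by omega) d
          have hk3 : 2^(Nat.log 2 d + 1) = 2 * 2^(Nat.log 2 d) := by rw [pow_succ]; ring
          generalize Nat.log 2 d = k at *
          by_cases hkK : k < K
          · by_cases hside : q + d ≤ x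
            · refine step (q + 2^k) (min T.length (q + 2^(k+1))) ?_ (by omega) (by omega) (by omega)
              refine Finset.mem_union_right _ (Finset.mem_union_left _ ?_)
              exact Finset.mem_image.2 ⟨(q, k), by simp [hq, hkK], rfl⟩
            · refine step (q + 1 - 2^(k+1)) (q + 1 - 2^k) ?_ (by omega) (by omega) (by omega)
              refine Finset.mem_union_left _ ?_
              exact Finset.mem_image.2 ⟨(q, k), by simp [hq, hkK], rfl⟩
          · have hp : 2^K ≤ 2^k := Nat.pow_le_pow_right (by omega) (by omega)
            have hp0 : 0 < 2^K := by positivity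
            have hdm := Nat.div_add_mod x (2^K)
            have hml := Nat.mod_lt x hp0
            rw [mul_comm] at hdm
            have hdl : x / 2^K < Q.card := by
              rw [Nat.div_lt_iff_lt_mul hp0]; omega
            refine step (x / 2^K * 2^K) (min T.length (x / 2^K * 2^K + 2^K)) ?_ (by omega) (by omega) (by omega)
            refine Finset.mem_union_right _ (Finset.mem_union_right _ ?_)
            exact Finset.mem_image.2 ⟨x / 2^K, by simpa using hdl, rfl⟩
      apply List.ext_getElem?
      intro x
      by_cases hx : x < T.length
      · obtain ⟨_, q, hq, _⟩ := hA.2 x (x+1) (by omega) (by omega)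
        exact main (x + q) x q hq hx (by omega) (by omega)
      · rw [List.getElem?_eq_none (by omega), List.getElem?_eq_none (by omega)]
  exact (Nat.sInf_le ⟨M, hM, rfl⟩ : minMacro T ≤ M.card).trans hcard

theorem exists_att (T : List α) : ∃ Q : Finset ℕ, Att0 T Q ∧ Q.card = minAttr T := by
  classical
  have hne : {m | ∃ Γ : Finset ℕ, IsAttractor T Γ ∧ Γ.card = m}.Nonempty := by
    refine ⟨_, Finset.Icc 1 T.length, ⟨fun p hp => Finset.mem_Icc.1 hp, ?_⟩, rfl⟩
    intro i j h1 h2 h3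
    exact ⟨i, j, i, h1, h2, h3, rfl, Finset.mem_Icc.2 ⟨h1, by omega⟩, le_rfl, h2⟩
  obtain ⟨Γ, hΓ, hc⟩ := Nat.sInf_mem hne
  refine ⟨Γ.image (fun p => p - 1), ⟨?_, ?_⟩, ?_⟩
  · intro q hq
    obtain ⟨p, hp, rfl⟩ := Finset.mem_image.1 hq
    have := hΓ.1 p hp
    omega
  · intro a b hab hb
    obtain ⟨i', j', p, h1, h2, h3, h4, h5, h6, h7⟩ := hΓ.2 (a+1) b (by omega) (by omega) hb
    obtain ⟨a', rfl⟩ : ∃ a', i' = a' + 1 := ⟨i' - 1, by omega⟩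
    rw [substr_eq_sb, substr_eq_sb] at h4
    have hl := congrArg List.length h4
    rw [sb_length _ _ _ h3, sb_length _ _ _ hb] at hl
    have hj : j' = a' + (b - a) := by omega
    subst hj
    exact ⟨a', p - 1, Finset.mem_image_of_mem _ h5, by omega, by omega, h3, h4⟩
  · rw [Finset.card_image_of_injOn]
    · exact hc
    · intro p hp p' hp' h
      have h1 := (hΓ.1 p hp).1
      have h2 := (hΓ.1 p' hp').1
      simp only at h; omega

end Helpers

/-- approximation rates of dictionary compressors with respect to
the smallest string attractor: `b*, c* ∈ O(γ* log(n/γ*))` and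
`g*, g_rl*, z ∈ O(γ* log²(n/γ*))`, with a single absolute constant `C`. -/
theorem compressors_vs_smallest_attractor :
    ∃ C : ℝ, 0 < C ∧ ∀ (α : Type u) (T : List α), T ≠ [] →
      ((minMacro T : ℝ) ≤ C * (minAttr T : ℝ) * (1 + Real.logb 2 ((T.length : ℝ) / (minAttr T : ℝ))) ∧
       (minCollage T : ℝ) ≤ C * (minAttr T : ℝ) * (1 + Real.logb 2 ((T.length : ℝ) / (minAttr T : ℝ))) ∧
       (minSLP T : ℝ) ≤ C * (minAttr T : ℝ) * (1 + Real.logb 2 ((T.length : ℝ) / (minAttr T : ℝ))) ^ 2 ∧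
       (minRLSLP T : ℝ) ≤ C * (minAttr T : ℝ) * (1 + Real.logb 2 ((T.length : ℝ) / (minAttr T : ℝ))) ^ 2 ∧
       (lzCount T : ℝ) ≤ C * (minAttr T : ℝ) * (1 + Real.logb 2 ((T.length : ℝ) / (minAttr T : ℝ))) ^ 2) := by
  refine ⟨100, by norm_num, ?_⟩
  intro α T hT
  obtain ⟨Q, hA, hQ⟩ := exists_att T
  have hn : 0 < T.length := List.length_pos_iff.2 hT
  have hQ0 : 0 < Q.card := by
    obtain ⟨_, q, hq, _⟩ := hA.2 0 1 (by omega) (by omega)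
    exact Finset.card_pos.2 ⟨q, hq⟩
  have hQn : Q.card ≤ T.length := by
    have : Q ⊆ Finset.range T.length := fun q hq => Finset.mem_range.2 (hA.1 q hq)
    simpa using Finset.card_le_card this
  rw [← hQ]
  have hγ : (1:ℝ) ≤ (Q.card : ℝ) := by exact_mod_cast hQ0
  have hγn : (Q.card : ℝ) ≤ (T.length : ℝ) := by exact_mod_cast hQn
  obtain ⟨K, hK, hKL⟩ : ∃ K : ℕ, T.length ≤ Q.card * 2^K ∧
      (K : ℝ) ≤ 1 + Real.logb 2 ((T.length : ℝ) / (Q.card : ℝ)) := by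
    have hex : ∃ K : ℕ, T.length ≤ Q.card * 2^K :=
      ⟨T.length, by nlinarith [(Nat.lt_two_pow_self : T.length < 2^T.length)]⟩
    classical
    refine ⟨Nat.find hex, Nat.find_spec hex, ?_⟩
    have hL0 : 0 ≤ Real.logb 2 ((T.length : ℝ) / (Q.card : ℝ)) :=
      Real.logb_nonneg (by norm_num) (by rw [le_div_iff₀ (by linarith)]; linarith)
    rcases Nat.eq_zero_or_pos (Nat.find hex) with h | h
    · rw [h]; push_cast; linarith
    · have h1 := Nat.find_min hex (Nat.sub_lt h one_pos)
      obtain ⟨k, hk⟩ : ∃ k, Nat.find hex = k + 1 := ⟨_, (Nat.sub_add_cancel h).symm⟩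
      rw [hk] at h1 ⊢
      simp only [Nat.add_sub_cancel, not_le] at h1
      have h2 : (Q.card : ℝ) * 2^k < T.length := by exact_mod_cast h1
      have h3 : (k : ℝ) ≤ Real.logb 2 ((T.length : ℝ) / (Q.card : ℝ)) := by
        rw [Real.le_logb_iff_rpow_le (by norm_num) (by apply div_pos <;> linarith), Real.rpow_natCast,
          le_div_iff₀ (by linarith)]
        linarith
      push_cast; linarith
  set L := Real.logb 2 ((T.length : ℝ) / (Q.card : ℝ)) with hL
  have hL0 : 0 ≤ L :=
    Real.logb_nonneg (by norm_num) (by rw [le_div_iff₀ (by linarith)]; linarith)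
  have hK0 : (0:ℝ) ≤ K := Nat.cast_nonneg K
  obtain ⟨g, hg⟩ : ∃ g : ℝ, (Q.card : ℝ) = g := ⟨_, rfl⟩
  have hKK : (K:ℝ) + 1 ≤ 2 * (1 + L) := by linarith
  have hsq : ((K:ℝ) + 1)^2 ≤ 4 * (1 + L)^2 := by nlinarith
  have hsq1 : 1 ≤ (1 + L)^2 := by nlinarith
  obtain ⟨t1, g1, e1, c1⟩ := build hT hA CT.extr_col (fun _ _ _ => le_rfl) K hK
  obtain ⟨t2, g2, e2, c2⟩ := build hT hA CT.extr_slp (fun a b h => Nat.mul_le_mul_left 2 h) K hK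
  have m0 := minMacro_le hA K hK
  have m1 := (CT.minCollage_le t1 g1).trans c1
  have m2 := (CT.minSLP_le t2 g2).trans c2
  have m3 := (CT.minRLSLP_le t2 g2).trans c2
  have m4 := (lzCount_le t2 g2).trans (Nat.add_le_add_right c2 1)
  rw [e1] at m1
  rw [e2] at m2 m3 m4
  have r0 : (minMacro T : ℝ) ≤ g * (2 * K + 2) := by rw [← hg]; exact_mod_cast m0
  have r1 : (minCollage T : ℝ) ≤ g + K * (g * (2 * 1 + 2)) + g * (1 + 1) := by rw [← hg]; exact_mod_cast m1
  have r2 : (minSLP T : ℝ) ≤ g + K * (g * (2 * (2 * (3 * K)) + 2)) + g * (2 * (3 * K) + 1) := by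
    rw [← hg]; exact_mod_cast m2
  have r3 : (minRLSLP T : ℝ) ≤ g + K * (g * (2 * (2 * (3 * K)) + 2)) + g * (2 * (3 * K) + 1) := by
    rw [← hg]; exact_mod_cast m3
  have r4 : (lzCount T : ℝ) ≤ g + K * (g * (2 * (2 * (3 * K)) + 2)) + g * (2 * (3 * K) + 1) + 1 := by
    rw [← hg]; exact_mod_cast m4
  clear m0 m1 m2 m3 m4 c1 c2 e1 e2 g1 g2 hK
  rw [hg] at hγ ⊢
  clear_value L
  generalize (minMacro T : ℝ) = x0 at *
  generalize (minCollage T : ℝ) = x1 at *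
  generalize (minSLP T : ℝ) = x2 at *
  generalize (minRLSLP T : ℝ) = x3 at *
  generalize (lzCount T : ℝ) = x4 at *
  generalize (K : ℝ) = k at *
  have b1 : g * (k + 1) ≤ g * (2 * (1 + L)) := mul_le_mul_of_nonneg_left hKK (by linarith)
  have b2 : g * (k + 1)^2 ≤ g * (4 * (1 + L)^2) := mul_le_mul_of_nonneg_left hsq (by linarith)
  have b3 : g + k * (g * (2 * (2 * (3 * k)) + 2)) + g * (2 * (3 * k) + 1) ≤ 12 * (g * (k + 1)^2) := by
    have : 0 ≤ g * k := mul_nonneg (by linarith) hK0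
    nlinarith
  have b4 : 1 ≤ g * (1 + L)^2 := by nlinarith
  have b5 : 0 ≤ g * (1 + L) := mul_nonneg (by linarith) (by linarith)
  refine ⟨?_, ?_, ?_, ?_, ?_⟩
  · linarith [mul_assoc 100 g (1 + L)]
  · linarith [mul_assoc 100 g (1 + L), mul_left_comm k g 4]
  · linarith [mul_assoc 100 g ((1 + L)^2)]
  · linarith [mul_assoc 100 g ((1 + L)^2)]
  · linarith [mul_assoc 100 g ((1 + L)^2)]
end

section
/- For every nonempty string X, every k ≥ 1 and every integer t ≥ 1, γ_k*(X^t) ≤ γ_k*(X) + 1, where X^t denotes the concatenation of t copies of X and γ_k*(·) denotes the minimum size of a k-attractor. -/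
universe u

variable {α : Type*}

/-- `Γ` is a `k`-attractor of `T`: every nonempty substring `T[i..j]` with
`j - i + 1 ≤ k` has an occurrence crossing a position of `Γ`. -/
def IsKAttractor (k : ℕ) (T : List α) (Γ : Finset ℕ) : Prop :=
  (∀ p ∈ Γ, 1 ≤ p ∧ p ≤ T.length) ∧
  ∀ i j : ℕ, 1 ≤ i → i ≤ j → j ≤ T.length → j + 1 ≤ i + k →
    ∃ i' j' p : ℕ, 1 ≤ i' ∧ i' ≤ j' ∧ j' ≤ T.length ∧
      substr T i' j' = substr T i j ∧ p ∈ Γ ∧ i' ≤ p ∧ p ≤ j'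

/-- `minKAttr k T` is the minimum size `γ_k*(T)` of a `k`-attractor of `T`. -/
noncomputable def minKAttr (k : ℕ) (T : List α) : ℕ :=
  sInf {m | ∃ Γ : Finset ℕ, IsKAttractor k T Γ ∧ Γ.card = m}

theorem substr_append_right (A B : List α) (i j : ℕ) (hi : 1 ≤ i) :
    substr (A ++ B) (i + A.length) (j + A.length) = substr B i j := by
  unfold substr
  have h1 : i + A.length - 1 = A.length + (i - 1) := by omega
  have h2 : j + A.length + 1 - (i + A.length) = j + 1 - i := by omega
  rw [h1, h2, List.drop_append, List.drop_eq_nil_of_le (Nat.le_add_right _ _)]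
  simp

theorem substr_append_left (A B : List α) (i j : ℕ) (hi : 1 ≤ i) (hj : j ≤ A.length) :
    substr (A ++ B) i j = substr A i j := by
  unfold substr
  rw [List.drop_append, List.take_append]
  have h : j + 1 - i - (A.drop (i - 1)).length = 0 := by
    rw [List.length_drop]; omega
  rw [h]; simp

theorem isKAttractor_power (X : List α) (hX : X ≠ []) (k t : ℕ) (ht : 1 ≤ t)
    (Γ : Finset ℕ) (h : IsKAttractor k X Γ) :
    IsKAttractor k ((List.replicate t X).flatten) (insert X.length Γ) := by
  have hn : 0 < X.length := List.length_pos_iff.mpr hX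
  have hlen : ∀ s, ((List.replicate s X).flatten).length = s * X.length := by
    intro s; simp
  have hle : X.length ≤ t * X.length := Nat.le_mul_of_pos_left _ ht
  have hadd : ∀ a b, (List.replicate (a + b) X).flatten
      = (List.replicate a X).flatten ++ (List.replicate b X).flatten := by
    intro a b; rw [List.replicate_add, List.flatten_append]
  obtain ⟨h1, h2⟩ := h
  refine ⟨?_, ?_⟩
  · intro p hp
    rw [hlen]
    rcases Finset.mem_insert.mp hp with rfl | hp
    · exact ⟨hn, hle⟩
    · exact ⟨(h1 p hp).1, (h1 p hp).2.trans hle⟩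
  · intro i j hi hij hj hk
    rw [hlen] at hj ⊢
    obtain ⟨q, r, hr1, hr2, rfl⟩ : ∃ q r, 1 ≤ r ∧ r ≤ X.length ∧ i = r + q * X.length := by
      refine ⟨(i - 1) / X.length, (i - 1) % X.length + 1, by omega, Nat.mod_lt _ hn, ?_⟩
      have := Nat.mod_add_div' (i - 1) X.length
      omega
    obtain ⟨m, rfl⟩ : ∃ m, j = m + q * X.length := ⟨j - q * X.length, by omega⟩
    have hqt : q < t := by
      by_contra hc
      have := Nat.mul_le_mul_right X.length (not_lt.mp hc)
      omega
    obtain ⟨s, rfl⟩ : ∃ s, t = q + (s + 1) := ⟨t - q - 1, by omega⟩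
    have hm : m ≤ (s + 1) * X.length := by
      rw [Nat.add_mul q] at hj; omega
    have e1 : substr (List.replicate (q + (s + 1)) X).flatten (r + q * X.length)
        (m + q * X.length) = substr (List.replicate (s + 1) X).flatten r m := by
      rw [hadd, ← hlen q]; exact substr_append_right _ _ _ _ hr1
    have e2 : ∀ a b, 1 ≤ a → b ≤ X.length →
        substr (List.replicate (s + 1) X).flatten a b = substr X a b := by
      intro a b ha hb
      rw [List.replicate_succ, List.flatten_cons]
      exact substr_append_left _ _ _ _ ha hb
    have e3 : ∀ a b, 1 ≤ a → b ≤ (s + 1) * X.length →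
        substr (List.replicate (q + (s + 1)) X).flatten a b
          = substr (List.replicate (s + 1) X).flatten a b := by
      intro a b ha hb
      rw [Nat.add_comm q, hadd]
      exact substr_append_left _ _ _ _ ha (by rw [hlen]; exact hb)
    rw [e1]
    have hle' : X.length ≤ (s + 1) * X.length := Nat.le_mul_of_pos_left _ (by omega)
    by_cases hmn : m ≤ X.length
    · obtain ⟨i', j', p, a1, a2, a3, a4, a5, a6, a7⟩ :=
        h2 r m hr1 (by omega) hmn (by omega)
      refine ⟨i', j', p, a1, a2, by omega, ?_, Finset.mem_insert_of_mem a5, a6, a7⟩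
      rw [e3 _ _ a1 (by omega), e2 _ _ a1 a3, e2 _ _ hr1 hmn, a4]
    · exact ⟨r, m, X.length, hr1, by omega, by omega, e3 _ _ hr1 hm,
        Finset.mem_insert_self _ _, hr2, by omega⟩

/-- for every nonempty string `X`, every `k ≥ 1` and `t ≥ 1`,
`γ_k*(X^t) ≤ γ_k*(X) + 1`, where `X^t` is the concatenation of `t` copies of `X`. -/
theorem kattractor_power (X : List α) (hX : X ≠ []) (k t : ℕ) (hk : 1 ≤ k) (ht : 1 ≤ t) :
    minKAttr k ((List.replicate t X).flatten) ≤ minKAttr k X + 1 := by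
  have hne : {m | ∃ Γ : Finset ℕ, IsKAttractor k X Γ ∧ Γ.card = m}.Nonempty := by
    refine ⟨_, Finset.Icc 1 X.length, ⟨fun p hp => Finset.mem_Icc.mp hp, ?_⟩, rfl⟩
    intro i j hi hij hj _
    exact ⟨i, j, i, hi, hij, hj, rfl, Finset.mem_Icc.mpr ⟨hi, by omega⟩, le_rfl, hij⟩
  obtain ⟨Γ, hΓ, hc⟩ := Nat.sInf_mem hne
  have h := isKAttractor_power X hX k t ht Γ hΓ
  have hmin : minKAttr k ((List.replicate t X).flatten) ≤ (insert X.length Γ).card :=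
    Nat.sInf_le ⟨_, h, rfl⟩
  have hcard := Finset.card_insert_le X.length Γ
  have hc' : Γ.card = minKAttr k X := hc
  omega
end

section
/- Let T be a string of length n and let 1 ≤ k ≤ n. Then γ_k*(T) ≤ σ_k(T²), where T² is the concatenation of two copies of T, σ_k(T²) is the number of distinct substrings of T² of length k, and γ_k*(T) is the minimum size of a k-attractor of T. In particular, the set of starting positions of the leftmost occurrences in T² of the distinct length-k substrings of T² yields a k-attractor of T of size σ_k(T²). -/
universe u

variable {α : Type*}

/-- `sigmaK k S` is the number of distinct substrings of `S` of length `k`. -/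
noncomputable def sigmaK (k : ℕ) (S : List α) : ℕ :=
  {W : List α | W.length = k ∧ W <:+: S}.ncard

/-- The set of 1-based starting positions of the leftmost occurrences in `S` of
the distinct length-`k` substrings of `S`. -/
def leftmostStarts (k : ℕ) (S : List α) : Set ℕ :=
  {i | 1 ≤ i ∧ i + k ≤ S.length + 1 ∧
    ∀ i' : ℕ, 1 ≤ i' → i' < i → substr S i' (i' + k - 1) ≠ substr S i (i + k - 1)}

lemma substr_k (S : List α) (i k : ℕ) (hi : 1 ≤ i) (hk : 1 ≤ k) :
    substr S i (i + k - 1) = (S.drop (i - 1)).take k := by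
  unfold substr
  congr 1
  omega

lemma take_drop_app (T U : List α) (m l : ℕ) (h : m + l ≤ T.length) :
    ((T ++ U).drop m).take l = (T.drop m).take l := by
  rw [List.drop_append_of_le_length (by omega), List.take_append_of_le_length (by simp; omega)]

lemma leftmost_le (T : List α) (k : ℕ) (hk : 1 ≤ k) (p : ℕ)
    (hp : p ∈ leftmostStarts k (T ++ T)) : 1 ≤ p ∧ p ≤ T.length := by
  obtain ⟨h1, h2, h3⟩ := hp
  refine ⟨h1, ?_⟩
  by_contra hlt
  push Not at hlt
  simp only [List.length_append] at h2
  apply h3 (p - T.length) (by omega) (by omega)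
  rw [substr_k _ _ _ (by omega) hk, substr_k _ _ _ h1 hk, take_drop_app _ _ _ _ (by omega)]
  have : p - 1 = T.length + (p - T.length - 1) := by omega
  rw [this, List.drop_length_add_append]

lemma leftmost_card (S : List α) (k : ℕ) (hk : 1 ≤ k) :
    (leftmostStarts k S).ncard = sigmaK k S := by
  unfold sigmaK
  refine Set.ncard_congr (fun i _ => substr S i (i + k - 1)) ?_ ?_ ?_
  · rintro i ⟨h1, h2, h3⟩
    simp only [Set.mem_setOf_eq]
    rw [substr_k _ _ _ h1 hk]
    refine ⟨by simp; omega, ?_⟩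
    exact (List.take_prefix _ _).isInfix.trans (List.drop_suffix _ _).isInfix
  · rintro i j ⟨h1, h2, h3⟩ ⟨g1, g2, g3⟩ h
    rcases lt_trichotomy i j with hl | hl | hl
    · exact absurd h (g3 i h1 hl)
    · exact hl
    · exact absurd h.symm (h3 j g1 hl)
  · rintro W ⟨hW, s, t, rfl⟩
    classical
    have hex : ∃ i, 1 ≤ i ∧ substr (s ++ W ++ t) i (i + k - 1) = W := by
      refine ⟨s.length + 1, by omega, ?_⟩
      rw [substr_k _ _ _ (by omega) hk]
      simp [← hW]
    obtain ⟨h1, h2⟩ := Nat.find_spec hex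
    refine ⟨Nat.find hex, ⟨h1, ?_, ?_⟩, h2⟩
    · have := congrArg List.length h2
      rw [substr_k _ _ _ h1 hk, List.length_take, List.length_drop] at this
      omega
    · intro i' hi' hlt he
      exact Nat.find_min hex hlt ⟨hi', he.trans h2⟩

lemma leftmost_attr (T : List α) (k : ℕ) (hk : 1 ≤ k) (hkn : k ≤ T.length) (Γ : Finset ℕ)
    (hΓ : (Γ : Set ℕ) = leftmostStarts k (T ++ T)) : IsKAttractor k T Γ := by
  have hm : ∀ p, p ∈ Γ ↔ p ∈ leftmostStarts k (T ++ T) := by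
    intro p
    rw [← hΓ, Finset.mem_coe]
  refine ⟨fun p hp => leftmost_le T k hk p ((hm p).1 hp), ?_⟩
  intro i j hi hij hj hjk
  classical
  obtain ⟨l, rfl⟩ : ∃ l, j = i + l - 1 := ⟨j + 1 - i, by omega⟩
  have hl : 1 ≤ l := by omega
  have hex : ∃ a, 1 ≤ a ∧ substr (T ++ T) a (a + l - 1) = substr T i (i + l - 1) := by
    refine ⟨i, hi, ?_⟩
    rw [substr_k _ _ _ hi hl, substr_k _ _ _ hi hl, take_drop_app _ _ _ _ (by omega)]
  have hle : Nat.find hex ≤ i := by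
    apply Nat.find_min'
    refine ⟨hi, ?_⟩
    rw [substr_k _ _ _ hi hl, substr_k _ _ _ hi hl, take_drop_app _ _ _ _ (by omega)]
  obtain ⟨h1, h2⟩ := Nat.find_spec hex
  have hmin := fun m => @Nat.find_min _ _ hex m
  generalize Nat.find hex = a at *
  refine ⟨a, a + l - 1, a, h1, by omega, by omega, ?_, ?_, le_rfl, by omega⟩
  · rw [← h2, substr_k _ _ _ h1 hl, substr_k _ _ _ h1 hl, take_drop_app _ _ _ _ (by omega)]
  · rw [hm]
    refine ⟨h1, by simp only [List.length_append]; omega, ?_⟩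
    intro b hb hba he
    apply hmin b hba
    refine ⟨hb, ?_⟩
    rw [← h2]
    rw [substr_k _ _ _ hb hk, substr_k _ _ _ h1 hk] at he
    rw [substr_k _ _ _ hb hl, substr_k _ _ _ h1 hl]
    have := congrArg (List.take l) he
    rwa [List.take_take, List.take_take, min_eq_left (by omega)] at this

/-- `γ_k*(T) ≤ σ_k(T²)`; in particular the set of starting
positions of the leftmost occurrences in `T²` of the distinct length-`k`
substrings of `T²` is a `k`-attractor of `T` of size `σ_k(T²)`. -/
theorem kattractor_le_sigma (T : List α) (k : ℕ) (hk : 1 ≤ k) (hkn : k ≤ T.length) :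
    minKAttr k T ≤ sigmaK k (T ++ T) ∧
    ∃ Γ : Finset ℕ, (Γ : Set ℕ) = leftmostStarts k (T ++ T) ∧
      IsKAttractor k T Γ ∧ Γ.card = sigmaK k (T ++ T) := by
  have hfin : (leftmostStarts k (T ++ T)).Finite :=
    (Set.finite_Icc 1 T.length).subset (fun p hp => leftmost_le T k hk p hp)
  have hΓ : (hfin.toFinset : Set ℕ) = leftmostStarts k (T ++ T) := hfin.coe_toFinset
  have hA := leftmost_attr T k hk hkn _ hΓ
  have hc : hfin.toFinset.card = sigmaK k (T ++ T) := by
    rw [← leftmost_card _ _ hk, Set.ncard_eq_toFinset_card _ hfin]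
  exact ⟨Nat.sInf_le ⟨_, hA, hc⟩, _, hΓ, hA, hc⟩
end
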